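/- Let m = m(n) be a sequence of integers with min{m, C(n,2) − m} / log n → ∞ as n → ∞. Then the models D(G(n,m)) and B_m(n) are asymptotically quite equivalent: for every constant c > 0 and every sequence of events H_n (sets of integer sequences of length n) such that, for all sufficiently large n, Pr(H_n) ≥ n^{−c} holds in at least one of the two models, one has Pr_{D(G(n,m))}(H_n) / Pr_{B_m}(H_n) → 1 as n → ∞. -/

import Mathlib

open Finset

noncomputable section

/-- Simple graphs on vertex set `[n]`, encoded as finsets of non-diagonal unordered pairs. -/
def Graphs (n : ℕ) : Finset (Finset (Sym2 (Fin n))) :=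
  Finset.univ.filter (fun E => ∀ e ∈ E, ¬ e.IsDiag)

/-- Degree of vertex `i` in the graph `E`. -/
def deg {n : ℕ} (E : Finset (Sym2 (Fin n))) (i : Fin n) : ℕ :=
  (E.filter (fun e => i ∈ e)).card

/-- `Pr_{B_m}(D)`: probability of `D` for `n` independent `Bin(n-1,p)` variables conditioned
on the sum being `2m` (independent of `p`). -/
def prB (n m : ℕ) (D : Fin n → ℕ) : ℝ :=
  if ∑ i, D i = 2 * m then
    (∏ i, ((n - 1).choose (D i) : ℝ)) / ((n * (n - 1)).choose (2 * m) : ℝ)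
  else 0

open scoped Classical in
/-- Probability, in `D(G(n,m))`, of the event `H` (a set of degree sequences). -/
def prGEvent (n m : ℕ) (H : Set (Fin n → ℕ)) : ℝ :=
  (((Graphs n).filter (fun E => E.card = m ∧ (fun i => deg E i) ∈ H)).card : ℝ) /
    (((Graphs n).filter (fun E => E.card = m)).card : ℝ)

open scoped Classical in
/-- Probability, in the model `B_m(n)`, of the event `H`.  (All sequences of positive
probability have entries at most `n - 1`, so the sum below covers the whole support.) -/
def prBEvent (n m : ℕ) (H : Set (Fin n → ℕ)) : ℝ :=
  ∑ f : Fin n → Fin n,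
    if (fun i => (f i : ℕ)) ∈ H then prB n m (fun i => (f i : ℕ)) else 0

lemma mll {a b c : ℝ} (h : b ≤ c) (h0 : 0 ≤ a) : a*b ≤ a*c := mul_le_mul_of_nonneg_left h h0
lemma mlr {a b c : ℝ} (h : b ≤ c) (h0 : 0 ≤ a) : b*a ≤ c*a := mul_le_mul_of_nonneg_right h h0

/-- degree sequences with sum `M` -/
def Wt (n M : ℕ) : Finset (Fin n → ℕ) := Finset.piAntidiag univ M
def wt (n : ℕ) (D : Fin n → ℕ) : ℝ := ∏ i, ((n - 1).choose (D i) : ℝ)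
def GD (n : ℕ) (D : Fin n → ℕ) : Finset (Finset (Sym2 (Fin n))) :=
  (Graphs n).filter (fun E => ∀ i, deg E i = D i)
def NN (n : ℕ) (D : Fin n → ℕ) : ℝ := ((GD n D).card : ℝ)
def mu (n m : ℕ) (D : Fin n → ℕ) : ℝ := wt n D / ((n*(n - 1)).choose (2*m) : ℝ)
def nu (n m : ℕ) (D : Fin n → ℕ) : ℝ := NN n D / ((n.choose 2).choose m : ℝ)

lemma mem_Wt {n M : ℕ} {D : Fin n → ℕ} : D ∈ Wt n M ↔ ∑ i, D i = M := by
  simp [Wt]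

lemma mem_Graphs {n : ℕ} {E : Finset (Sym2 (Fin n))} :
    E ∈ Graphs n ↔ ∀ v, s(v, v) ∉ E := by
  simp only [Graphs, mem_filter, mem_univ, true_and]
  constructor
  · intro h v hv; exact h _ hv (by simp)
  · intro h e he hd
    induction e with | _ x y =>
    simp at hd; subst hd; exact h _ he

lemma mem_GD {n : ℕ} {D : Fin n → ℕ} {E : Finset (Sym2 (Fin n))} :
    E ∈ GD n D ↔ (∀ v, s(v, v) ∉ E) ∧ ∀ i, deg E i = D i := by
  simp [GD, mem_Graphs]

lemma handshake {n : ℕ} {E : Finset (Sym2 (Fin n))} (hE : E ∈ Graphs n) :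
    ∑ i, deg E i = 2*E.card := by
  simp only [deg, card_filter]
  rw [Finset.sum_comm, mul_comm, ← smul_eq_mul, ← Finset.sum_const]
  refine sum_congr rfl fun e he => ?_
  have h1 : ¬ e.IsDiag := by
    simp only [Graphs, mem_filter, mem_univ, true_and] at hE; exact hE e he
  induction e with | _ x y =>
  simp at h1
  rw [← card_filter]
  have : (univ.filter fun i : Fin n => i ∈ s(x, y)) = {x, y} := by
    ext i; simp
  rw [this, card_pair h1]

lemma card_nondiag (n : ℕ) :
    ((univ : Finset (Sym2 (Fin n))).filter (fun e => ¬ e.IsDiag)).card = n.choose 2 := by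
  have := Sym2.card_subtype_not_diag (α := Fin n)
  rw [Fintype.card_subtype] at this
  simpa using this

lemma Graphs_card_eq (n m : ℕ) :
    (Graphs n).filter (fun E => E.card = m) =
      Finset.powersetCard m ((univ : Finset (Sym2 (Fin n))).filter (fun e => ¬ e.IsDiag)) := by
  ext E
  simp only [Graphs, mem_filter, mem_univ, true_and, mem_powersetCard, subset_iff]

lemma card_Graphs (n m : ℕ) :
    ((Graphs n).filter (fun E => E.card = m)).card = (n.choose 2).choose m := by
  rw [Graphs_card_eq, card_powersetCard, card_nondiag]

lemma sum_GD {n m : ℕ} (P : (Fin n → ℕ) → Prop) [DecidablePred P] (h : Finset (Sym2 (Fin n)) → ℝ) :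
    ∑ E ∈ (Graphs n).filter (fun E => E.card = m ∧ P (fun i => deg E i)), h E =
      ∑ D ∈ (Wt n (2*m)).filter P, ∑ E ∈ GD n D, h E := by
  rw [← Finset.sum_fiberwise_of_maps_to (t := (Wt n (2*m)).filter P) (g := fun E i => deg E i)]
  · refine sum_congr rfl fun D hD => ?_
    apply sum_congr _ fun _ _ => rfl
    ext E
    simp only [mem_filter, GD, mem_Wt] at hD ⊢
    constructor
    · rintro ⟨⟨h1, h2, h3⟩, h4⟩
      exact ⟨h1, fun i => congrFun h4 i⟩
    · rintro ⟨h1, h2⟩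
      have h4 : (fun i => deg E i) = D := funext h2
      refine ⟨⟨h1, ?_, by rw [h4]; exact hD.2⟩, h4⟩
      have := handshake h1
      simp only [h2] at this
      omega
  · intro E hE
    simp only [mem_filter, mem_Wt] at hE ⊢
    refine ⟨?_, hE.2.2⟩
    rw [handshake hE.1, hE.2.1]

open scoped Classical in
lemma prG_eq (n m : ℕ) (H : Set (Fin n → ℕ)) :
    prGEvent n m H = ∑ D ∈ (Wt n (2*m)).filter (· ∈ H), nu n m D := by
  have h := sum_GD (n := n) (m := m) (· ∈ H) (fun _ => 1)
  simp only [sum_const, nsmul_eq_mul, mul_one] at h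
  unfold prGEvent nu NN
  rw [card_Graphs, ← sum_div, ← h]

open scoped Classical in
lemma prB_eq (n m : ℕ) (H : Set (Fin n → ℕ)) :
    prBEvent n m H = ∑ D ∈ (Wt n (2*m)).filter (· ∈ H), mu n m D := by
  unfold prBEvent
  have h1 : ∑ D ∈ (Wt n (2*m)).filter (· ∈ H), mu n m D =
      ∑ D ∈ (Wt n (2*m)).filter (fun D => D ∈ H ∧ ∀ i, D i < n), mu n m D := by
    symm
    apply Finset.sum_subset
    · intro D; simp only [mem_filter]; tauto
    · intro D hD hD'
      simp only [mem_filter, not_and, not_forall] at hD hD'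
      obtain ⟨i, hi⟩ := hD' hD.1 hD.2
      have : wt n D = 0 := by
        apply Finset.prod_eq_zero (mem_univ i)
        rw [Nat.choose_eq_zero_of_lt]; simp
        have := i.2; omega
      simp [mu, this]
  rw [h1]
  have h2 : ∀ f : Fin n → Fin n, (if (fun i => (f i : ℕ)) ∈ H then prB n m (fun i => (f i : ℕ)) else 0)
      = if ((fun i => (f i : ℕ)) ∈ H ∧ ∑ i, (f i : ℕ) = 2*m) then mu n m (fun i => (f i : ℕ)) else 0 := by
    intro f
    unfold prB mu wt
    split_ifs <;> simp_all
  rw [sum_congr rfl fun f _ => h2 f, ← Finset.sum_filter]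
  refine Finset.sum_bij (fun f _ i => (f i : ℕ)) ?_ ?_ ?_ ?_
  · intro f hf
    simp only [mem_filter, mem_univ, true_and, mem_Wt] at hf ⊢
    exact ⟨hf.2, hf.1, fun i => (f i).2⟩
  · intro f _ g _ h
    funext i; exact Fin.ext (congrFun h i)
  · intro D hD
    simp only [mem_filter, mem_Wt] at hD
    exact ⟨fun i => ⟨D i, hD.2.2 i⟩, by simp [hD.1, hD.2.1], rfl⟩
  · intro f _; rfl

lemma wt_nonneg (n D) : 0 ≤ wt n D := Finset.prod_nonneg fun _ _ => by positivity
lemma mu_nonneg (n m D) : 0 ≤ mu n m D := div_nonneg (wt_nonneg _ _) (by positivity)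
lemma nu_nonneg (n m D) : 0 ≤ nu n m D := by unfold nu NN; positivity

lemma sum_nu {n m : ℕ} (h : m ≤ n.choose 2) : ∑ D ∈ Wt n (2*m), nu n m D = 1 := by
  have h := prG_eq n m Set.univ
  simp only [Set.mem_univ, filter_true] at h
  rw [← h]; unfold prGEvent
  simp only [Set.mem_univ, and_true, card_Graphs]
  apply div_self
  have := Nat.choose_pos (n := n.choose 2) (k := m) (by assumption)
  positivity

def Intf (n m : ℕ) (c θ : ℝ) : Prop :=
  ∃ (Gd : Finset (Fin n → ℕ)) (lam : ℝ), Gd ⊆ Wt n (2*m) ∧ 0 < lam ∧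
    (∀ D ∈ Gd, (1 - θ)*lam*mu n m D ≤ nu n m D ∧ nu n m D ≤ (1 + θ)*lam*mu n m D) ∧
    ∑ D ∈ Wt n (2*m) \ Gd, mu n m D ≤ (n : ℝ)^(-c) ∧
    ∑ D ∈ Wt n (2*m) \ Gd, nu n m D ≤ (n : ℝ)^(-c)

/-- add one at coordinate `a` -/
def up {n : ℕ} (T : Fin n → ℕ) (a : Fin n) : Fin n → ℕ := T + Pi.single a 1

lemma up_apply {n : ℕ} (T : Fin n → ℕ) (a i : Fin n) : up T a i = T i + if i = a then 1 else 0 := by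
  simp [up, Pi.single_apply]

lemma up_comm {n : ℕ} (T : Fin n → ℕ) (a b : Fin n) : up (up T a) b = up (up T b) a := by
  simp [up, add_right_comm]

lemma up_mem {n M : ℕ} {T : Fin n → ℕ} (h : T ∈ Wt n M) (a : Fin n) : up T a ∈ Wt n (M + 1) := by
  rw [mem_Wt] at *
  simp [up_apply, sum_add_distrib, h]

def rr {n : ℕ} (T : Fin n → ℕ) (a : Fin n) : ℝ := (n : ℝ) - 1 - T a

lemma wt_up {n : ℕ} (T : Fin n → ℕ) (a : Fin n) :
    wt n (up T a)*(up T a a : ℝ) = wt n T*rr T a := by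
  unfold wt
  rw [← Finset.mul_prod_erase _ _ (mem_univ a), ← Finset.mul_prod_erase _ _ (mem_univ a)]
  have h1 : ∏ x ∈ univ.erase a, ((n - 1).choose (up T a x) : ℝ) =
      ∏ x ∈ univ.erase a, ((n - 1).choose (T x) : ℝ) := by
    refine Finset.prod_congr rfl fun x hx => ?_
    rw [up_apply, if_neg (ne_of_mem_erase hx)]; simp
  have h2 : ((n - 1).choose (up T a a) : ℝ)*(up T a a : ℝ) = ((n - 1).choose (T a) : ℝ)*rr T a := by
    rw [up_apply, if_pos rfl, rr]
    have hn : 1 ≤ n := by have := a.2; omega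
    by_cases hT : T a ≤ n - 1
    · have := Nat.choose_succ_right_eq (n - 1) (T a)
      have h3 : ((n - 1 - T a : ℕ) : ℝ) = (n : ℝ) - 1 - T a := by
        rw [Nat.cast_sub hT, Nat.cast_sub hn]; simp
      rw [← h3]; exact_mod_cast this
    · rw [Nat.choose_eq_zero_of_lt (by omega), Nat.choose_eq_zero_of_lt (by omega)]; simp
  rw [h1]; linear_combination (∏ x ∈ univ.erase a, ((n - 1).choose (T x) : ℝ))*h2

lemma sampling (n M : ℕ) (H : (Fin n → ℕ) → Fin n → ℝ) :
    ∑ T ∈ Wt n M, wt n T*∑ a, rr T a*H (up T a) a =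
      ∑ D ∈ Wt n (M + 1), wt n D*∑ a, (D a : ℝ)*H D a := by
  simp only [mul_sum]
  rw [sum_comm, sum_comm (s := Wt n (M + 1))]
  refine sum_congr rfl fun a _ => ?_
  have h0 : ∑ D ∈ Wt n (M + 1), wt n D*((D a : ℝ)*H D a) =
      ∑ D ∈ (Wt n (M + 1)).filter (fun D => D a ≠ 0), wt n D*((D a : ℝ)*H D a) := by
    symm; apply Finset.sum_subset (filter_subset _ _)
    intro D hD hD'
    simp only [mem_filter, not_and, not_not] at hD'
    simp [hD' hD]
  rw [h0]
  refine Finset.sum_bij (fun T _ => up T a) ?_ ?_ ?_ ?_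
  · intro T hT
    rw [mem_filter]; exact ⟨up_mem hT a, by simp [up_apply]⟩
  · intro T _ T' _ h
    simpa [up] using h
  · intro D hD
    rw [mem_filter, mem_Wt] at hD
    refine ⟨D - Pi.single a 1, ?_, ?_⟩
    · rw [mem_Wt]
      have : ∑ i, D i = ∑ i, ((D - Pi.single a 1 : Fin n → ℕ) i + (Pi.single a 1 : Fin n → ℕ) i) := by
        refine sum_congr rfl fun i _ => ?_
        by_cases h : i = a
        · subst h; simp; omega
        · simp [h]
      rw [sum_add_distrib] at this
      simp at this ⊢; omega
    · funext i
      by_cases h : i = a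
      · subst h; simp [up_apply]; omega
      · simp [up_apply, h]
  · intro T _
    have := wt_up T a
    linear_combination -(H (up T a) a)*this

lemma sum_rr {n M : ℕ} {T : Fin n → ℕ} (h : T ∈ Wt n M) :
    ∑ a, rr T a = (n*(n - 1) : ℝ) - M := by
  rw [mem_Wt] at h
  unfold rr
  rw [sum_sub_distrib, ← Nat.cast_sum, h]; simp; ring

lemma castA (n : ℕ) : ((n*(n - 1) : ℕ) : ℝ) = n*(n - 1) := by
  cases n <;> simp

lemma sum_wt (n M : ℕ) : ∑ D ∈ Wt n M, wt n D = ((n*(n - 1)).choose M : ℝ) := by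
  induction M with
  | zero =>
    have : Wt n 0 = {0} := by ext D; simp [mem_Wt, funext_iff]
    simp [this, wt]
  | succ M ih =>
    have h := sampling n M (fun _ _ => 1)
    simp only [mul_one] at h
    have h1 : ∑ T ∈ Wt n M, wt n T*∑ a, rr T a = ((n*(n - 1)).choose M : ℝ)*((n*(n - 1) : ℝ) - M) := by
      rw [← ih, sum_mul]; exact sum_congr rfl fun T hT => by rw [sum_rr hT]
    have h2 : ∑ D ∈ Wt n (M + 1), wt n D*∑ a, (D a : ℝ) = (∑ D ∈ Wt n (M + 1), wt n D)*(M + 1) := by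
      rw [sum_mul]; refine sum_congr rfl fun T hT => ?_
      rw [mem_Wt] at hT; rw [← Nat.cast_sum, hT]; push_cast; ring
    rw [h1, h2] at h
    have h3 : ((n*(n - 1)).choose (M + 1) : ℝ)*(M + 1) = ((n*(n - 1)).choose M : ℝ)*((n*(n - 1) : ℝ) - M) := by
      have := Nat.choose_succ_right_eq (n*(n - 1)) M
      by_cases hM : M ≤ n*(n - 1)
      · have h4 : ((n*(n - 1) - M : ℕ) : ℝ) = (n*(n - 1) : ℝ) - M := by
          rw [Nat.cast_sub hM, castA]
        rw [← h4]; exact_mod_cast this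
      · rw [Nat.choose_eq_zero_of_lt (by omega), Nat.choose_eq_zero_of_lt (by omega)]; simp
    have : (M + 1 : ℝ) ≠ 0 := by positivity
    apply mul_right_cancel₀ this
    rw [← h, h3]

lemma sum_mu {n m : ℕ} (h : 2*m ≤ n*(n - 1)) : ∑ D ∈ Wt n (2*m), mu n m D = 1 := by
  unfold mu; rw [← sum_div, sum_wt]; apply div_self
  have := Nat.choose_pos h; positivity

/-- expectation in the model `B` with sum `M` -/
def EE (n M : ℕ) (F : (Fin n → ℕ) → ℝ) : ℝ :=
  (∑ D ∈ Wt n M, wt n D*F D) / ((n*(n - 1)).choose M : ℝ)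

def qq {n : ℕ} (M : ℕ) (T : Fin n → ℕ) (a : Fin n) : ℝ := rr T a / ((n*(n - 1) : ℝ) - M)

lemma EE_congr {n M : ℕ} {F G : (Fin n → ℕ) → ℝ} (h : ∀ D ∈ Wt n M, F D = G D) : EE n M F = EE n M G := by
  unfold EE; rw [sum_congr rfl fun D hD => by rw [h D hD]]

lemma EE_mono {n M : ℕ} {F G : (Fin n → ℕ) → ℝ}
    (h : ∀ D ∈ Wt n M, (∀ a, 0 ≤ rr D a) → F D ≤ G D) : EE n M F ≤ EE n M G := by
  unfold EE; apply div_le_div_of_nonneg_right _ (by positivity)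
  refine sum_le_sum fun D hD => ?_
  by_cases h1 : ∀ a, 0 ≤ rr D a
  · exact mll (h D hD h1) (wt_nonneg _ _)
  · push Not at h1
    obtain ⟨a, ha⟩ := h1
    have : wt n D = 0 := by
      apply Finset.prod_eq_zero (mem_univ a)
      have hn : 1 ≤ n := by have := a.2; omega
      rw [Nat.choose_eq_zero_of_lt]; simp
      unfold rr at ha
      have : (n : ℝ) < D a + 1 := by linarith
      have : n < D a + 1 := by exact_mod_cast this
      omega
    simp [this]

lemma EE_add (n M : ℕ) (F G : (Fin n → ℕ) → ℝ) : EE n M (fun D => F D + G D) = EE n M F + EE n M G := by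
  unfold EE; rw [← add_div, ← sum_add_distrib]; simp [mul_add]
lemma EE_smul (n M : ℕ) (c : ℝ) (F : (Fin n → ℕ) → ℝ) : EE n M (fun D => c*F D) = c*EE n M F := by
  unfold EE; rw [← mul_div_assoc, mul_sum]; congr 1; exact sum_congr rfl fun _ _ => by ring
lemma EE_const {n M : ℕ} (hM : M ≤ n*(n - 1)) (c : ℝ) : EE n M (fun _ => c) = c := by
  unfold EE; rw [← sum_mul, sum_wt, mul_comm, mul_div_assoc, div_self, mul_one]
  have := Nat.choose_pos hM; positivity

lemma EE_step {n M : ℕ} (hM : M < n*(n - 1)) (H : (Fin n → ℕ) → Fin n → ℝ) :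
    EE n M (fun T => ∑ a, qq M T a*H (up T a) a) =
      EE n (M + 1) (fun D => ∑ a, (D a : ℝ) / (M + 1)*H D a) := by
  have h := sampling n M H
  unfold EE
  have hZ := Nat.choose_succ_right_eq (n*(n - 1)) M
  have hpos : (0:ℝ) < (n*(n - 1) : ℝ) - M := by
    rw [← castA]; have : (M:ℝ) < ((n*(n-1) : ℕ) : ℝ) := by exact_mod_cast hM
    linarith
  have h4 : ((n*(n - 1) - M : ℕ) : ℝ) = (n*(n - 1) : ℝ) - M := by
    rw [Nat.cast_sub hM.le, castA]
  have hZ' : ((n*(n - 1)).choose (M + 1) : ℝ)*(M + 1) = ((n*(n - 1)).choose M : ℝ)*((n*(n - 1) : ℝ) - M) := by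
    rw [← h4]; exact_mod_cast hZ
  have e1 : ∑ D ∈ Wt n M, wt n D*∑ a, qq M D a*H (up D a) a =
      (∑ T ∈ Wt n M, wt n T*∑ a, rr T a*H (up T a) a) / ((n*(n - 1) : ℝ) - M) := by
    rw [sum_div]; refine sum_congr rfl fun T _ => ?_
    rw [mul_div_assoc, sum_div]; congr 1
    refine sum_congr rfl fun a _ => ?_
    unfold qq; ring
  have e2 : ∑ D ∈ Wt n (M + 1), wt n D*∑ a, (D a : ℝ) / (M + 1)*H D a =
      (∑ D ∈ Wt n (M + 1), wt n D*∑ a, (D a : ℝ)*H D a) / (M + 1) := by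
    rw [sum_div]; refine sum_congr rfl fun T _ => ?_
    rw [mul_div_assoc, sum_div]; congr 1
    refine sum_congr rfl fun a _ => ?_
    ring
  rw [e1, e2, h, div_div, div_div]
  congr 1
  rw [mul_comm, ← hZ', mul_comm]

lemma EE_step' {n M : ℕ} (hM : M < n*(n - 1)) (F : (Fin n → ℕ) → ℝ) :
    EE n M (fun T => ∑ a, qq M T a*F (up T a)) = EE n (M + 1) F := by
  rw [EE_step hM (fun D _ => F D)]
  apply EE_congr
  intro D hD
  rw [mem_Wt] at hD
  rw [← sum_mul, ← sum_div, ← Nat.cast_sum, hD]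
  push_cast
  rw [div_self (by positivity), one_mul]

lemma sum_qq {n M : ℕ} (hM : M < n*(n - 1)) {T : Fin n → ℕ} (h : T ∈ Wt n M) : ∑ a, qq M T a = 1 := by
  unfold qq; rw [← sum_div, sum_rr h, div_self]
  rw [← castA]; have : (M:ℝ) < ((n*(n-1) : ℕ) : ℝ) := by exact_mod_cast hM
  linarith

lemma qq_nonneg {n M : ℕ} (hM : M < n*(n - 1)) {T : Fin n → ℕ} {a : Fin n} (h : 0 ≤ rr T a) :
    0 ≤ qq M T a := by
  apply div_nonneg h
  rw [← castA]; have : (M:ℝ) < ((n*(n-1) : ℕ) : ℝ) := by exact_mod_cast hM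
  linarith

lemma pow_ineq (j : ℕ) (hj : 1 ≤ j) (x y : ℝ) :
    (x + y)^(2*j) ≤ x^(2*j) + (2*j : ℕ)*x^(2*j - 1)*y +
      2^(2*j)*(x^(2*j - 2)*y^2 + y^(2*j)) := by
  obtain ⟨l, hl⟩ : ∃ l, 2*j = l + 2 := ⟨2*j - 2, by omega⟩
  have hev : Even (l + 2) := by rw [← hl]; exact even_two_mul j
  have hev' : Even l := by rw [Nat.even_add] at hev; simpa using hev
  rw [hl, add_comm x y, add_pow]
  have key : ∀ i, i ≤ l → |y|^(i + 2)*|x|^(l - i) ≤ x^l*y^2 + y^(l + 2) := by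
    intro i hi
    rw [← hev'.pow_abs x, ← sq_abs y, ← hev.pow_abs y]
    have hx := abs_nonneg x
    have hy := abs_nonneg y
    have e1 : |x|^l = |x|^i*|x|^(l - i) := by rw [← pow_add]; congr 1; omega
    have e2 : |y|^(l + 2) = |y|^(i + 2)*|y|^(l - i) := by rw [← pow_add]; congr 1; omega
    rcases le_total |y| |x| with h | h
    · have h1 : |y|^i ≤ |x|^i := pow_le_pow_left₀ hy h i
      have h2 : |y|^(i + 2)*|x|^(l - i) ≤ |x|^l*|y|^2 := by
        rw [e1, pow_add]
        have : 0 ≤ |y|^2*|x|^(l - i) := by positivity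
        nlinarith
      have : 0 ≤ |y|^(l + 2) := by positivity
      linarith
    · have h1 : |x|^(l - i) ≤ |y|^(l - i) := pow_le_pow_left₀ hx h _
      have h2 : |y|^(i + 2)*|x|^(l - i) ≤ |y|^(l + 2) := by
        rw [e2]; exact mll h1 (by positivity)
      have : 0 ≤ |x|^l*|y|^2 := by positivity
      linarith
  rw [Finset.sum_range_succ', Finset.sum_range_succ']
  have hs : ∑ i ∈ range (l + 1), y^(i + 1 + 1)*x^(l + 2 - (i + 1 + 1))*((l + 2).choose (i + 1 + 1) : ℝ) ≤
      2^(l + 2)*(x^l*y^2 + y^(l + 2)) := by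
    calc _ ≤ ∑ i ∈ range (l + 1), ((l + 2).choose (i + 1 + 1) : ℝ)*(x^l*y^2 + y^(l + 2)) := by
          refine sum_le_sum fun i hi => ?_
          rw [mul_comm]
          apply mll _ (by positivity)
          refine le_trans (le_abs_self _) ?_
          rw [abs_mul, abs_pow, abs_pow]
          have hi' : i ≤ l := by simp at hi; omega
          have := key i hi'
          rw [show l + 2 - (i + 1 + 1) = l - i by omega]
          exact this
      _ ≤ _ := by
          rw [← sum_mul]
          apply mlr
          · have h2 : ∑ i ∈ range (l + 1), (l + 2).choose (i + 1 + 1) ≤ 2^(l + 2) := by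
              have h := Nat.sum_range_choose (l + 2)
              rw [Finset.sum_range_succ', Finset.sum_range_succ'] at h; omega
            exact_mod_cast h2
          · have h1 := hev'.pow_nonneg x
            have h2 := hev.pow_nonneg y
            positivity
  have e3 : l + 2 - 1 = l + 1 := by omega
  have e4 : l + 2 - 2 = l := by omega
  simp only [e3, e4]
  simp at hs ⊢
  linarith

lemma young_ineq (j : ℕ) (hj : 1 ≤ j) (s : ℝ) (hs : 0 < s) (x y : ℝ) :
    x^(2*j - 2)*y^2 ≤ x^(2*j) / s + s^(j - 1)*y^(2*j) := by
  obtain ⟨l, rfl⟩ : ∃ l, j = l + 1 := ⟨j - 1, by omega⟩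
  have e : 2*(l + 1) - 2 = 2*l := by omega
  rw [e, show l + 1 - 1 = l by omega, pow_mul, pow_mul, pow_mul]
  have hx := sq_nonneg x
  have hy := sq_nonneg y
  generalize x^2 = X at *
  generalize y^2 = Y at *
  rcases le_total (s*Y) X with h | h
  · have h1 : X^l*Y ≤ X^(l + 1) / s := by
      rw [le_div_iff₀ hs, pow_succ]
      have : 0 ≤ X^l := by positivity
      nlinarith
    have : 0 ≤ s^l*Y^(l + 1) := by positivity
    linarith
  · have h1 : X^l ≤ (s*Y)^l := pow_le_pow_left₀ hx h l
    have h2 : X^l*Y ≤ s^l*Y^(l + 1) := by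
      rw [mul_pow] at h1; rw [pow_succ, ← mul_assoc]; exact mlr h1 hy
    have : 0 ≤ X^(l + 1) / s := by positivity
    linarith

lemma jensen_even {ι : Type*} (s : Finset ι) (j : ℕ) (p z : ι → ℝ) (hj : 1 ≤ j)
    (hp : ∀ i ∈ s, 0 ≤ p i) (h1 : ∑ i ∈ s, p i ≤ 1) :
    (∑ i ∈ s, p i*z i)^(2*j) ≤ ∑ i ∈ s, p i*z i^(2*j) := by
  have hc := (even_two_mul j).convexOn_pow (𝕜 := ℝ)
  have := hc.map_sum_le (t := insertNone s) (w := fun o => o.elim (1 - ∑ i ∈ s, p i) p)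
    (p := fun o => o.elim 0 z) ?_ ?_ (by simp)
  · simp only [Finset.sum_insertNone, smul_eq_mul, Option.elim_none, Option.elim_some] at this
    simpa [zero_pow (show 2*j ≠ 0 by omega)] using this
  · intro i hi
    cases i with
    | none => simpa using h1
    | some a => simpa using hp a (by simpa using hi)
  · simp [Finset.sum_insertNone]

def hat {n : ℕ} (M : ℕ) (F : (Fin n → ℕ) → ℝ) (T : Fin n → ℕ) : ℝ := ∑ a, qq M T a*F (up T a)

def del (n M k : ℕ) (F : (Fin n → ℕ) → ℝ) : ℝ :=
  EE n M (fun T => ∑ a, ∑ b, qq M T a*qq M T b*(F (up T a) - F (up T b))^k)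

def VV (n M k : ℕ) (F : (Fin n → ℕ) → ℝ) : ℝ := EE n M (fun D => (F D - EE n M F)^k)

lemma VV_step {n M j : ℕ} (hj : 1 ≤ j) (hM : M < n*(n - 1)) (s : ℝ) (hs : 1 ≤ s)
    (F : (Fin n → ℕ) → ℝ) :
    VV n (M + 1) (2*j) F ≤ (1 + 2^(2*j) / s)*VV n M (2*j) (hat M F) +
      2^(2*j)*(s^(j - 1) + 1)*del n M (2*j) F := by
  unfold VV del
  have hE : EE n M (hat M F) = EE n (M + 1) F := EE_step' hM F
  rw [hE]
  set c := EE n (M + 1) F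
  rw [← EE_step' hM, ← EE_smul, ← EE_smul, ← EE_add]
  apply EE_mono
  intro T hT hr
  have hq : ∀ a, 0 ≤ qq M T a := fun a => qq_nonneg hM (hr a)
  have hq1 := sum_qq hM hT
  set X := hat M F T - c
  set Y := fun a => F (up T a) - hat M F T
  have hY0 : ∑ a, qq M T a*Y a = 0 := by
    simp only [Y, mul_sub, sum_sub_distrib, ← sum_mul, hq1, hat]; ring
  have hYk : ∀ a, Y a^(2*j) ≤ ∑ b, qq M T b*(F (up T a) - F (up T b))^(2*j) := by
    intro a
    have : Y a = ∑ b, qq M T b*(F (up T a) - F (up T b)) := by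
      simp only [Y, mul_sub, sum_sub_distrib, ← sum_mul, hq1, hat]; ring
    rw [this]
    exact jensen_even _ _ _ _ hj (fun b _ => hq b) hq1.le
  have hpt : ∀ a, (F (up T a) - c)^(2*j) ≤ (1 + 2^(2*j) / s)*X^(2*j) +
      (2*j : ℕ)*X^(2*j - 1)*Y a + 2^(2*j)*(s^(j - 1) + 1)*Y a^(2*j) := by
    intro a
    have h1 := pow_ineq j hj X (Y a)
    have h2 := young_ineq j hj s (by linarith) X (Y a)
    have e : X + Y a = F (up T a) - c := by simp only [X, Y]; ring
    rw [e] at h1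
    have h3 : (2:ℝ)^(2*j)*(X^(2*j - 2)*Y a^2) ≤ 2^(2*j)*(X^(2*j) / s + s^(j - 1)*Y a^(2*j)) :=
      mll h2 (by positivity)
    have e2 : (2:ℝ)^(2*j)*(X^(2*j) / s) = 2^(2*j) / s*X^(2*j) := by ring
    linarith
  calc ∑ a, qq M T a*(F (up T a) - c)^(2*j) 
      ≤ ∑ a, qq M T a*((1 + 2^(2*j) / s)*X^(2*j) +
      (2*j : ℕ)*X^(2*j - 1)*Y a + 2^(2*j)*(s^(j - 1) + 1)*Y a^(2*j)) :=
        sum_le_sum fun a _ => mll (hpt a) (hq a)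
    _ = (∑ a, qq M T a)*((1 + 2^(2*j) / s)*X^(2*j)) + (2*j : ℕ)*X^(2*j - 1)*(∑ a, qq M T a*Y a)
        + 2^(2*j)*(s^(j - 1) + 1)*∑ a, qq M T a*Y a^(2*j) := by
        rw [sum_mul, mul_sum, mul_sum, ← sum_add_distrib, ← sum_add_distrib]
        exact sum_congr rfl fun a _ => by ring
    _ ≤ _ := by
        rw [hY0, hq1]
        simp only [mul_zero, add_zero, one_mul]
        apply add_le_add le_rfl
        apply mll _ (by positivity)
        refine sum_le_sum fun a _ => ?_
        refine le_trans (mll (hYk a) (hq a)) ?_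
        rw [mul_sum]
        exact sum_le_sum fun b _ => by rw [mul_assoc]

lemma hat_diff {n M : ℕ} (F : (Fin n → ℕ) → ℝ) (U : Fin n → ℕ) (a b : Fin n) (hab : a ≠ b) :
    hat (M + 1) F (up U a) - hat (M + 1) F (up U b) =
      ∑ c, (rr U c - (if c = a then 1 else 0) - (if c = b then 1 else 0)) / ((n*(n - 1) : ℝ) - (M + 1 : ℕ)) *
        (F (up (up U c) a) - F (up (up U c) b)) := by
  unfold hat qq
  have e1 : ∀ x c, rr (up U x) c = rr U c - (if c = x then 1 else 0) := by
    intro x c; unfold rr; rw [up_apply]; push_cast; split_ifs <;> ring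
  simp only [e1]
  have h0 : ∑ c, (((if c = b then 1 else 0) / ((n*(n - 1) : ℝ) - (M + 1 : ℕ)))*F (up (up U c) a) -
    ((if c = a then 1 else 0) / ((n*(n - 1) : ℝ) - (M + 1 : ℕ)))*F (up (up U c) b)) = 0 := by
    rw [sum_sub_distrib]
    simp only [ite_div, zero_div, ite_mul, zero_mul, sum_ite_eq', mem_univ, if_true]
    rw [up_comm]; ring
  refine sub_eq_zero.1 (Eq.trans ?_ h0)
  rw [← sum_sub_distrib, ← sum_sub_distrib]
  refine sum_congr rfl fun c _ => ?_
  rw [up_comm U a c, up_comm U b c]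
  ring

lemma rr_up {n : ℕ} (U : Fin n → ℕ) (x c : Fin n) : rr (up U x) c = rr U c - (if c = x then 1 else 0) := by
  unfold rr; rw [up_apply]; push_cast; split_ifs <;> ring

lemma rr_int {n : ℕ} (U : Fin n → ℕ) (a : Fin n) (h : 0 ≤ rr U a) : rr U a = 0 ∨ 1 ≤ rr U a := by
  unfold rr at *
  have h1 : U a + 1 ≤ n := by
    have : (U a : ℝ) + 1 ≤ n := by linarith
    exact_mod_cast this
  rcases h1.eq_or_lt with h2 | h2
  · left; rw [← h2]; push_cast; ring
  · right
    have : (U a : ℝ) + 1 + 1 ≤ n := by exact_mod_cast h2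
    linarith

lemma del_hat {n M j : ℕ} (hj : 1 ≤ j) (hM : M + 1 < n*(n - 1)) (F : (Fin n → ℕ) → ℝ) :
    del n M (2*j) (hat (M + 1) F) ≤ del n (M + 1) (2*j) F := by
  unfold del
  rw [← EE_step' (by omega)]
  apply EE_mono
  intro U hU hr
  simp only [mul_sum]
  conv_rhs => rw [Finset.sum_comm]
  refine sum_le_sum fun a _ => ?_
  conv_rhs => rw [Finset.sum_comm]
  refine sum_le_sum fun b _ => ?_
  have hR' : (0:ℝ) < (n*(n - 1) : ℝ) - (M + 1 : ℕ) := by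
    rw [← castA]; have : ((M + 1 : ℕ):ℝ) < ((n*(n-1) : ℕ) : ℝ) := by exact_mod_cast hM
    linarith
  have hsum : ∑ c, rr U c = (n*(n - 1) : ℝ) - M := sum_rr hU
  rcases eq_or_ne a b with rfl | hab
  · simp [zero_pow (show 2*j ≠ 0 by omega)]
  rw [hat_diff F U a b hab]
  have hRR : (n*(n - 1) : ℝ) - (M : ℕ) = (n*(n - 1) : ℝ) - (M + 1 : ℕ) + 1 := by push_cast; ring
  unfold qq
  simp only [rr_up]
  rw [hRR] at hsum ⊢
  set R := (n*(n - 1) : ℝ) - (M + 1 : ℕ) with hRdef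
  have hK : ∀ c, rr U c*(rr U a - if a = c then 1 else 0)*(rr U b - if b = c then 1 else 0) =
      rr U a*rr U b*(rr U c - (if c = a then 1 else 0) - (if c = b then 1 else 0)) := by
    intro c
    by_cases h1 : c = a
    · subst h1; simp [hab, hab.symm]; ring
    · by_cases h2 : c = b
      · subst h2; simp only [h1, Ne.symm h1, if_true, if_false]; ring
      · simp [h1, h2, Ne.symm h1, Ne.symm h2]; ring
  have hz : ∀ c, (0:ℝ) ≤ (F (up (up U c) a) - F (up (up U c) b))^(2*j) := fun c => (even_two_mul j).pow_nonneg _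
  by_cases h0 : 1 ≤ rr U a ∧ 1 ≤ rr U b
  · have hp : ∀ c ∈ univ, 0 ≤ (rr U c - (if c = a then 1 else 0) - (if c = b then 1 else 0)) / R := by
      intro c _
      apply div_nonneg _ hR'.le
      have := hr c
      by_cases h1 : c = a
      · subst h1; simp [hab]; linarith
      · by_cases h2 : c = b
        · subst h2; simp [h1]; linarith
        · simp [h1, h2, this]
    have hJ := jensen_even univ j _ (fun c => F (up (up U c) a) - F (up (up U c) b)) hj hp (by
      rw [← sum_div, div_le_one hR', sum_sub_distrib, sum_sub_distrib, hsum]; simp)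
    calc _ ≤ rr U a / (R + 1)*(rr U b / (R + 1))*_ := mll hJ (by
            have := hr a; have := hr b; positivity)
      _ = ∑ c, (rr U a*rr U b*(rr U c - (if c = a then 1 else 0) - (if c = b then 1 else 0)) / R) *
            (F (up (up U c) a) - F (up (up U c) b))^(2*j)*(1 / (R + 1)*(1 / (R + 1))) := by
          rw [mul_sum]; exact sum_congr rfl fun c _ => by ring
      _ ≤ ∑ c, (rr U a*rr U b*(rr U c - (if c = a then 1 else 0) - (if c = b then 1 else 0)) / R) *
            (F (up (up U c) a) - F (up (up U c) b))^(2*j)*(1 / R*(1 / (R + 1))) := by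
          refine sum_le_sum fun c hc => ?_
          apply mll
          · apply mlr _ (by positivity)
            apply one_div_le_one_div_of_le hR'; linarith
          · have := hp c hc
            rw [mul_div_assoc]
            have := hz c; have := hr a; have := hr b
            positivity
      _ = _ := by
          refine sum_congr rfl fun c _ => ?_
          rw [← hK]
          have h1 : R + 1 ≠ 0 := by positivity
          field_simp
  · have h00 : rr U a*rr U b = 0 := by
      rcases rr_int U a (hr a) with h | h
      · simp [h]
      · rcases rr_int U b (hr b) with h' | h'
        · simp [h']
        · exact absurd ⟨h, h'⟩ h0
    have e1 : rr U a / (R + 1)*(rr U b / (R + 1)) = 0 := by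
      rw [div_mul_div_comm, h00, zero_div]
    rw [e1, zero_mul]
    refine sum_nonneg fun c _ => ?_
    have := hK c
    rw [h00, zero_mul] at this
    have e2 : rr U c / (R + 1)*((rr U a - if a = c then 1 else 0) / R*((rr U b - if b = c then 1 else 0) / R) *
       (F (up (up U c) a) - F (up (up U c) b))^(2*j)) = 0 := by
      calc _ = (rr U c*(rr U a - if a = c then 1 else 0)*(rr U b - if b = c then 1 else 0)) *
        ((F (up (up U c) a) - F (up (up U c) b))^(2*j) / (R + 1) / R / R) := by ring
        _ = 0 := by rw [this, zero_mul]
    exact e2.ge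

lemma del_nonneg {n M j : ℕ} (hM : M < n*(n - 1)) (F : (Fin n → ℕ) → ℝ) : 0 ≤ del n M (2*j) F := by
  unfold del
  have : EE n M (fun _ => 0) = 0 := EE_const hM.le 0
  rw [← this]
  apply EE_mono
  intro T _ hr
  refine sum_nonneg fun a _ => sum_nonneg fun b _ => ?_
  exact mul_nonneg (mul_nonneg (qq_nonneg hM (hr a)) (qq_nonneg hM (hr b))) ((even_two_mul j).pow_nonneg _)

lemma VV_zero {n j : ℕ} (hj : 1 ≤ j) (F : (Fin n → ℕ) → ℝ) : VV n 0 (2*j) F = 0 := by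
  have hW : Wt n 0 = {fun _ => 0} := by
    ext D; rw [mem_Wt]; simp [funext_iff]
  unfold VV EE
  rw [hW]
  simp [wt]; omega

lemma VV_ind {n j : ℕ} (hj : 1 ≤ j) (s : ℝ) (hs : 1 ≤ s) (M : ℕ) : M < n*(n - 1) → ∀ F : (Fin n → ℕ) → ℝ,
    VV n (M + 1) (2*j) F ≤ (1 + 2^(2*j) / s)^M*(M + 1)*(2^(2*j)*(s^(j - 1) + 1)) *
      del n M (2*j) F := by
  induction M with
  | zero =>
    intro hM F
    have := VV_step hj hM s hs F
    rw [VV_zero hj] at this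
    simpa using this
  | succ M ih =>
    intro hM F
    have h1 := VV_step hj hM s hs F
    have h2 := ih (by omega) (hat (M + 1) F)
    have h3 := del_hat hj hM F
    have h0 : (0:ℝ) ≤ 2^(2*j) / s := by positivity
    have hd := del_nonneg (j := j) hM F
    set B := (2:ℝ)^(2*j)*(s^(j - 1) + 1) with hB
    have hB0 : 0 ≤ B := by positivity
    set u := 1 + (2:ℝ)^(2*j) / s
    have hu : 1 ≤ u := by simp only [u]; linarith
    have hu0 : 0 ≤ u := by linarith
    have h4 : u*VV n (M + 1) (2*j) (hat (M + 1) F) ≤ u*(u^M*(M + 1)*B*del n (M + 1) (2*j) F) :=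
      mll (h2.trans (mll h3 (by positivity))) hu0
    have h5 : 1 ≤ u^(M + 1) := one_le_pow₀ hu
    have h6 : B*del n (M + 1) (2*j) F ≤ u^(M + 1)*(B*del n (M + 1) (2*j) F) :=
      le_mul_of_one_le_left (by positivity) h5
    push_cast
    calc _ ≤ _ := h1
      _ ≤ u*(u^M*(M + 1)*B*del n (M + 1) (2*j) F) + u^(M + 1)*(B*del n (M + 1) (2*j) F) :=
        add_le_add h4 h6
      _ = _ := by ring

/-- Poincare inequality -/
lemma poincare {n j M : ℕ} (hj : 1 ≤ j) (hM : M < n*(n - 1)) (F : (Fin n → ℕ) → ℝ) :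
    VV n (M + 1) (2*j) F ≤ (Real.exp (2^(2*j))*(2^(2*j)*2))*((M : ℝ) + 1)^j*del n M (2*j) F := by
  have h := VV_ind hj ((M : ℝ) + 1) (by linarith [Nat.cast_nonneg (α := ℝ) M]) M hM F
  refine h.trans (mlr ?_ (del_nonneg hM F))
  have hs : (1:ℝ) ≤ (M : ℝ) + 1 := by linarith [Nat.cast_nonneg (α := ℝ) M]
  set s := (M : ℝ) + 1
  have h1 : (1 + (2:ℝ)^(2*j) / s)^M ≤ Real.exp (2^(2*j)) := by
    have h2 : 1 + (2:ℝ)^(2*j) / s ≤ Real.exp (2^(2*j) / s) := by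
      linarith [Real.add_one_le_exp ((2:ℝ)^(2*j) / s)]
    refine (pow_le_pow_left₀ (by positivity) h2 M).trans ?_
    rw [← Real.exp_nat_mul]
    apply Real.exp_le_exp.2
    rw [← mul_div_assoc, div_le_iff₀ (by linarith), mul_comm]
    apply mll _ (by positivity)
    simp [s]
  have h2 : s^(j - 1) + 1 ≤ 2*s^(j - 1) := by linarith [one_le_pow₀ hs (n := j - 1)]
  have h3 : s^j = s*s^(j - 1) := by rw [← pow_succ']; congr 1; omega
  rw [h3]
  calc _ ≤ Real.exp (2^(2*j))*s*(2^(2*j)*(2*s^(j - 1))) := by gcongr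
    _ = _ := by ring

def ff (n m : ℕ) (D : Fin n → ℕ) : ℝ := nu n m D / mu n m D

lemma ff_nonneg (n m D) : 0 ≤ ff n m D := div_nonneg (nu_nonneg _ _ _) (mu_nonneg _ _ _)

/-- neighbours -/
def nb {n : ℕ} (E : Finset (Sym2 (Fin n))) (v : Fin n) : Finset (Fin n) := univ.filter (fun u => s(v, u) ∈ E)

lemma mem_nb {n : ℕ} {E : Finset (Sym2 (Fin n))} {v u : Fin n} : u ∈ nb E v ↔ s(v, u) ∈ E := by simp [nb]

lemma deg_eq_nb {n : ℕ} (E : Finset (Sym2 (Fin n))) (v : Fin n) : deg E v = (nb E v).card := by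
  unfold deg
  symm
  apply Finset.card_bij (fun u _ => s(v, u))
  · intro u hu; simp [mem_nb] at hu; simp [hu]
  · intro u _ w _ h; simp at h; rcases h with h | h
    · exact h
    · rw [h.2, h.1]
  · intro e he
    simp only [mem_filter] at he
    obtain ⟨u, rfl⟩ := he.2
    exact ⟨u, by simpa [mem_nb] using he.1, rfl⟩

lemma deg_le {n : ℕ} {E : Finset (Sym2 (Fin n))} (hE : ∀ v, s(v, v) ∉ E) (v : Fin n) : deg E v ≤ n - 1 := by
  rw [deg_eq_nb]
  have : nb E v ⊆ univ.erase v := by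
    intro u hu
    rw [mem_nb] at hu
    simp only [mem_erase, mem_univ, and_true]
    rintro rfl; exact hE _ hu
  have := card_le_card this
  simpa using this

lemma NN_zero {n : ℕ} {D : Fin n → ℕ} (h : wt n D = 0) : NN n D = 0 := by
  unfold NN
  rw [Nat.cast_eq_zero, card_eq_zero, eq_empty_iff_forall_notMem]
  intro E hE
  rw [mem_GD] at hE
  have : 0 < wt n D := by
    apply Finset.prod_pos
    intro i _
    have h := deg_le hE.1 i
    rw [hE.2 i] at h
    exact_mod_cast Nat.choose_pos h
  linarith

lemma mu_ff {n m : ℕ} (D : Fin n → ℕ) (hm : 2*m ≤ n*(n - 1)) : mu n m D*ff n m D = nu n m D := by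
  unfold ff
  by_cases h : mu n m D = 0
  · have h1 : wt n D = 0 := by
      unfold mu at h
      have := Nat.choose_pos hm
      rcases div_eq_zero_iff.1 h with h | h
      · exact h
      · have : ((n*(n - 1)).choose (2*m) : ℝ) ≠ 0 := by positivity
        contradiction
    rw [h, zero_mul, nu, NN_zero h1, zero_div]
  · field_simp

lemma EE_eq_mu (n m : ℕ) (F : (Fin n → ℕ) → ℝ) : EE n (2*m) F = ∑ D ∈ Wt n (2*m), mu n m D*F D := by
  unfold EE mu; rw [sum_div]; exact sum_congr rfl fun _ _ => by ring

lemma root_ineq {k : ℕ} (hk : 1 ≤ k) {x y r s : ℝ} (hx : 0 ≤ x) (hy : 0 ≤ y) (_hr : 0 ≤ r) (hs : 0 ≤ s)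
    (hxy : y ≤ x) (h : |x^k - y^k| ≤ r*x^k + s*y^k) : x - y ≤ r*x + s*y := by
  obtain ⟨l, rfl⟩ : ∃ l, k = l + 1 := ⟨k - 1, by omega⟩
  rcases hx.eq_or_lt with rfl | hx0
  · have : y = 0 := le_antisymm hxy hy
    subst this; simp
  have h1 := (le_abs_self _).trans h
  have h2 : y^l ≤ x^l := pow_le_pow_left₀ hy hxy l
  have hxl : 0 < x^l := by positivity
  rw [pow_succ, pow_succ] at h1
  have h3 : x^l*(x - y) ≤ x^l*(r*x + s*y) := by
    have e1 : y^l*y ≤ x^l*y := mlr h2 hy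
    have e2 : s*(y^l*y) ≤ s*(x^l*y) := mll e1 hs
    nlinarith
  exact le_of_mul_le_mul_left h3 hxl

lemma root_ineq' {k : ℕ} (hk : 1 ≤ k) {x y r s : ℝ} (hx : 0 ≤ x) (hy : 0 ≤ y) (hr : 0 ≤ r) (hs : 0 ≤ s)
    (h : |x^k - y^k| ≤ r*x^k + s*y^k) :
    |x - y|^k ≤ 2^k*(r^k*x^k + s^k*y^k) := by
  have h1 : |x - y| ≤ r*x + s*y := by
    rcases le_total y x with h' | h'
    · rw [abs_of_nonneg (by linarith)]; exact root_ineq hk hx hy hr hs h' h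
    · rw [abs_of_nonpos (by linarith)]
      have := root_ineq hk hy hx hs hr h' (by rw [abs_sub_comm]; linarith)
      linarith
  calc |x - y|^k ≤ (r*x + s*y)^k := pow_le_pow_left₀ (abs_nonneg _) h1 k
    _ ≤ 2^(k - 1)*((r*x)^k + (s*y)^k) := add_pow_le (by positivity) (by positivity) k
    _ ≤ 2^k*((r*x)^k + (s*y)^k) := by
        gcongr
        · norm_num
        · omega
    _ = _ := by rw [mul_pow, mul_pow]

lemma dsum {ι : Type*} [Fintype ι] (q φ : ι → ℝ) (C : ℝ) (h : ∑ a, q a = 1) :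
    ∑ a, ∑ b, q a*q b*(C*(φ a + φ b)) = 2*C*∑ a, q a*φ a := by
  have h1 : ∑ a, ∑ b, q a*q b*(C*(φ a + φ b)) =
      ∑ a, (C*(q a*φ a)*∑ b, q b + C*q a*∑ b, q b*φ b) := by
    refine sum_congr rfl fun a _ => ?_
    rw [mul_sum, mul_sum, ← sum_add_distrib]
    exact sum_congr rfl fun b _ => by ring
  rw [h1, h, sum_add_distrib, ← sum_mul, ← sum_mul, ← mul_sum, ← mul_sum, h]; ring

open scoped Classical in
def rho {n : ℕ} (DD : Set (Fin n → ℕ)) (δ : ℝ) (D : Fin n → ℕ) : ℝ := if D ∈ DD then δ else 1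

open scoped Classical in
def nuc (n m : ℕ) (DD : Set (Fin n → ℕ)) : ℝ := ∑ D ∈ (Wt n (2*m)).filter (· ∉ DD), nu n m D

lemma rho_nonneg {n : ℕ} (DD : Set (Fin n → ℕ)) {δ : ℝ} (h : 0 ≤ δ) (D : Fin n → ℕ) : 0 ≤ rho DD δ D := by
  unfold rho; split_ifs <;> linarith

def Hyp (n m : ℕ) (DD : Set (Fin n → ℕ)) (δ : ℝ) : Prop :=
  ∀ T ∈ Wt n (2*m - 1), ∀ a b, a ≠ b → 0 < rr T a → 0 < rr T b →
    |ff n m (up T a) - ff n m (up T b)| ≤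
      rho DD δ (up T a)*ff n m (up T a) + rho DD δ (up T b)*ff n m (up T b)

open scoped Classical in
lemma del_bound {n m j : ℕ} (hj : 1 ≤ j) (hm : 1 ≤ m) (hA : 2*m ≤ n*(n - 1)) (hN : m ≤ n.choose 2)
    (DD : Set (Fin n → ℕ)) (δ : ℝ) (hδ : 0 ≤ δ) (H : Hyp n m DD δ) (g : (Fin n → ℕ) → ℝ)
    (hg : ∀ D, 0 ≤ g D) (hgk : ∀ D, g D^(2*j) = ff n m D) :
    del n (2*m - 1) (2*j) g ≤ 2^(2*j)*2*(δ^(2*j) + nuc n m DD) := by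
  obtain ⟨M, hM⟩ : ∃ M, 2*m = M + 1 := ⟨2*m - 1, by omega⟩
  have hM1 : 2*m - 1 = M := by omega
  have hMA : M < n*(n - 1) := by omega
  unfold Hyp at H
  rw [hM1] at H ⊢
  have hpos := rho_nonneg DD hδ
  have step : EE n M (fun T => ∑ a, qq M T a*((2:ℝ)^(2*j)*2*(rho DD δ (up T a)^(2*j)*ff n m (up T a))))
      = 2^(2*j)*2*EE n (M + 1) (fun D => rho DD δ D^(2*j)*ff n m D) := by
    rw [← EE_smul, ← EE_step' hMA]
  calc _ ≤ EE n M (fun T => ∑ a, qq M T a*((2:ℝ)^(2*j)*2*(rho DD δ (up T a)^(2*j)*ff n m (up T a)))) := by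
        unfold del
        apply EE_mono
        intro T hT hr
        have hq : ∀ a, 0 ≤ qq M T a := fun a => qq_nonneg hMA (hr a)
        have hq1 := sum_qq hMA hT
        calc _ ≤ ∑ a, ∑ b, qq M T a*qq M T b*(2^(2*j)*(rho DD δ (up T a)^(2*j)*ff n m (up T a) +
                rho DD δ (up T b)^(2*j)*ff n m (up T b))) := by
              refine sum_le_sum fun a _ => sum_le_sum fun b _ => ?_
              have fa := ff_nonneg n m (up T a)
              have fb := ff_nonneg n m (up T b)
              have ra := hpos (up T a)
              have rb := hpos (up T b)
              rcases eq_or_ne a b with rfl | hab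
              · simp only [sub_self, zero_pow (show 2*j ≠ 0 by omega), mul_zero]
                have := hq a
                positivity
              by_cases h0 : 0 < rr T a ∧ 0 < rr T b
              · apply mll _ (mul_nonneg (hq a) (hq b))
                have := H T hT a b hab h0.1 h0.2
                rw [← hgk, ← hgk] at this ⊢
                rw [← (even_two_mul j).pow_abs (g (up T a) - g (up T b))]
                exact root_ineq' (by omega) (hg _) (hg _) ra rb this
              · have : qq M T a*qq M T b = 0 := by
                  unfold qq
                  rcases (hr a).eq_or_lt with h | h
                  · simp [← h]
                  · rcases (hr b).eq_or_lt with h' | h'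
                    · simp [← h']
                    · exact absurd ⟨h, h'⟩ h0
                rw [this]; simp
          _ = _ := by
              rw [dsum _ (fun a => rho DD δ (up T a)^(2*j)*ff n m (up T a)) _ hq1, mul_sum]
              exact sum_congr rfl fun a _ => by ring
    _ = _ := step
    _ ≤ _ := by
        apply mll _ (by positivity)
        rw [← hM, EE_eq_mu]
        calc _ ≤ ∑ D ∈ Wt n (2*m), (δ^(2*j)*nu n m D + (if D ∈ DD then 0 else nu n m D)) := by
              refine sum_le_sum fun D _ => ?_
              have := mu_ff D hA
              rw [mul_left_comm, this]
              have := nu_nonneg n m D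
              unfold rho
              split_ifs
              · simp
              · simp only [one_pow, one_mul]; have : 0 ≤ δ^(2*j)*nu n m D := by positivity
                linarith
          _ = _ := by
              rw [sum_add_distrib, ← mul_sum, sum_nu hN, mul_one, nuc, sum_filter]
              congr 1
              exact sum_congr rfl fun D _ => by simp only [ite_not]

set_option maxHeartbeats 1000000 in
open scoped Classical in
lemma crit (j : ℕ) (hj : 1 ≤ j) (θ : ℝ) (hθ : 0 < θ) (hθ1 : θ ≤ 1) : ∃ K : ℝ, 0 < K ∧
    ∀ (c : ℝ) (n m : ℕ) (DD : Set (Fin n → ℕ)) (δ : ℝ), 1 ≤ m → 2*m ≤ n*(n - 1) → m ≤ n.choose 2 → 0 ≤ δ →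
      Hyp n m DD δ → K*((2*m : ℝ)^j*(δ^(2*j) + nuc n m DD)) ≤ (n : ℝ)^(-c) →
      (n : ℝ)^(-c) ≤ 1 / 2 → Intf n m c θ := by
  set τ : ℝ := θ / (8*(2*j)) with hτ
  have hj' : (1:ℝ) ≤ j := by exact_mod_cast hj
  have hτ0 : 0 < τ := by positivity
  have hτ1 : τ ≤ 1 / 4 := by
    rw [hτ, div_le_iff₀ (by positivity)]; nlinarith
  set C1 : ℝ := (Real.exp (2^(2*j))*(2^(2*j)*2))*(2^(2*j)*2) with hC1
  have hC10 : 0 < C1 := by positivity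
  refine ⟨C1*(2^(2*j)*(1 + 1 / τ^(2*j))), by positivity, ?_⟩
  intro c n m DD δ hm hA hN hδ H hK hc
  set g : (Fin n → ℕ) → ℝ := fun D => ff n m D^(1 / ((2*j : ℕ) : ℝ)) with hgdef
  have hg : ∀ D, 0 ≤ g D := fun D => Real.rpow_nonneg (ff_nonneg _ _ _) _
  have hgk : ∀ D, g D^(2*j) = ff n m D := by
    intro D
    simp only [hgdef]
    rw [one_div, Real.rpow_inv_natCast_pow (ff_nonneg _ _ _) (by omega)]
  have hdel := del_bound hj hm hA hN DD δ hδ H g hg hgk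
  obtain ⟨M, hM⟩ : ∃ M, 2*m = M + 1 := ⟨2*m - 1, by omega⟩
  have hp := poincare hj (show M < n*(n - 1) by omega) g
  rw [show 2*m - 1 = M by omega] at hdel
  have hMr : (2*m : ℝ) = M + 1 := by exact_mod_cast hM
  rw [← hMr, ← hM] at hp
  unfold VV at hp
  set gb := EE n (2*m) g with hgb
  set k := 2*j with hk
  have hev : Even k := even_two_mul j
  set Q := (2*m : ℝ)^j*(δ^k + nuc n m DD) with hQ
  have hVQ : EE n (2*m) (fun D => (g D - gb)^k) ≤ C1*Q := by
    refine hp.trans ((mll hdel (by positivity)).trans (le_of_eq ?_))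
    rw [hC1, hQ]; ring
  have hnu1 : EE n (2*m) (fun D => g D^k) = 1 := by
    rw [EE_eq_mu, ← sum_nu hN]
    exact sum_congr rfl fun D _ => by rw [hgk, mu_ff D hA]
  have hmu1 : ∑ D ∈ Wt n (2*m), mu n m D = 1 := by
    have := EE_const hA 1
    rw [EE_eq_mu] at this; simpa using this
  have hgb0 : 0 ≤ gb := by
    rw [hgb, EE_eq_mu]
    exact sum_nonneg fun D _ => mul_nonneg (mu_nonneg _ _ _) (hg D)
  have hgb1 : gb^k ≤ 1 := by
    rw [hgb, ← hnu1, EE_eq_mu, EE_eq_mu]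
    exact jensen_even _ _ _ _ hj (fun D _ => mu_nonneg _ _ _) hmu1.le
  set Gd := (Wt n (2*m)).filter (fun D => |g D - gb| ≤ τ) with hGd
  have hV0 : 0 ≤ EE n (2*m) (fun D => (g D - gb)^k) := by
    rw [EE_eq_mu]; exact sum_nonneg fun D _ => mul_nonneg (mu_nonneg _ _ _) (hev.pow_nonneg _)
  have hC1Q : 0 ≤ C1*Q := hV0.trans hVQ
  have hbadV : ∑ D ∈ Wt n (2*m) \ Gd, mu n m D*(g D - gb)^k ≤ C1*Q := by
    refine le_trans ?_ hVQ
    rw [EE_eq_mu]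
    exact sum_le_sum_of_subset_of_nonneg sdiff_subset
      fun D _ _ => mul_nonneg (mu_nonneg _ _ _) (hev.pow_nonneg _)
  have hmub : ∑ D ∈ Wt n (2*m) \ Gd, mu n m D ≤ C1*Q*(1 / τ^k) := by
    rw [mul_one_div, le_div_iff₀ (by positivity)]
    refine le_trans ?_ hbadV
    rw [sum_mul]
    refine sum_le_sum fun D hD => mll ?_ (mu_nonneg _ _ _)
    simp only [hGd, mem_sdiff, mem_filter, not_and, not_le] at hD
    rw [← hev.pow_abs (g D - gb)]
    exact pow_le_pow_left₀ hτ0.le (hD.2 hD.1).le k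
  have hnub : ∑ D ∈ Wt n (2*m) \ Gd, nu n m D ≤ C1*Q*(2^k*(1 + 1 / τ^k)) := by
    calc _ ≤ ∑ D ∈ Wt n (2*m) \ Gd, 2^k*(mu n m D*(g D - gb)^k + mu n m D) := by
          refine sum_le_sum fun D _ => ?_
          rw [← mu_ff D hA, ← hgk]
          have h1 : g D^k ≤ 2^k*((g D - gb)^k + gb^k) := by
            have e : g D ≤ |g D - gb| + gb := by linarith [le_abs_self (g D - gb)]
            rw [← hev.pow_abs (g D - gb)]
            calc g D^k ≤ (|g D - gb| + gb)^k := pow_le_pow_left₀ (hg D) e k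
              _ ≤ 2^(k - 1)*(|g D - gb|^k + gb^k) := add_pow_le (abs_nonneg _) hgb0 k
              _ ≤ _ := by
                gcongr
                · norm_num
                · omega
          have h2 : g D^k ≤ 2^k*((g D - gb)^k + 1) := by
            refine h1.trans ?_
            gcongr
          have := mll h2 (mu_nonneg n m D)
          linarith
      _ ≤ 2^k*(C1*Q + C1*Q*(1 / τ^k)) := by
          rw [← mul_sum, sum_add_distrib]
          gcongr
      _ = _ := by ring
  have hKK : C1*Q*(2^k*(1 + 1 / τ^k)) ≤ (n : ℝ)^(-c) := by
    refine le_trans (le_of_eq ?_) hK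
    ring
  have hnub' := hnub.trans hKK
  have h2k : (1:ℝ) ≤ 2^k := one_le_pow₀ (by norm_num)
  have hmub' : ∑ D ∈ Wt n (2*m) \ Gd, mu n m D ≤ (n : ℝ)^(-c) := by
    refine hmub.trans (le_trans ?_ hKK)
    apply mll _ hC1Q
    have : 0 ≤ 1 / τ^k := by positivity
    nlinarith only [this, h2k]
  have hsub : Gd ⊆ Wt n (2*m) := filter_subset _ _
  -- gb ≥ 1/4
  have hgb4 : 1 / 4 ≤ gb := by
    by_contra hlt
    push Not at hlt
    have h1 : ∑ D ∈ Gd, nu n m D ≤ (1 / 2)^k := by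
      calc _ ≤ ∑ D ∈ Gd, mu n m D*(1 / 2)^k := by
            refine sum_le_sum fun D hD => ?_
            rw [← mu_ff D hA, ← hgk]
            apply mll _ (mu_nonneg _ _ _)
            apply pow_le_pow_left₀ (hg D)
            simp only [hGd, mem_filter] at hD
            have := (abs_le.1 hD.2).2
            linarith
        _ ≤ 1*(1 / 2)^k := by
            rw [← sum_mul]
            apply mlr _ (by positivity)
            rw [← hmu1]
            exact sum_le_sum_of_subset_of_nonneg hsub fun D _ _ => mu_nonneg _ _ _
        _ = _ := one_mul _
    have h2 : (1 / 2 : ℝ)^k ≤ (1 / 2)^2 := pow_le_pow_of_le_one (by norm_num) (by norm_num) (by omega)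
    have h3 := sum_nu hN
    rw [← sum_sdiff hsub] at h3
    norm_num at h2
    linarith
  have hgbp : 0 < gb := by linarith
  refine ⟨Gd, gb^k, hsub, by positivity, ?_, hmub', hnub'⟩
  intro D hD
  simp only [hGd, mem_filter] at hD
  have hab := abs_le.1 hD.2
  have hx : k*(4*τ) = θ / 2 := by
    rw [hτ, hk]; push_cast; field_simp; norm_num
  have e0 : 0 ≤ τ*(4*gb - 1) := mul_nonneg hτ0.le (by linarith only [hgb4])
  have e1 : gb*(1 - 4*τ) ≤ g D := by linarith only [e0, hab.1]
  have e2 : g D ≤ gb*(1 + 4*τ) := by linarith only [e0, hab.2]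
  have b1 : 1 - θ ≤ (1 - 4*τ)^k := by
    have := one_add_mul_le_pow (show (-2:ℝ) ≤ -(4*τ) by linarith) k
    rw [← sub_eq_add_neg] at this
    linarith
  have b2 : (1 + 4*τ)^k ≤ 1 + θ := by
    have h1 : 1 + 4*τ ≤ Real.exp (4*τ) := by linarith [Real.add_one_le_exp (4*τ)]
    have h2 := pow_le_pow_left₀ (by positivity) h1 k
    rw [← Real.exp_nat_mul, hx] at h2
    have h3 : Real.exp (θ / 2) ≤ 1 / (1 - θ / 2) := by
      rw [le_div_iff₀ (by linarith)]
      have h5 := Real.add_one_le_exp (-(θ / 2))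
      have h6 : Real.exp (θ / 2)*Real.exp (-(θ/2)) = 1 := by rw [← Real.exp_add]; simp
      have := Real.exp_pos (θ / 2)
      nlinarith only [h5, h6, this]
    have h4 : 1 / (1 - θ / 2) ≤ 1 + θ := by
      rw [div_le_iff₀ (by linarith)]; nlinarith only [hθ, hθ1]
    linarith only [h2, h3, h4]
  rw [← mu_ff D hA, ← hgk]
  have p1 := pow_le_pow_left₀ (mul_nonneg hgb0 (by linarith)) e1 k
  have p2 := pow_le_pow_left₀ (hg D) e2 k
  rw [mul_pow] at p1 p2
  have hmu0 := mu_nonneg n m D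
  have hgk0 : 0 ≤ gb^k := by positivity
  constructor
  · calc _ = mu n m D*(gb^k*(1 - θ)) := by ring
      _ ≤ mu n m D*(gb^k*(1 - 4*τ)^k) := by gcongr
      _ ≤ _ := by gcongr
  · calc _ ≤ mu n m D*(gb^k*(1 + 4*τ)^k) := by gcongr
      _ ≤ mu n m D*(gb^k*(1 + θ)) := by gcongr
      _ = _ := by ring

def sw {α : Type*} [DecidableEq α] (E R S : Finset α) : Finset α := (E \ R) ∪ S

lemma mem_sw {α : Type*} [DecidableEq α] {E R S : Finset α} {x : α} : x ∈ sw E R S ↔ (x ∈ E ∧ x ∉ R) ∨ x ∈ S := by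
  simp [sw]

lemma sw_sw {α : Type*} [DecidableEq α] {E R S : Finset α} (h1 : R ⊆ E) (h2 : Disjoint S E) :
    sw (sw E R S) S R = E := by
  ext x
  have := @h1 x
  have h4 : x ∈ S → x ∉ E := fun h => Finset.disjoint_left.1 h2 h
  simp only [mem_sw]; tauto

lemma deg_sw {n : ℕ} {E R S : Finset (Sym2 (Fin n))} (h1 : R ⊆ E) (h2 : Disjoint S E) (v : Fin n) :
    deg (sw E R S) v + (R.filter (fun e => v ∈ e)).card = deg E v + (S.filter (fun e => v ∈ e)).card := by
  unfold deg sw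
  rw [filter_union, card_union_of_disjoint]
  · have : (E \ R).filter (fun e => v ∈ e) = E.filter (fun e => v ∈ e) \ R.filter (fun e => v ∈ e) := by
      ext x; simp; tauto
    rw [this, card_sdiff_of_subset (filter_subset_filter _ h1)]
    have := card_le_card (filter_subset_filter (fun e => v ∈ e) h1)
    omega
  · apply disjoint_filter_filter
    exact (h2.mono_right sdiff_subset).symm

lemma switch_sum {α ι : Type*} [DecidableEq α] [Fintype ι] (S S' : Finset (Finset α))
    (R A : ι → Finset α) (P P' : Finset α → ι → Prop) [∀ E x, Decidable (P E x)] [∀ E x, Decidable (P' E x)]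
    (w w' : Finset α → ι → ℝ)
    (h1 : ∀ E ∈ S, ∀ x, P E x → (R x ⊆ E ∧ Disjoint (A x) E) ∧ sw E (R x) (A x) ∈ S' ∧ P' (sw E (R x) (A x)) x ∧
      w E x = w' (sw E (R x) (A x)) x)
    (h2 : ∀ E ∈ S', ∀ x, P' E x → (A x ⊆ E ∧ Disjoint (R x) E) ∧ sw E (A x) (R x) ∈ S ∧ P (sw E (A x) (R x)) x) :
    ∑ E ∈ S, ∑ x, (if P E x then w E x else 0) = ∑ E ∈ S', ∑ x, (if P' E x then w' E x else 0) := by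
  rw [sum_comm, sum_comm (s := S')]
  refine sum_congr rfl fun x _ => ?_
  rw [← sum_filter, ← sum_filter]
  refine Finset.sum_bij' (fun E _ => sw E (R x) (A x)) (fun E _ => sw E (A x) (R x)) ?_ ?_ ?_ ?_ ?_
  · intro E hE; rw [mem_filter] at *; have := h1 E hE.1 x hE.2; exact ⟨this.2.1, this.2.2.1⟩
  · intro E hE; rw [mem_filter] at *; exact (h2 E hE.1 x hE.2).2
  · intro E hE; rw [mem_filter] at hE; have := (h1 E hE.1 x hE.2).1; exact sw_sw this.1 this.2
  · intro E hE; rw [mem_filter] at hE; have := (h2 E hE.1 x hE.2).1; exact sw_sw this.1 this.2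
  · intro E hE; rw [mem_filter] at hE; exact (h1 E hE.1 x hE.2).2.2.2

/-- extended codegree -/
def ct {n : ℕ} (E : Finset (Sym2 (Fin n))) (a b : Fin n) : ℕ :=
  (univ.filter (fun u => s(a, u) ∈ E ∧ s(b, u) ∈ E)).card + if s(a, b) ∈ E then 1 else 0

lemma ct_comm {n : ℕ} (E : Finset (Sym2 (Fin n))) (a b : Fin n) : ct E a b = ct E b a := by
  unfold ct; rw [Sym2.eq_swap]; simp only [and_comm]

/-- number of movable edges -/
lemma card_X {n : ℕ} {E : Finset (Sym2 (Fin n))} (hE : ∀ v, s(v, v) ∉ E) {a b : Fin n} (hab : a ≠ b) :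
    (univ.filter (fun u => u ≠ a ∧ s(b, u) ∈ E ∧ s(a, u) ∉ E)).card + ct E a b = deg E b := by
  rw [deg_eq_nb, ct, ← add_assoc, ← card_union_of_disjoint]
  · split_ifs with h
    · rw [← card_singleton a, ← card_union_of_disjoint]
      · congr 1; ext u; simp only [mem_union, mem_filter, mem_univ, true_and, mem_singleton, mem_nb]
        rw [Sym2.eq_swap] at h
        have := hE a
        by_cases hu : u = a
        · subst hu; simp [h]
        · simp [hu]; tauto
      · rw [disjoint_singleton_right]; simp [hE]
    · rw [add_zero]
      congr 1; ext u; simp only [mem_union, mem_filter, mem_univ, true_and, mem_nb]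
      rw [Sym2.eq_swap] at h
      by_cases hu : u = a
      · subst hu; simp [h]
      · simp [hu]; tauto
  · rw [disjoint_filter]; intro u _ h1 h2; exact h1.2.2 h2.1

lemma GD_sw {n : ℕ} {D D' : Fin n → ℕ} {E R S : Finset (Sym2 (Fin n))} (hE : E ∈ GD n D) (h1 : R ⊆ E)
    (h2 : Disjoint S E) (hS : ∀ v, s(v, v) ∉ S)
    (hD : ∀ v, D' v + (R.filter (fun e => v ∈ e)).card = D v + (S.filter (fun e => v ∈ e)).card) :
    sw E R S ∈ GD n D' := by
  rw [mem_GD] at *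
  refine ⟨fun v hv => ?_, fun v => ?_⟩
  · rcases mem_sw.1 hv with h | h
    · exact hE.1 v h.1
    · exact hS v h
  · have := deg_sw h1 h2 v
    have := hD v
    have := hE.2 v
    omega

lemma move_ok {n : ℕ} {T : Fin n → ℕ} {a b u : Fin n} (hab : a ≠ b) {E : Finset (Sym2 (Fin n))}
    (hE : E ∈ GD n (up T b)) (hP : u ≠ a ∧ s(b, u) ∈ E ∧ s(a, u) ∉ E) :
    (({s(b, u)} : Finset _) ⊆ E ∧ Disjoint {s(a, u)} E) ∧ sw E {s(b, u)} {s(a, u)} ∈ GD n (up T a) ∧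
      (u ≠ b ∧ s(a, u) ∈ sw E {s(b, u)} {s(a, u)} ∧ s(b, u) ∉ sw E {s(b, u)} {s(a, u)}) ∧
      ct (sw E {s(b, u)} {s(a, u)}) a b = ct E a b := by
  obtain ⟨h1, h2, h3⟩ := hP
  have hl := (mem_GD.1 hE).1
  have hub : u ≠ b := by rintro rfl; exact hl _ h2
  have hR : ({s(b, u)} : Finset _) ⊆ E := by simpa using h2
  have hS : Disjoint ({s(a, u)} : Finset _) E := by simpa using h3
  refine ⟨⟨hR, hS⟩, GD_sw hE hR hS ?_ ?_, ⟨hub, ?_, ?_⟩, ?_⟩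
  · intro v; simp; grind
  · intro v
    simp only [up_apply, filter_singleton, Sym2.mem_iff]
    grind
  · simp [mem_sw]
  · simp [mem_sw]; grind
  · unfold ct
    simp only [mem_sw, mem_singleton, Sym2.eq_iff]
    congr 2
    · ext w; simp only [mem_filter, mem_univ, true_and]
      grind
    · grind

/-- move lemma -/
lemma move {n : ℕ} (T : Fin n → ℕ) {a b : Fin n} (hab : a ≠ b) (h : ℕ → ℝ) :
    ∑ E ∈ GD n (up T b), h (ct E a b)*((T b : ℝ) + 1 - ct E a b) =
      ∑ E ∈ GD n (up T a), h (ct E a b)*((T a : ℝ) + 1 - ct E a b) := by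
  have key : ∀ x y : Fin n, x ≠ y → ∀ E ∈ GD n (up T y), h (ct E x y)*((T y : ℝ) + 1 - ct E x y) =
      ∑ u, if (u ≠ x ∧ s(y, u) ∈ E ∧ s(x, u) ∉ E) then h (ct E x y) else 0 := by
    intro x y hxy E hE
    rw [mem_GD] at hE
    have := card_X hE.1 hxy
    rw [hE.2 y, up_apply, if_pos rfl] at this
    rw [← sum_filter, sum_const, nsmul_eq_mul, mul_comm]
    congr 1
    have : (((univ.filter (fun u => u ≠ x ∧ s(y, u) ∈ E ∧ s(x, u) ∉ E)).card + ct E x y : ℕ) : ℝ) = ((T y + 1 : ℕ) : ℝ) := by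
      rw [this]
    push_cast at this
    linarith
  rw [sum_congr rfl (key a b hab)]
  have e2 : ∑ E ∈ GD n (up T a), h (ct E a b)*((T a : ℝ) + 1 - ct E a b) =
     ∑ E ∈ GD n (up T a), ∑ u, if (u ≠ b ∧ s(a, u) ∈ E ∧ s(b, u) ∉ E) then h (ct E a b) else 0 := by
    refine sum_congr rfl fun E hE => ?_
    have := key b a hab.symm E hE
    rw [ct_comm E b a] at this
    exact this
  rw [e2]
  refine switch_sum _ _ (fun u => {s(b, u)}) (fun u => {s(a, u)}) _ _ _ _ ?_ ?_
  · intro E hE u hP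
    obtain ⟨h1, h2, h3, h4⟩ := move_ok hab hE hP
    exact ⟨h1, h2, h3, by rw [h4]⟩
  · intro E hE u hP
    obtain ⟨h1, h2, h3, h4⟩ := move_ok hab.symm hE hP
    exact ⟨h1, h2, h3⟩

lemma card_filter_pair {α : Type*} [DecidableEq α] {e f : α} (h : e ≠ f) (p : α → Prop) [DecidablePred p] :
    (({e, f} : Finset α).filter p).card = (if p e then 1 else 0) + (if p f then 1 else 0) := by
  rw [card_filter, sum_pair h]

lemma switch_le {α ι : Type*} [DecidableEq α] [Fintype ι] (S S' : Finset (Finset α))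
    (R A : ι → Finset α) (P P' : Finset α → ι → Prop) [∀ E x, Decidable (P E x)] [∀ E x, Decidable (P' E x)]
    (h1 : ∀ E ∈ S, ∀ x, P E x → (R x ⊆ E ∧ Disjoint (A x) E) ∧ sw E (R x) (A x) ∈ S' ∧ P' (sw E (R x) (A x)) x) :
    ∑ E ∈ S, (univ.filter (P E)).card ≤ ∑ E ∈ S', (univ.filter (P' E)).card := by
  simp only [card_filter]
  rw [sum_comm, sum_comm (s := S')]
  refine sum_le_sum fun x _ => ?_
  rw [← card_filter, ← card_filter]
  apply card_le_card_of_injOn (fun E => sw E (R x) (A x))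
  · intro E hE
    simp only [coe_filter, Set.mem_ofPred_eq] at hE ⊢
    exact (h1 E hE.1 x hE.2).2
  · intro E hE F hF h
    simp only [coe_filter, Set.mem_ofPred_eq] at hE hF h
    have a1 := (h1 E hE.1 x hE.2).1
    have a2 := (h1 F hF.1 x hF.2).1
    rw [← sw_sw a1.1 a1.2, ← sw_sw a2.1 a2.2, h]

lemma sw2_GD {n : ℕ} {D : Fin n → ℕ} {E : Finset (Sym2 (Fin n))} {u v x y : Fin n} (hE : E ∈ GD n D)
    (huv : u ≠ v) (h1 : s(u, v) ∈ E) (h2 : s(x, y) ∈ E) (hxu : x ≠ u) (hux : s(u, x) ∉ E) (hyv : y ≠ v)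
    (hvy : s(v, y) ∉ E) :
    ({s(u, v), s(x, y)} ⊆ E ∧ Disjoint {s(u, x), s(v, y)} E) ∧ sw E {s(u, v), s(x, y)} {s(u, x), s(v, y)} ∈ GD n D := by
  have hR : {s(u, v), s(x, y)} ⊆ E := by
    intro e he; simp only [mem_insert, mem_singleton] at he; rcases he with rfl | rfl <;> assumption
  have hS : Disjoint {s(u, x), s(v, y)} E := by
    rw [disjoint_left]
    intro e he; simp only [mem_insert, mem_singleton] at he; rcases he with rfl | rfl <;> assumption
  refine ⟨⟨hR, hS⟩, GD_sw hE hR hS ?_ ?_⟩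
  · intro w; simp only [mem_insert, mem_singleton, Sym2.eq_iff]; grind
  · intro w
    have hl := (mem_GD.1 hE).1
    have hxy : x ≠ y := by rintro rfl; exact hl _ h2
    have e1 : s(u, v) ≠ s(x, y) := by
      intro h; rw [Sym2.eq_iff] at h
      rcases h with ⟨h, h'⟩ | ⟨h, h'⟩
      · exact hxu h.symm
      · subst h'; exact hux h1
    have e2 : s(u, x) ≠ s(v, y) := by
      intro h; rw [Sym2.eq_iff] at h
      rcases h with ⟨h, h'⟩ | ⟨h, h'⟩
      · exact huv h
      · subst h'; exact hux h1
    rw [card_filter_pair e1, card_filter_pair e2]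
    simp only [Sym2.mem_iff]
    grind

lemma switch_bound {n M Δ : ℕ} {D : Fin n → ℕ} (hD : ∑ i, D i = M) (hΔ : ∀ i, D i ≤ Δ) (hΔM : 12*Δ^2 ≤ M)
    {u v : Fin n} (huv : u ≠ v) (Q : Finset (Sym2 (Fin n)) → Prop) [DecidablePred Q]
    (hQ : ∀ E ∈ GD n D, ∀ x y, s(u, v) ∈ E → s(x, y) ∈ E → x ≠ u → s(u, x) ∉ E → y ≠ v → s(v, y) ∉ E → Q E →
      Q (sw E {s(u, v), s(x, y)} {s(u, x), s(v, y)})) :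
    ((GD n D).filter (fun E => s(u, v) ∈ E ∧ Q E)).card*M ≤
      2*(D u*D v)*((GD n D).filter Q).card := by
  have h := switch_le ((GD n D).filter (fun E => s(u, v) ∈ E ∧ Q E)) ((GD n D).filter Q)
    (fun z : Fin n × Fin n => {s(u, v), s(z.1, z.2)}) (fun z => {s(u, z.1), s(v, z.2)})
    (fun E z => s(z.1, z.2) ∈ E ∧ z.1 ≠ u ∧ s(u, z.1) ∉ E ∧ z.2 ≠ v ∧ s(v, z.2) ∉ E)
    (fun E z => s(u, z.1) ∈ E ∧ s(v, z.2) ∈ E) ?_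
  · have hR : ∑ E ∈ (GD n D).filter Q, (univ.filter (fun z : Fin n × Fin n => s(u, z.1) ∈ E ∧ s(v, z.2) ∈ E)).card =
        ((GD n D).filter Q).card*(D u*D v) := by
      rw [Finset.sum_const_nat]
      intro E hE
      rw [mem_filter, mem_GD] at hE
      rw [← hE.1.2 u, ← hE.1.2 v, deg_eq_nb, deg_eq_nb, ← card_product]
      congr 1; ext z; simp [mem_nb]
    rw [hR] at h
    have hL : ((GD n D).filter (fun E => s(u, v) ∈ E ∧ Q E)).card*M ≤
        2*∑ E ∈ (GD n D).filter (fun E => s(u, v) ∈ E ∧ Q E), (univ.filter (fun z : Fin n × Fin n =>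
          s(z.1, z.2) ∈ E ∧ z.1 ≠ u ∧ s(u, z.1) ∉ E ∧ z.2 ≠ v ∧ s(v, z.2) ∉ E)).card := by
      rw [mul_sum, ← smul_eq_mul, ← sum_const]
      refine sum_le_sum fun E hE => ?_
      rw [mem_filter, mem_GD] at hE
      obtain ⟨⟨hl, hdeg⟩, huvE, -⟩ := hE
      have hall : (univ.filter (fun z : Fin n × Fin n => s(z.1, z.2) ∈ E)).card = M := by
        rw [← hD, card_filter, ← univ_product_univ, sum_product]
        refine sum_congr rfl fun x _ => ?_
        rw [← hdeg x, deg_eq_nb, nb, card_filter]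
      have hcov : univ.filter (fun z : Fin n × Fin n => s(z.1, z.2) ∈ E) ⊆
          univ.filter (fun z : Fin n × Fin n =>
            s(z.1, z.2) ∈ E ∧ z.1 ≠ u ∧ s(u, z.1) ∉ E ∧ z.2 ≠ v ∧ s(v, z.2) ∉ E) ∪
          ((insert u (nb E u)).biUnion (fun x => (nb E x).image (fun y => (x, y))) ∪
          (insert v (nb E v)).biUnion (fun y => (nb E y).image (fun x => (x, y)))) := by
        intro z hz
        simp only [mem_filter, mem_univ, true_and, mem_union, mem_biUnion, mem_insert, mem_image, mem_nb] at hz ⊢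
        by_cases h1 : z.1 = u ∨ s(u, z.1) ∈ E
        · right; left; exact ⟨z.1, h1, z.2, hz, rfl⟩
        · by_cases h2 : z.2 = v ∨ s(v, z.2) ∈ E
          · right; right; exact ⟨z.2, h2, z.1, by rwa [Sym2.eq_swap], rfl⟩
          · left; tauto
      have hb : ∀ w : Fin n, ∀ g : Fin n → Fin n → Fin n × Fin n, ((insert w (nb E w)).biUnion (fun x => (nb E x).image (g x))).card ≤ (Δ + 1)*Δ := by
        intro w g
        have hd : ∀ x, (nb E x).card ≤ Δ := fun x => by rw [← deg_eq_nb, hdeg x]; exact hΔ x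
        refine (card_biUnion_le_card_mul _ _ Δ fun x _ => card_image_le.trans (hd x)).trans ?_
        exact Nat.mul_le_mul_right _ ((card_insert_le _ _).trans (by have := hd w; omega))
      have hc := (card_le_card hcov).trans (card_union_le _ _)
      have hc2 := card_union_le ((insert u (nb E u)).biUnion (fun x => (nb E x).image (fun y => (x, y))))
          ((insert v (nb E v)).biUnion (fun y => (nb E y).image (fun x => (x, y))))
      have b1 := hb u (fun x y => (x, y))
      have b2 := hb v (fun y x => (x, y))
      rw [hall] at hc
      have hΔ1 : 1 ≤ Δ := by
        refine le_trans ?_ (hΔ u)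
        rw [← hdeg u, deg_eq_nb]
        exact card_pos.2 ⟨v, mem_nb.2 huvE⟩
      nlinarith
    calc _ ≤ _ := hL
      _ ≤ 2*_ := Nat.mul_le_mul_left _ h
      _ = _ := by ring
  · intro E hE z hz
    rw [mem_filter] at hE
    obtain ⟨h1, h2, h3, h4, h5⟩ := hz
    obtain ⟨a1, a2⟩ := sw2_GD hE.1 huv hE.2.1 h1 h2 h3 h4 h5
    refine ⟨a1, mem_filter.2 ⟨a2, hQ E hE.1 _ _ hE.2.1 h1 h2 h3 h4 h5 hE.2.2⟩, ?_⟩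
    simp [mem_sw]

lemma ct_bound {n M Δ : ℕ} {D : Fin n → ℕ} (hD : ∑ i, D i = M) (hΔ : ∀ i, D i ≤ Δ) (hΔM : 12*Δ^2 ≤ M)
    {a b : Fin n} (hab : a ≠ b) :
    M*∑ E ∈ GD n D, ct E a b ≤ 4*Δ*(D a*D b)*(GD n D).card := by
  have e1 : ∑ E ∈ GD n D, ct E a b = ∑ w, ((GD n D).filter (fun E => s(a, w) ∈ E ∧ s(w, b) ∈ E)).card +
      ((GD n D).filter (fun E => s(a, b) ∈ E ∧ True)).card := by
    unfold ct
    simp only [card_filter, sum_add_distrib, and_true]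
    rw [sum_comm]
    congr 1
    refine sum_congr rfl fun w _ => sum_congr rfl fun E _ => ?_
    rw [Sym2.eq_swap (a := w)]
  have e2 : ∑ w, ((GD n D).filter (fun E => s(w, b) ∈ E)).card = D b*(GD n D).card := by
    simp only [card_filter]
    rw [sum_comm, mul_comm, ← smul_eq_mul, ← sum_const]
    refine sum_congr rfl fun E hE => ?_
    rw [← (mem_GD.1 hE).2 b, deg_eq_nb, nb, card_filter]
    exact sum_congr rfl fun w _ => by rw [Sym2.eq_swap]
  rw [e1, mul_add]
  have b1 : ∀ w, M*((GD n D).filter (fun E => s(a, w) ∈ E ∧ s(w, b) ∈ E)).card ≤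
      2*(D a*Δ)*((GD n D).filter (fun E => s(w, b) ∈ E)).card := by
    intro w
    rcases eq_or_ne a w with rfl | haw
    · rw [filter_false_of_mem, card_empty, mul_zero]
      · positivity
      · intro E hE h; exact (mem_GD.1 hE).1 _ h.1
    rw [mul_comm]
    refine (switch_bound hD hΔ hΔM haw (fun E => s(w, b) ∈ E) ?_).trans ?_
    · intro E hE x y h1 h2 h3 h4 h5 h6 h7
      rw [mem_sw]; left; refine ⟨h7, ?_⟩
      simp only [mem_insert, mem_singleton, Sym2.eq_iff]
      grind
    · exact Nat.mul_le_mul_right _ (Nat.mul_le_mul_left _ (Nat.mul_le_mul_left _ (hΔ w)))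
  have b2 := switch_bound hD hΔ hΔM hab (fun _ => True) (fun _ _ _ _ _ _ _ _ _ _ _ => trivial)
  have b3 := sum_le_sum (s := univ) fun w _ => b1 w
  rw [← mul_sum, ← mul_sum, e2] at b3
  rw [mul_comm] at b2
  rw [filter_true_of_mem (fun _ _ => trivial)] at b2
  rcases Nat.eq_zero_or_pos Δ with h0 | h0
  · have := hΔ a; have h1 : D a = 0 := by omega
    rw [h1] at b2 b3 ⊢; simp only [zero_mul, mul_zero] at *; omega
  · calc _ ≤ _ := add_le_add b3 b2
      _ ≤ 2*(D a*Δ)*(D b*(GD n D).card) + Δ*(2*(D a*D b)*(GD n D).card) :=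
        add_le_add le_rfl (Nat.le_mul_of_pos_left _ h0)
      _ = _ := by ring

/-- normalised counts -/
def xx {n : ℕ} (T : Fin n → ℕ) (a : Fin n) : ℝ := NN n (up T a)*(T a + 1) / rr T a

lemma xx_nonneg {n : ℕ} (T : Fin n → ℕ) (a : Fin n) (h : 0 < rr T a) : 0 ≤ xx T a := by
  unfold xx NN; positivity

lemma ff_up {n m : ℕ} (T : Fin n → ℕ) : ∃ C : ℝ, 0 ≤ C ∧ ∀ a, 0 < rr T a → ff n m (up T a) = C*xx T a := by
  refine ⟨((n*(n - 1)).choose (2*m) : ℝ) / ((n.choose 2).choose m : ℝ) / wt n T,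
    div_nonneg (by positivity) (wt_nonneg _ _), ?_⟩
  intro a ha
  have h := wt_up T a
  have h2 : ((up T a a : ℕ) : ℝ) = T a + 1 := by rw [up_apply]; simp
  rw [h2] at h
  have h3 : wt n (up T a) = wt n T*rr T a / (T a + 1) := by
    rw [← h]; field_simp
  unfold ff nu mu xx
  rw [h3]
  have := ha.ne'
  have h4 : (T a : ℝ) + 1 ≠ 0 := by positivity
  rcases eq_or_ne (wt n T) 0 with h0 | h0
  · simp [h0]
  · field_simp

lemma Hyp_of {n m : ℕ} (DD : Set (Fin n → ℕ)) (δ : ℝ)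
    (hδ : 0 ≤ δ) (h : ∀ T ∈ Wt n (2*m - 1), ∀ a b, a ≠ b → 0 < rr T a → 0 < rr T b → up T b ∈ DD →
      xx T b - xx T a ≤ δ*xx T b) : Hyp n m DD δ := by
  intro T hT a b hab ha hb
  obtain ⟨C, hC, hCe⟩ := ff_up (m := m) T
  have one : ∀ a b, a ≠ b → 0 < rr T a → 0 < rr T b →
      ff n m (up T b) - ff n m (up T a) ≤ rho DD δ (up T b)*ff n m (up T b) := by
    intro a b hab ha hb
    rw [hCe a ha, hCe b hb]
    have : xx T b - xx T a ≤ rho DD δ (up T b)*xx T b := by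
      unfold rho
      split_ifs with h1
      · exact h T hT a b hab ha hb h1
      · linarith [xx_nonneg T a ha]
    have := mll this hC
    linarith
  have h1 := one a b hab ha hb
  have h2 := one b a hab.symm hb ha
  have n1 := mul_nonneg (rho_nonneg DD hδ (up T a)) (ff_nonneg n m (up T a))
  have n2 := mul_nonneg (rho_nonneg DD hδ (up T b)) (ff_nonneg n m (up T b))
  rw [abs_le]; constructor <;> linarith

/-- sparse one sided bound -/
lemma sparse_one {n m Δ : ℕ} (hm : 1 ≤ m) {T : Fin n → ℕ} (hT : T ∈ Wt n (2*m - 1)) {a b : Fin n} (hab : a ≠ b)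
    (ha : 0 < rr T a) (hb : 0 < rr T b) (hΔ : ∀ i, up T b i ≤ Δ) (hΔM : 12*Δ^2 ≤ 2*m) (hn : 2 ≤ n) :
    xx T b - xx T a ≤ ((Δ : ℝ) / (n - 1) + 4*Δ^2 / (2*m))*xx T b := by
  have hsum : ∑ i, up T b i = 2*m := by
    have := mem_Wt.1 (up_mem hT b); omega
  have hct := ct_bound hsum hΔ hΔM hab
  have hmove := move T hab (fun _ => 1)
  simp only [one_mul, sum_sub_distrib, sum_const, nsmul_eq_mul] at hmove
  have hn1 : (0:ℝ) < (n:ℝ) - 1 := by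
    have : (2:ℝ) ≤ n := by exact_mod_cast hn
    linarith
  have hm0 : (0:ℝ) < m := by exact_mod_cast hm
  have hbD : up T b b = T b + 1 := by rw [up_apply]; simp
  have hb1 : (T b : ℝ) + 1 ≤ Δ := by have := hΔ b; rw [hbD] at this; exact_mod_cast this
  have ha1 : (up T b a : ℝ) ≤ Δ := by exact_mod_cast hΔ a
  have xa : xx T a*rr T a = NN n (up T a)*(T a + 1) := by unfold xx; field_simp
  have xb : xx T b*rr T b = NN n (up T b)*(T b + 1) := by unfold xx; field_simp
  have xa0 := xx_nonneg T a ha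
  have xb0 := xx_nonneg T b hb
  have hct' : (2*m : ℝ)*∑ E ∈ GD n (up T b), (ct E a b : ℝ) ≤ 4*Δ^2*(NN n (up T b)*(T b + 1)) := by
    have : ((2*m*∑ E ∈ GD n (up T b), ct E a b : ℕ) : ℝ) ≤ ((4*Δ*(up T b a*up T b b)*(GD n (up T b)).card : ℕ) : ℝ) := by
      exact_mod_cast hct
    push_cast [hbD] at this
    refine this.trans ?_
    unfold NN
    have e : (4*(Δ:ℝ)*(up T b a*(T b + 1))*(GD n (up T b)).card) ≤ 4*(Δ:ℝ)*(Δ*(T b + 1))*(GD n (up T b)).card := by gcongr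
    linarith
  have hKa : (0:ℝ) ≤ ∑ E ∈ GD n (up T a), (ct E a b : ℝ) := sum_nonneg fun _ _ => by positivity
  set Kb := ∑ E ∈ GD n (up T b), (ct E a b : ℝ)
  have hKb : Kb ≤ 4*Δ^2 / (2*m)*(xx T b*rr T b) := by
    rw [xb, div_mul_eq_mul_div, le_div_iff₀ (by positivity)]; linarith
  have hrb : rr T b ≤ (n:ℝ) - 1 := by unfold rr; linarith [Nat.cast_nonneg (α := ℝ) (T b)]
  have hra : rr T a ≤ (n:ℝ) - 1 := by unfold rr; linarith [Nat.cast_nonneg (α := ℝ) (T a)]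
  have hrb2 : (n:ℝ) - 1 - Δ ≤ rr T b := by unfold rr; linarith
  have k1 : xx T b*rr T b - Kb ≤ xx T a*((n:ℝ) - 1) := by
    have : xx T a*rr T a ≤ xx T a*((n:ℝ) - 1) := mll hra xa0
    unfold NN at xa xb
    linarith
  have hε : 0 ≤ 4*(Δ:ℝ)^2 / (2*m) := by positivity
  set ε := 4*(Δ:ℝ)^2 / (2*m)
  have k2 : Kb ≤ ε*(xx T b*((n:ℝ) - 1)) := hKb.trans (by gcongr)
  have k3 : xx T b*((n:ℝ) - 1 - Δ) ≤ xx T b*rr T b := mll hrb2 xb0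
  have k4 : (xx T b - xx T a)*((n:ℝ) - 1) ≤ (((Δ : ℝ) / (n - 1) + ε)*xx T b)*((n:ℝ) - 1) := by
    have : (((Δ : ℝ) / (n - 1) + ε)*xx T b)*((n:ℝ) - 1) = Δ*xx T b + ε*(xx T b*((n:ℝ) - 1)) := by
      field_simp
    rw [this]; linarith
  exact le_of_mul_le_mul_right k4 hn1

lemma mode_bound {N m : ℕ} (hm : m < N) : N^N ≤ (N + 1)*(N.choose m*m^m*(N - m)^(N - m)) := by
  set t : ℕ → ℕ := fun k => N.choose k*m^k*(N - m)^(N - k) with ht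
  have hstep : ∀ k, k < N → (k + 1)*(N - m)*t (k + 1) = (N - k)*m*t k := by
    intro k hk
    have h1 := Nat.choose_succ_right_eq N k
    have h2 : N - k = (N - (k + 1)) + 1 := by omega
    simp only [ht]
    calc _ = (N.choose (k + 1)*(k + 1))*m^(k + 1)*((N - m)^(N - (k + 1))*(N - m)) := by ring
      _ = (N.choose k*(N - k))*m^(k + 1)*(N - m)^(N - k) := by rw [h1, ← pow_succ, ← h2]
      _ = _ := by ring
  have hup : ∀ k, k + 1 ≤ m → t k ≤ t (k + 1) := by
    intro k hk
    have h := hstep k (by omega)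
    have h3 : (k + 1)*(N - m) ≤ (N - k)*m := by
      rw [mul_comm (N - k)]; exact Nat.mul_le_mul hk (by omega)
    have h4 : 0 < (k + 1)*(N - m) := Nat.mul_pos (by omega) (by omega)
    have h5 := Nat.mul_le_mul_right (t k) h3
    rw [← h] at h5
    exact Nat.le_of_mul_le_mul_left h5 h4
  have hdown : ∀ k, m ≤ k → k < N → t (k + 1) ≤ t k := by
    intro k hk hkN
    have h := hstep k hkN
    have h3 : (N - k)*m ≤ (k + 1)*(N - m) := by
      rw [mul_comm]; exact Nat.mul_le_mul (by omega) (by omega)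
    have h4 : 0 < (k + 1)*(N - m) := Nat.mul_pos (by omega) (by omega)
    have h5 := Nat.mul_le_mul_right (t k) h3
    rw [← h] at h5
    exact Nat.le_of_mul_le_mul_left h5 h4
  have hle1 : ∀ d, d ≤ m → t (m - d) ≤ t m := by
    intro d
    induction d with
    | zero => intro _; simp
    | succ d ih =>
      intro hd
      have := hup (m - (d + 1)) (by omega)
      rw [show m - (d + 1) + 1 = m - d by omega] at this
      exact this.trans (ih (by omega))
  have hle2 : ∀ d, m + d ≤ N → t (m + d) ≤ t m := by
    intro d
    induction d with
    | zero => intro _; simp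
    | succ d ih =>
      intro hd
      exact (hdown (m + d) (by omega) (by omega)).trans (ih (by omega))
  have hall : ∀ k ∈ range (N + 1), t k ≤ t m := by
    intro k hk
    rw [mem_range] at hk
    rcases le_total k m with h | h
    · have := hle1 (m - k) (by omega); rwa [show m - (m - k) = k by omega] at this
    · have := hle2 (k - m) (by omega); rwa [show m + (k - m) = k by omega] at this
  have hs : N^N = ∑ k ∈ range (N + 1), t k := by
    have := add_pow m (N - m) N
    rw [show m + (N - m) = N by omega] at this
    rw [this]
    exact sum_congr rfl fun k _ => by simp only [ht, Nat.cast_id]; ring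
  rw [hs]
  exact (Finset.sum_le_card_nsmul _ _ _ hall).trans (by simp [ht])

/-- common neighbours of a set -/
def XA {n : ℕ} (E : Finset (Sym2 (Fin n))) (A : Finset (Fin n)) : ℕ :=
  (univ.filter (fun u => ∀ a ∈ A, s(a, u) ∈ E)).card

lemma sum_containing {α : Type*} [DecidableEq α] (U K : Finset α) (hK : K ⊆ U) (p : ℝ) :
    ∑ E ∈ U.powerset, (if K ⊆ E then p^E.card*(1 - p)^(U \ E).card else 0) = p^K.card := by
  have h := Finset.prod_add (fun _ => p) (fun e => if e ∈ K then 0 else 1 - p) U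
  have h1 : ∏ e ∈ U, (p + if e ∈ K then 0 else 1 - p) = p^K.card := by
    have : ∀ e ∈ U, (p + if e ∈ K then 0 else 1 - p) = if e ∈ K then p else 1 := by
      intro e _; split_ifs <;> ring
    rw [Finset.prod_congr rfl this, prod_ite, prod_const, prod_const_one, mul_one, filter_mem_eq_inter,
      inter_eq_right.2 hK]
  rw [← h1, h]
  refine sum_congr rfl fun E hE => ?_
  rw [prod_const]
  split_ifs with hKE
  · congr 1
    rw [Finset.prod_congr rfl (g := fun _ => 1 - p), prod_const]
    intro e he
    rw [if_neg]; intro h'; exact (mem_sdiff.1 he).2 (hKE h')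
  · symm
    obtain ⟨e, he1, he2⟩ := not_subset.1 hKE
    rw [Finset.prod_eq_zero (i := e), mul_zero]
    · exact mem_sdiff.2 ⟨hK he1, he2⟩
    · simp [he1]

def Und (n : ℕ) : Finset (Sym2 (Fin n)) := univ.filter (fun e => ¬ e.IsDiag)

lemma mgf {n : ℕ} (A : Finset (Fin n)) (hA : A.Nonempty) (p z : ℝ) :
    ∑ E ∈ (Und n).powerset, p^E.card*(1 - p)^(Und n \ E).card*(1 + z)^(XA E A) =
      (1 + z*p^A.card)^(n - A.card) := by
  set K : Finset (Fin n) → Finset (Sym2 (Fin n)) := fun B => (A ×ˢ B).image (fun q => s(q.1, q.2)) with hKdef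
  have hKE : ∀ B E, K B ⊆ E ↔ ∀ u ∈ B, ∀ a ∈ A, s(a, u) ∈ E := by
    intro B E
    simp only [hKdef, subset_iff, mem_image, mem_product, Prod.exists]
    constructor
    · intro h u hu a ha; exact h ⟨a, u, ⟨ha, hu⟩, rfl⟩
    · rintro h _ ⟨a, u, ⟨ha, hu⟩, rfl⟩; exact h u hu a ha
  have hKU : ∀ B ∈ (Aᶜ).powerset, K B ⊆ Und n := by
    intro B hB
    rw [hKE]
    intro u hu a ha
    have := mem_powerset.1 hB hu
    simp only [Und, mem_filter, mem_univ, true_and, Sym2.mk_isDiag_iff]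
    rintro rfl; simp [ha] at this
  have hKc : ∀ B ∈ (Aᶜ).powerset, (K B).card = A.card*B.card := by
    intro B hB
    rw [hKdef, card_image_of_injOn, card_product]
    intro x hx y hy hxy
    simp only [coe_product, Set.mem_prod, mem_coe] at hx hy
    have h1 := mem_powerset.1 hB hx.2
    have h2 := mem_powerset.1 hB hy.2
    simp only [mem_compl] at h1 h2
    simp only [Sym2.eq_iff] at hxy
    rcases hxy with h | h
    · exact Prod.ext h.1 h.2
    · exact absurd (h.1 ▸ hx.1) h2
  have hX : ∀ E ∈ (Und n).powerset, (1 + z)^(XA E A) = ∑ B ∈ (Aᶜ).powerset, z^B.card*if K B ⊆ E then 1 else 0 := by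
    intro E hE
    have e1 : (1 + z)^(XA E A) = ∏ u ∈ Aᶜ, (1 + if (∀ a ∈ A, s(a, u) ∈ E) then z else 0) := by
      have : ∀ u ∈ Aᶜ, (1 + if (∀ a ∈ A, s(a, u) ∈ E) then z else 0) = if (∀ a ∈ A, s(a, u) ∈ E) then 1 + z else 1 := by
        intro u _; split_ifs <;> ring
      rw [Finset.prod_congr rfl this, prod_ite, prod_const, prod_const_one, mul_one]
      congr 1; unfold XA; congr 1; ext u
      simp only [mem_filter, mem_univ, true_and, mem_compl]
      constructor
      · intro h; refine ⟨fun hu => ?_, h⟩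
        have := mem_powerset.1 hE (h u hu)
        simp [Und] at this
      · intro h; exact h.2
    rw [e1, Finset.prod_one_add]
    refine sum_congr rfl fun B _ => ?_
    rw [prod_ite_zero, prod_const]
    simp only [hKE]
    split_ifs <;> simp
  have hprod : (1 + z*p^A.card)^(n - A.card) = ∑ B ∈ (Aᶜ).powerset, z^B.card*p^(A.card*B.card) := by
    have h1 : ∏ u ∈ Aᶜ, (1 + z*p^A.card) = (1 + z*p^A.card)^(n - A.card) := by
      rw [prod_const, card_compl, Fintype.card_fin]
    rw [← h1, Finset.prod_one_add]
    refine sum_congr rfl fun B _ => ?_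
    rw [prod_const, mul_pow, pow_mul]
  rw [hprod]
  calc _ = ∑ E ∈ (Und n).powerset, ∑ B ∈ (Aᶜ).powerset, z^B.card*(if K B ⊆ E then p^E.card*(1 - p)^(Und n \ E).card else 0) := by
        refine sum_congr rfl fun E hE => ?_
        rw [hX E hE, mul_sum]
        refine sum_congr rfl fun B _ => ?_
        split_ifs <;> ring
    _ = _ := by
        rw [sum_comm]
        refine sum_congr rfl fun B hB => ?_
        rw [← mul_sum, sum_containing _ _ (hKU B hB), hKc B hB]

lemma GG_eq (n m : ℕ) : (Graphs n).filter (fun E => E.card = m) = (Und n).powersetCard m := Graphs_card_eq n m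

lemma Und_card (n : ℕ) : (Und n).card = n.choose 2 := card_nondiag n

/-- transfer of the mgf to G(n,m) -/
lemma mgf_m {n m : ℕ} (hm : m < n.choose 2) (A : Finset (Fin n)) (hA : A.Nonempty) (z : ℝ) (hz : -1 ≤ z) :
    ∑ E ∈ (Und n).powersetCard m, (1 + z)^(XA E A) ≤
      ((n.choose 2 : ℝ) + 1)*((n.choose 2).choose m)*(1 + z*((m : ℝ) / n.choose 2)^A.card)^(n - A.card) := by
  set N := n.choose 2 with hN
  set p : ℝ := (m : ℝ) / N with hp
  have hN0 : (0:ℝ) < N := by exact_mod_cast (by omega : 0 < N)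
  have hp0 : 0 ≤ p := by positivity
  have hp1 : 0 ≤ 1 - p := by
    rw [hp, sub_nonneg, div_le_one hN0]; exact_mod_cast hm.le
  have h := mgf A hA p z
  have hsub : (Und n).powersetCard m ⊆ (Und n).powerset := by
    intro E hE; rw [mem_powersetCard] at hE; exact mem_powerset.2 hE.1
  have h1 : ∑ E ∈ (Und n).powersetCard m, p^m*(1 - p)^(N - m)*(1 + z)^(XA E A) ≤ (1 + z*p^A.card)^(n - A.card) := by
    rw [← h]
    refine le_trans (le_of_eq ?_) (sum_le_sum_of_subset_of_nonneg hsub ?_)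
    · refine sum_congr rfl fun E hE => ?_
      rw [mem_powersetCard] at hE
      rw [card_sdiff_of_subset hE.1, hE.2, Und_card]
    · intro E _ _
      have : 0 ≤ 1 + z := by linarith
      positivity
  rw [← mul_sum] at h1
  have hmode : (1:ℝ) ≤ (N + 1)*(N.choose m)*(p^m*(1 - p)^(N - m)) := by
    have hb := mode_bound hm
    have hb' : ((N : ℝ)^N) ≤ (N + 1)*(N.choose m*m^m*((N:ℝ) - m)^(N - m)) := by
      have : ((N^N : ℕ) : ℝ) ≤ (((N + 1)*(N.choose m*m^m*(N - m)^(N - m)) : ℕ) : ℝ) := by exact_mod_cast hb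
      push_cast [Nat.cast_sub hm.le] at this
      exact this
    have e1 : p^m*(1 - p)^(N - m) = (m^m*((N:ℝ) - m)^(N - m)) / N^N := by
      have : 1 - p = ((N:ℝ) - m) / N := by rw [hp]; field_simp
      rw [this, hp, div_pow, div_pow, div_mul_div_comm, ← pow_add]
      congr 2; omega
    rw [e1, ← mul_div_assoc, le_div_iff₀ (by positivity)]
    linarith
  set S := ∑ E ∈ (Und n).powersetCard m, (1 + z)^(XA E A)
  have hS : 0 ≤ S := sum_nonneg fun E _ => pow_nonneg (by linarith) _
  calc S ≤ ((N + 1)*(N.choose m)*(p^m*(1 - p)^(N - m)))*S := le_mul_of_one_le_left hS hmode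
    _ = (N + 1)*(N.choose m)*(p^m*(1 - p)^(N - m)*S) := by ring
    _ ≤ _ := mll h1 (by positivity)

lemma mgf_exp {n m : ℕ} (hm : m < n.choose 2) (A : Finset (Fin n)) (hA : A.Nonempty) (hA3 : A.card ≤ 3)
    (l : ℝ) (hl : |l| ≤ 1) (hlm : l^2*(n*((m : ℝ) / n.choose 2)^A.card) ≤ 1) :
    ∑ E ∈ (Und n).powersetCard m, Real.exp (l*XA E A) ≤
      ((n.choose 2 : ℝ) + 1)*((n.choose 2).choose m) *
        Real.exp (l*(n*((m : ℝ) / n.choose 2)^A.card) + 4) := by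
  set N := n.choose 2 with hN
  set p : ℝ := (m : ℝ) / N with hp
  have hN0 : (0:ℝ) < N := by exact_mod_cast (by omega : 0 < N)
  have hp0 : 0 ≤ p := by positivity
  have hp1 : p ≤ 1 := by
    rw [hp, div_le_one hN0]; exact_mod_cast hm.le
  have hq0 : 0 ≤ p^A.card := by positivity
  have hq1 : p^A.card ≤ 1 := pow_le_one₀ hp0 hp1
  set q := p^A.card
  set z := Real.exp l - 1 with hz
  have hz1 : -1 ≤ z := by have := Real.exp_pos l; simp only [hz]; linarith
  have h := mgf_m hm A hA z hz1
  have e1 : ∀ E, (1 + z)^(XA E A) = Real.exp (l*XA E A) := by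
    intro E
    rw [hz, mul_comm, Real.exp_nat_mul]; congr 1; ring
  simp only [e1] at h
  refine h.trans (mll ?_ (by positivity))
  have hAn : A.card ≤ n := by simpa using Finset.card_le_univ A
  have hb : 0 ≤ 1 + z*q := by nlinarith
  have h2 : (1 + z*q)^(n - A.card) ≤ Real.exp (z*q)^(n - A.card) := by
    apply pow_le_pow_left₀ hb
    have := Real.add_one_le_exp (z*q); linarith
  refine h2.trans ?_
  rw [← Real.exp_nat_mul, Real.exp_le_exp, Nat.cast_sub hAn]
  have h3 := abs_le.1 (Real.abs_exp_sub_one_sub_id_le hl)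
  have h4 : (z - l)*(n*q) ≤ l^2*(n*q) := mlr (by simp only [hz]; linarith [h3.2]) (by positivity)
  have h5 : -(3:ℝ) ≤ A.card*(z*q) := by
    have a1 : -1 ≤ z*q := by nlinarith
    have a2 : (A.card : ℝ) ≤ 3 := by exact_mod_cast hA3
    have a3 : (0:ℝ) ≤ A.card := by positivity
    nlinarith
  nlinarith

lemma CL {n m : ℕ} (hm : m < n.choose 2) (A : Finset (Fin n)) (hA : A.Nonempty) (hA3 : A.card ≤ 3)
    (L μ : ℝ) (hμ : μ = n*((m : ℝ) / n.choose 2)^A.card) :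
    (((Und n).powersetCard m).filter (fun E => ¬ (|(XA E A : ℝ) - μ| < L*(Real.sqrt μ + 1)))).card ≤
      2*((n.choose 2 : ℝ) + 1)*Real.exp (4 - L)*((n.choose 2).choose m) := by
  have hμ0 : 0 ≤ μ := by rw [hμ]; positivity
  set s := Real.sqrt μ with hs
  have hs0 : 0 ≤ s := Real.sqrt_nonneg _
  have hss : s^2 = μ := Real.sq_sqrt hμ0
  set l := 1 / (s + 1) with hl
  have hls : l*(s + 1) = 1 := by rw [hl]; field_simp
  have hl0 : 0 < l := by positivity
  have hl1 : l ≤ 1 := by nlinarith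
  have hlm : l^2*μ ≤ 1 := by
    rw [← hss, ← mul_pow]; apply pow_le_one₀ (by positivity); nlinarith
  have hu := mgf_exp hm A hA hA3 l (by rw [abs_le]; constructor <;> linarith) (by rw [← hμ]; exact hlm)
  have hd := mgf_exp hm A hA hA3 (-l) (by rw [abs_neg, abs_le]; constructor <;> linarith) (by rw [← hμ, neg_sq]; exact hlm)
  rw [← hμ] at hu hd
  set U := (Und n).powersetCard m
  have key : ∀ l' : ℝ, (∑ E ∈ U, Real.exp (l'*XA E A) ≤
      ((n.choose 2 : ℝ) + 1)*((n.choose 2).choose m)*Real.exp (l'*μ + 4)) →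
      ((U.filter (fun E => L ≤ l'*((XA E A : ℝ) - μ))).card : ℝ) ≤
        ((n.choose 2 : ℝ) + 1)*((n.choose 2).choose m)*Real.exp (4 - L) := by
    intro l' h
    have h1 : ((U.filter (fun E => L ≤ l'*((XA E A : ℝ) - μ))).card : ℝ)*Real.exp (l'*μ + L) ≤
        ∑ E ∈ U, Real.exp (l'*XA E A) := by
      rw [← nsmul_eq_mul]
      refine (Finset.card_nsmul_le_sum _ _ _ ?_).trans
        (sum_le_sum_of_subset_of_nonneg (filter_subset _ _) fun E _ _ => (Real.exp_pos _).le)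
      intro E hE
      rw [Real.exp_le_exp]
      have := (mem_filter.1 hE).2
      linarith
    have h2 := h1.trans h
    rw [← le_div_iff₀ (Real.exp_pos _), mul_div_assoc, ← Real.exp_sub] at h2
    rwa [show l'*μ + 4 - (l'*μ + L) = 4 - L by ring] at h2
  have k1 := key l hu
  have k2 := key (-l) hd
  have hsub : U.filter (fun E => ¬ (|(XA E A : ℝ) - μ| < L*(s + 1))) ⊆
      U.filter (fun E => L ≤ l*((XA E A : ℝ) - μ)) ∪ U.filter (fun E => L ≤ -l*((XA E A : ℝ) - μ)) := by
    intro E hE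
    rw [mem_filter] at hE
    rw [mem_union, mem_filter, mem_filter]
    have h1 := not_lt.1 hE.2
    have h2 : L ≤ l*|(XA E A : ℝ) - μ| := by
      have := mll h1 hl0.le
      rwa [show l*(L*(s + 1)) = L*(l*(s + 1)) by ring, hls, mul_one] at this
    rcases abs_cases ((XA E A : ℝ) - μ) with h | h
    · left; rw [h.1] at h2; exact ⟨hE.1, h2⟩
    · right; rw [h.1] at h2; exact ⟨hE.1, by linarith⟩
  have h3 : ((U.filter (fun E => ¬ (|(XA E A : ℝ) - μ| < L*(s + 1)))).card : ℝ) ≤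
      (U.filter (fun E => L ≤ l*((XA E A : ℝ) - μ))).card + (U.filter (fun E => L ≤ -l*((XA E A : ℝ) - μ))).card := by
    exact_mod_cast (card_le_card hsub).trans (card_union_le _ _)
  linarith

lemma exp_small (k : ℝ) : ∀ᶠ n : ℕ in Filter.atTop, Real.exp (-(n:ℝ)^(1/200:ℝ)) ≤ (n:ℝ)^(-k) := by
  have h := (isLittleO_exp_neg_mul_rpow_atTop (a := 1) one_pos (-(200*k))).bound (c := 1) one_pos
  have h2 : Filter.Tendsto (fun n : ℕ => (n:ℝ)^(1/200:ℝ)) Filter.atTop Filter.atTop :=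
    (tendsto_rpow_atTop (by norm_num)).comp tendsto_natCast_atTop_atTop
  filter_upwards [h2.eventually h, Filter.eventually_gt_atTop 0] with n hn hn0
  have hn' : (0:ℝ) ≤ n := by positivity
  rw [Real.norm_of_nonneg (Real.exp_pos _).le, Real.norm_of_nonneg (by positivity), ← Real.rpow_mul hn'] at hn
  convert hn using 2
  · ring
  · rw [one_mul]; congr 1; ring

lemma rpow_small (k C : ℝ) (hk : 0 < k) (ε : ℝ) (hε : 0 < ε) : ∀ᶠ n : ℕ in Filter.atTop, C*(n:ℝ)^(-k) ≤ ε := by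
  have h2 : Filter.Tendsto (fun n : ℕ => C*(n:ℝ)^(-k)) Filter.atTop (nhds (C*0)) :=
    ((tendsto_rpow_neg_atTop hk).comp tendsto_natCast_atTop_atTop).const_mul C
  rw [mul_zero] at h2
  exact h2.eventually_le_const hε

lemma two_choose (n : ℕ) : 2*n.choose 2 = n*(n - 1) := by
  rw [Nat.choose_two_right]; exact Nat.mul_div_cancel' (Nat.even_mul_pred_self n).two_dvd

lemma two_choose_real (n : ℕ) : 2*(n.choose 2 : ℝ) = n*(n - 1) := by
  rw [Nat.cast_choose_two]; ring

lemma crit_asym (c θ : ℝ) (hc : 0 < c) (hθ : 0 < θ) (hθ1 : θ ≤ 1) : ∀ᶠ n : ℕ in Filter.atTop,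
    ∀ (m : ℕ) (DD : Set (Fin n → ℕ)) (δ : ℝ), 1 ≤ m → m ≤ n.choose 2 → 0 ≤ δ → Hyp n m DD δ →
      δ^2*(2*m) ≤ (n:ℝ)^(-(1/20:ℝ)) → nuc n m DD ≤ 200*(n:ℝ)^20*Real.exp (-(n:ℝ)^(1/200:ℝ)) →
      Intf n m c θ := by
  set j : ℕ := ⌈20*(c + 1)⌉₊ + 1 with hj
  have hj1 : 20*(c + 1) ≤ j := by
    have := Nat.le_ceil (20*(c + 1)); rw [hj]; push_cast; linarith
  obtain ⟨K, hK, hcrit⟩ := crit j (by omega) θ hθ hθ1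
  filter_upwards [exp_small (c + 2*j + 20 + 1), rpow_small 1 (201*K) one_pos 1 one_pos,
    rpow_small c 1 hc (1/2) (by norm_num), Filter.eventually_ge_atTop 1] with n h1 h2 h3 hn m DD δ hm hmN hδ H hδm hnuc
  have hn1 : (1:ℝ) ≤ n := by exact_mod_cast hn
  have hn0 : (0:ℝ) < n := by linarith
  have hA : 2*m ≤ n*(n - 1) := by rw [← two_choose]; omega
  refine hcrit c n m DD δ hm hA hmN hδ H ?_ (by linarith)
  have e1 : (2*m : ℝ)^j*δ^(2*j) ≤ (n:ℝ)^(-(c + 1)) := by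
    calc (2*m : ℝ)^j*δ^(2*j) = (δ^2*(2*m))^j := by rw [pow_mul, ← mul_pow]; ring
      _ ≤ ((n:ℝ)^(-(1/20:ℝ)))^j := pow_le_pow_left₀ (by positivity) hδm _
      _ = (n:ℝ)^(-(1/20:ℝ)*j) := by rw [Real.rpow_mul hn0.le, Real.rpow_natCast]
      _ ≤ _ := Real.rpow_le_rpow_of_exponent_le hn1 (by linarith)
  have hM : (2*m : ℝ) ≤ (n:ℝ)^2 := by
    have : 2*m ≤ n^2 := hA.trans (by rw [pow_two]; exact Nat.mul_le_mul_left _ (by omega))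
    exact_mod_cast this
  have e2 : (2*m : ℝ)^j*nuc n m DD ≤ 200*(n:ℝ)^(-(c + 1)) := by
    calc (2*m : ℝ)^j*nuc n m DD ≤ ((n:ℝ)^2)^j*(200*(n:ℝ)^20*(n:ℝ)^(-(c + 2*j + 20 + 1))) := by
          refine mul_le_mul (pow_le_pow_left₀ (by positivity) hM _) (hnuc.trans ?_) ?_ (by positivity)
          · exact mll h1 (by positivity)
          · exact sum_nonneg fun _ _ => nu_nonneg _ _ _
      _ = 200*(n:ℝ)^(-(c + 1)) := by
          rw [← pow_mul]
          have : (n:ℝ)^(-(c + 2*j + 20 + 1))*((n:ℝ)^(2*j)*(n:ℝ)^20) = (n:ℝ)^(-(c + 1)) := by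
            rw [← pow_add, ← Real.rpow_add_natCast hn0.ne']; congr 1; push_cast; ring
          rw [← this]; ring
  have e3 : (n:ℝ)^(-(c + 1)) = (n:ℝ)^(-c)*(n:ℝ)^(-1:ℝ) := by rw [← Real.rpow_add hn0]; congr 1; ring
  have e4 : 0 < (n:ℝ)^(-c) := by positivity
  calc K*((2*m : ℝ)^j*(δ^(2*j) + nuc n m DD)) ≤ K*(201*(n:ℝ)^(-(c + 1))) := by
        refine mll ?_ hK.le; rw [mul_add]; linarith
    _ = (201*K*(n:ℝ)^(-1:ℝ))*(n:ℝ)^(-c) := by rw [e3]; ring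
    _ ≤ _ := by nlinarith

/-- good graphs -/
def GoodE (n m : ℕ) (L : ℝ) (E : Finset (Sym2 (Fin n))) : Prop :=
  ∀ a b c : Fin n, |(XA E {a, b, c} : ℝ) - n*((m : ℝ) / n.choose 2)^({a, b, c} : Finset (Fin n)).card| <
    L*(Real.sqrt (n*((m : ℝ) / n.choose 2)^({a, b, c} : Finset (Fin n)).card) + 1)

open scoped Classical in
def DDg (n m : ℕ) : Set (Fin n → ℕ) :=
  {D | (((GD n D).filter (fun E => ¬ GoodE n m ((n:ℝ)^(1/200:ℝ)) E)).card : ℝ)*(n:ℝ)^10 < NN n D}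

open scoped Classical in
lemma bad_count {n m : ℕ} (hm : m < n.choose 2) (L : ℝ) :
    (((Und n).powersetCard m).filter (fun E => ¬ GoodE n m L E)).card ≤
      (n:ℝ)^3*(2*((n.choose 2 : ℝ) + 1)*Real.exp (4 - L)*((n.choose 2).choose m)) := by
  set U := (Und n).powersetCard m
  set Bd : Fin n × Fin n × Fin n → Finset (Finset (Sym2 (Fin n))) := fun q =>
    U.filter (fun E => ¬ (|(XA E {q.1, q.2.1, q.2.2} : ℝ) - n*((m : ℝ) / n.choose 2)^({q.1, q.2.1, q.2.2} : Finset (Fin n)).card| <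
    L*(Real.sqrt (n*((m : ℝ) / n.choose 2)^({q.1, q.2.1, q.2.2} : Finset (Fin n)).card) + 1)))
  have hsub : U.filter (fun E => ¬ GoodE n m L E) ⊆ univ.biUnion Bd := by
    intro E hE
    rw [mem_filter] at hE
    obtain ⟨hU, hb⟩ := hE
    unfold GoodE at hb
    push Not at hb
    obtain ⟨a, b, c, h⟩ := hb
    rw [mem_biUnion]
    exact ⟨(a, b, c), mem_univ _, mem_filter.2 ⟨hU, not_lt.2 h⟩⟩
  have h1 : ((U.filter (fun E => ¬ GoodE n m L E)).card : ℝ) ≤ ∑ q : Fin n × Fin n × Fin n, ((Bd q).card : ℝ) := by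
    exact_mod_cast (card_le_card hsub).trans card_biUnion_le
  refine h1.trans ?_
  have h2 : ∀ q ∈ (univ : Finset (Fin n × Fin n × Fin n)), ((Bd q).card : ℝ) ≤ (2*((n.choose 2 : ℝ) + 1)*Real.exp (4 - L)*((n.choose 2).choose m)) := by
    intro q _
    exact CL hm _ (by simp) Finset.card_le_three L _ rfl
  refine (Finset.sum_le_card_nsmul _ _ _ h2).trans (le_of_eq ?_)
  rw [nsmul_eq_mul]; simp only [card_univ, Fintype.card_prod, Fintype.card_fin]; push_cast; ring

open scoped Classical in
lemma nuc_DDg {n m : ℕ} (hm : m < n.choose 2) :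
    nuc n m (DDg n m) ≤ 200*(n:ℝ)^20*Real.exp (-(n:ℝ)^(1/200:ℝ)) := by
  set L := (n:ℝ)^(1/200:ℝ) with hL
  set C : ℝ := ((n.choose 2).choose m : ℝ) with hC
  have hC0 : 0 < C := by rw [hC]; exact_mod_cast Nat.choose_pos hm.le
  have hbc := bad_count hm L
  have hn2 : 2 ≤ n := by
    by_contra h
    have : n.choose 2 = 0 := Nat.choose_eq_zero_of_lt (by omega)
    omega
  have hnr : (2:ℝ) ≤ n := by exact_mod_cast hn2
  have h1 : nuc n m (DDg n m) ≤ ∑ D ∈ Wt n (2*m), (n:ℝ)^10 / C*((GD n D).filter (fun E => ¬ GoodE n m L E)).card := by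
    unfold nuc
    refine (sum_le_sum (g := fun D => (n:ℝ)^10 / C*((GD n D).filter (fun E => ¬ GoodE n m L E)).card) ?_).trans
      (sum_le_sum_of_subset_of_nonneg (filter_subset _ _) fun _ _ _ => by positivity)
    intro D hD
    have := (mem_filter.1 hD).2
    simp only [DDg, Set.mem_ofPred_eq, not_lt] at this
    unfold nu
    rw [div_mul_eq_mul_div, ← hC]
    gcongr
    linarith
  have h2 : ∑ D ∈ Wt n (2*m), (((GD n D).filter (fun E => ¬ GoodE n m L E)).card : ℝ) =
      (((Und n).powersetCard m).filter (fun E => ¬ GoodE n m L E)).card := by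
    have := sum_GD (n := n) (m := m) (fun _ => True) (fun E => if ¬ GoodE n m L E then (1:ℝ) else 0)
    simp only [and_true, filter_true] at this
    rw [GG_eq] at this
    simp only [Finset.card_filter]
    push_cast
    exact this.symm
  rw [← mul_sum, h2] at h1
  have hN2 : (n.choose 2 : ℝ) + 1 ≤ n^2 := by have := two_choose_real n; nlinarith
  have e4 : Real.exp 4 ≤ 100 := by
    have : Real.exp 4 = Real.exp 1^4 := by rw [← Real.exp_nat_mul]; norm_num
    rw [this]
    have h3 := Real.exp_one_lt_d9
    calc Real.exp 1^4 ≤ (2.75:ℝ)^4 := pow_le_pow_left₀ (Real.exp_pos _).le (by linarith) _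
      _ ≤ 100 := by norm_num
  calc nuc n m (DDg n m) ≤ (n:ℝ)^10 / C*((n:ℝ)^3*(2*((n.choose 2 : ℝ) + 1)*Real.exp (4 - L)*C)) :=
        h1.trans (mll hbc (by positivity))
    _ = 2*(n:ℝ)^13*((n.choose 2 : ℝ) + 1)*(Real.exp 4*Real.exp (-L)) := by
        rw [← Real.exp_add, ← sub_eq_add_neg]; field_simp
    _ ≤ 2*(n:ℝ)^13*n^2*(100*Real.exp (-L)) := by gcongr
    _ = 200*(n:ℝ)^15*Real.exp (-L) := by ring
    _ ≤ _ := by gcongr <;> first | linarith | norm_num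

lemma xpow (n k : ℕ) : ((n:ℝ)^(1/200:ℝ))^k = (n:ℝ)^((k:ℝ) / 200) := by
  rw [← Real.rpow_natCast, ← Real.rpow_mul (by positivity)]; congr 1; ring

lemma xlarge (C : ℝ) : ∀ᶠ n : ℕ in Filter.atTop, C ≤ (n:ℝ)^(1/200:ℝ) :=
  ((tendsto_rpow_atTop (by norm_num)).comp tendsto_natCast_atTop_atTop).eventually_ge_atTop C

lemma d_eq {n m : ℕ} (hn : 2 ≤ n) : (n:ℝ)*((m:ℝ) / n.choose 2) = 2*m / (n - 1) := by
  have h := two_choose_real n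
  have hn' : (2:ℝ) ≤ n := by exact_mod_cast hn
  have h1 : (n:ℝ) - 1 ≠ 0 := by linarith
  have h2 : (n.choose 2 : ℝ) = n*(n - 1) / 2 := by linarith
  rw [h2]; field_simp

lemma XA_single {n : ℕ} (E : Finset (Sym2 (Fin n))) (v : Fin n) : XA E {v} = deg E v := by
  rw [deg_eq_nb]
  unfold XA; congr 1; ext u; simp [mem_nb]

lemma Good_deg {n m : ℕ} {L : ℝ} {E : Finset (Sym2 (Fin n))} (hG : GoodE n m L E) (hE : E ∈ Graphs n) (v : Fin n) :
    |(deg E v : ℝ) - n*((m : ℝ) / n.choose 2)| < L*(Real.sqrt (n*((m : ℝ) / n.choose 2)) + 1) := by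
  have := hG v v v
  simp only [mem_singleton, insert_eq_of_mem, card_singleton, pow_one] at this
  rwa [XA_single E v] at this

lemma GD_Graphs {n : ℕ} {D : Fin n → ℕ} {E : Finset (Sym2 (Fin n))} (h : E ∈ GD n D) : E ∈ Graphs n ∧ ∀ i, deg E i = D i := by
  rw [mem_GD] at h; exact ⟨mem_Graphs.2 h.1, h.2⟩

open scoped Classical in
lemma DDg_deg {n m : ℕ} (hn : 1 ≤ n) {D : Fin n → ℕ} (hD : D ∈ DDg n m) (v : Fin n) :
    |(D v : ℝ) - n*((m : ℝ) / n.choose 2)| < (n:ℝ)^(1/200:ℝ)*(Real.sqrt (n*((m : ℝ) / n.choose 2)) + 1) := by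
  simp only [DDg, Set.mem_ofPred_eq, NN] at hD
  have hn1 : (1:ℝ) ≤ (n:ℝ)^10 := one_le_pow₀ (by exact_mod_cast hn)
  by_contra hcon
  have hall : (GD n D).filter (fun E => ¬ GoodE n m ((n:ℝ)^(1/200:ℝ)) E) = GD n D := by
    rw [filter_eq_self]
    intro E hE hG
    obtain ⟨h1, h2⟩ := GD_Graphs hE
    have := Good_deg hG h1 v
    rw [h2 v] at this
    exact hcon this
  rw [hall] at hD
  have : (0:ℝ) ≤ ((GD n D).card : ℝ) := by positivity
  nlinarith

lemma R2_real {x M n Δ : ℝ} (hx : 10^6 ≤ x) (hnx : n = x^200) (h80 : x^80 ≤ M) (h260 : M ≤ x^260) (hΔ0 : 0 ≤ Δ)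
    (hΔ2 : Δ^2 ≤ 32*x^2*(M^2 / n^2 + 1)) :
    12*Δ^2 ≤ M ∧ (Δ / (n - 1) + 4*Δ^2 / M)^2*M ≤ 1 / x^10 := by
  have hx1 : 1 ≤ x := by linarith
  have hx0 : 0 < x := by linarith
  have hM0 : 0 < M := lt_of_lt_of_le (by positivity) h80
  have hnr : 2 ≤ n := by
    rw [hnx]; exact le_trans (by linarith) (le_self_pow₀ hx1 (by norm_num))
  have hn10 : 0 < n - 1 := by linarith
  have hn0 : 0 < n := by linarith
  have x20 : (0:ℝ) < 1 / x^20 := by positivity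
  have w1 : M^3 / n^4 ≤ 1 / x^20 := by
    rw [hnx, div_le_div_iff₀ (by positivity) (by positivity)]
    calc M^3*x^20 ≤ (x^260)^3*x^20 := by gcongr
      _ = 1*(x^200)^4 := by ring
  have w2 : 1 / M ≤ 1 / x^20 := by
    apply one_div_le_one_div_of_le (by positivity)
    exact le_trans (pow_le_pow_right₀ hx1 (by norm_num)) h80
  have w3 : M / n^2 ≤ 1 / x^20 := by
    rw [hnx, div_le_div_iff₀ (by positivity) (by positivity)]
    calc M*x^20 ≤ x^260*x^20 := by gcongr
      _ = x^280 := by ring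
      _ ≤ x^400 := pow_le_pow_right₀ hx1 (by norm_num)
      _ = _ := by ring
  have hsm : 10^6*(x^16*(1 / x^20)) ≤ 1 / x^3 := by
    rw [show x^16*(1 / x^20) = 1 / x^4 by field_simp]
    rw [mul_one_div, div_le_div_iff₀ (by positivity) (by positivity)]
    nlinarith [pow_pos hx0 3]
  constructor
  · have h1 : (12:ℝ)*Δ^2 ≤ 384*x^2*(M / n^2 + 1 / M)*M := by
      have : 384*x^2*(M / n^2 + 1 / M)*M = 12*(32*x^2*(M^2 / n^2 + 1)) := by field_simp; ring
      rw [this]; linarith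
    have h2 : 384*x^2*(M / n^2 + 1 / M) ≤ 1 := by
      calc 384*x^2*(M / n^2 + 1 / M) ≤ 384*x^2*(1 / x^20 + 1 / x^20) := by gcongr
        _ = 768*(x^2*(1 / x^20)) := by ring
        _ ≤ 10^6*(x^16*(1 / x^20)) := by
            gcongr
            · norm_num
            · norm_num
        _ ≤ 1 / x^3 := hsm
        _ ≤ 1 := by rw [div_le_one (by positivity)]; exact one_le_pow₀ hx1
    nlinarith
  · set δ : ℝ := Δ / (n - 1) + 4*Δ^2 / M with hδ
    have hδ0 : 0 ≤ δ := by positivity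
    have h1 : Δ / (n - 1) ≤ 2*Δ / n := by
      rw [div_le_div_iff₀ (by linarith) (by linarith)]
      nlinarith only [hΔ0, hnr]
    have h2 : δ^2 ≤ 8*Δ^2 / n^2 + 32*(Δ^2)^2 / M^2 := by
      have h3 : δ ≤ 2*Δ / n + 4*Δ^2 / M := by rw [hδ]; linarith
      calc δ^2 ≤ (2*Δ / n + 4*Δ^2 / M)^2 := pow_le_pow_left₀ hδ0 h3 _
        _ ≤ 2*(2*Δ / n)^2 + 2*(4*Δ^2 / M)^2 := by nlinarith [sq_nonneg (2*Δ / n - 4*Δ^2 / M)]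
        _ = _ := by rw [div_pow, div_pow]; ring
    have h4 : Δ^2*M / n^2 ≤ 64*x^4*(1 / x^20) := by
      calc Δ^2*M / n^2 ≤ 32*x^2*(M^2 / n^2 + 1)*M / n^2 := by gcongr
        _ = 32*x^2*(M^3 / n^4 + M / n^2) := by field_simp
        _ ≤ 32*x^2*(1 / x^20 + 1 / x^20) := by gcongr
        _ = 64*x^2*(1 / x^20) := by ring
        _ ≤ _ := by
          gcongr
          norm_num
    have h5 : (Δ^2)^2 / M ≤ 4096*x^4*(1 / x^20) := by
      calc (Δ^2)^2 / M ≤ (32*x^2*(M^2 / n^2 + 1))^2 / M := by gcongr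
        _ ≤ 1024*x^4*(2*(M^2 / n^2)^2 + 2) / M := by
            rw [mul_pow, mul_pow, show (32:ℝ)^2 = 1024 by norm_num, ← pow_mul]
            gcongr
            nlinarith [sq_nonneg (M^2 / n^2 - 1)]
        _ = 1024*x^4*(2*(M^3 / n^4) + 2*(1 / M)) := by field_simp
        _ ≤ 1024*x^4*(2*(1 / x^20) + 2*(1 / x^20)) := by gcongr
        _ = _ := by ring
    have h6 : δ^2*M ≤ 8*(Δ^2*M / n^2) + 32*((Δ^2)^2 / M) := by
      calc δ^2*M ≤ (8*Δ^2 / n^2 + 32*(Δ^2)^2 / M^2)*M := by gcongr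
        _ = _ := by field_simp
    have h7 : x^4*(1 / x^20)*10^6 ≤ 1 / x^10 := by
      rw [show x^4*(1 / x^20) = 1 / x^16 by field_simp, one_div_mul_eq_div, div_le_div_iff₀ (by positivity) (by positivity)]
      have : (10:ℝ)^6*x^10 ≤ x^6*x^10 := by
        gcongr
        linarith
      calc _ ≤ _ := this
        _ = _ := by ring
    have h8 : 0 < x^4*(1 / x^20) := by positivity
    linarith only [h4, h5, h6, h7, h8]

lemma R2 (c θ : ℝ) (hc : 0 < c) (hθ : 0 < θ) (hθ1 : θ ≤ 1) : ∀ᶠ n : ℕ in Filter.atTop, ∀ m : ℕ,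
    (n:ℝ)^(2/5:ℝ) ≤ 2*m → 2*m ≤ (n:ℝ)^(13/10:ℝ) → Intf n m c θ := by
  filter_upwards [crit_asym c θ hc hθ hθ1, xlarge (10^6), Filter.eventually_ge_atTop 2] with n hcr hx hn2 m hm1 hm2
  set x := (n:ℝ)^(1/200:ℝ) with hxdef
  have hnx : (n:ℝ) = x^200 := by rw [hxdef, xpow]; norm_num
  have h80 : x^80 ≤ 2*m := by rw [hxdef, xpow]; refine le_trans (le_of_eq ?_) hm1; norm_num
  have h260 : 2*m ≤ x^260 := by rw [hxdef, xpow]; refine hm2.trans (le_of_eq ?_); norm_num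
  have hx1 : 1 ≤ x := by linarith
  have hx0 : 0 < x := by linarith
  have hnr : (2:ℝ) ≤ n := by exact_mod_cast hn2
  set M : ℝ := 2*m with hM
  have hM0 : 0 < M := lt_of_lt_of_le (by positivity) h80
  have hmpos : 1 ≤ m := by
    by_contra h
    have : m = 0 := by omega
    rw [hM, this] at hM0; simp at hM0
  have hmN : m < n.choose 2 := by
    have h1 := two_choose_real n
    have h2 : M < n*(n - 1) := by
      have a1 : x^260*2 ≤ (n:ℝ)*(n / 2) := by
        rw [hnx]
        have : x^260*4 ≤ x^260*x^140 := by
          gcongr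
          calc (4:ℝ) ≤ x := by linarith
            _ ≤ x^140 := le_self_pow₀ hx1 (by norm_num)
        nlinarith
      have a2 : (0:ℝ) < x^260 := by positivity
      nlinarith
    have : (m:ℝ) < n.choose 2 := by linarith
    exact_mod_cast this
  set d := (n:ℝ)*((m:ℝ) / n.choose 2) with hd
  have hd' : d = M / (n - 1) := d_eq hn2
  have hd2 : d ≤ 2*M / n := by
    rw [hd', div_le_div_iff₀ (by linarith) (by linarith)]; nlinarith
  have hd0 : 0 ≤ d := by positivity
  set Δ : ℕ := ⌊2*x*(d + 1)⌋₊ with hΔ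
  have hΔr : (Δ:ℝ) ≤ 2*x*(d + 1) := Nat.floor_le (by positivity)
  have hDΔ : ∀ D ∈ DDg n m, ∀ v, D v ≤ Δ := by
    intro D hD v
    apply Nat.le_floor
    have h1 := (abs_lt.1 (DDg_deg (by omega) hD v)).2
    rw [← hd, ← hxdef] at h1
    have h2 : Real.sqrt d ≤ (d + 1) / 2 := by
      have h3 := Real.sq_sqrt hd0
      nlinarith [sq_nonneg (Real.sqrt d - 1)]
    have h3 : x*Real.sqrt d ≤ x*((d + 1) / 2) := mll h2 hx0.le
    nlinarith
  have hΔ2 : (Δ:ℝ)^2 ≤ 32*x^2*(M^2 / n^2 + 1) := by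
    have h1 : d^2 ≤ (2*M / n)^2 := pow_le_pow_left₀ hd0 hd2 _
    have h2 : (2*M / n)^2 = 4*(M^2 / n^2) := by rw [div_pow]; ring
    calc (Δ:ℝ)^2 ≤ (2*x*(d + 1))^2 := pow_le_pow_left₀ (by positivity) hΔr _
      _ = 4*x^2*(d + 1)^2 := by ring
      _ ≤ 4*x^2*(8*(M^2 / n^2) + 8) := by
          refine mll ?_ (by positivity)
          nlinarith [sq_nonneg (d - 1)]
      _ = _ := by ring
  obtain ⟨g1, g2⟩ := R2_real hx hnx h80 h260 (Nat.cast_nonneg Δ) hΔ2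
  have hΔM : 12*Δ^2 ≤ 2*m := by
    rw [hM] at g1
    exact_mod_cast g1
  set δ : ℝ := (Δ:ℝ) / (n - 1) + 4*Δ^2 / M with hδ
  have hn10 : (0:ℝ) < (n:ℝ) - 1 := by linarith
  have hδ0 : 0 ≤ δ := by positivity
  refine hcr m (DDg n m) δ hmpos hmN.le hδ0 ?_ ?_ (nuc_DDg hmN)
  · apply Hyp_of _ _ hδ0
    intro T hT a b hab ha hb hDD
    exact sparse_one hmpos hT hab ha hb (hDΔ _ hDD) hΔM hn2
  · have e1 : (n:ℝ)^(-(1/20:ℝ)) = 1 / x^10 := by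
      rw [hxdef, xpow, Real.rpow_neg (by positivity), one_div]; norm_num
    rw [e1, ← hM]; exact g2

def iX {n : ℕ} (E : Finset (Sym2 (Fin n))) (b b' v : Fin n) : Prop := v ≠ b' ∧ s(b, v) ∈ E ∧ s(b', v) ∉ E

instance {n : ℕ} (E : Finset (Sym2 (Fin n))) (b b' v : Fin n) : Decidable (iX E b b' v) := by unfold iX; infer_instance

lemma iX_card {n : ℕ} {D : Fin n → ℕ} {E : Finset (Sym2 (Fin n))} (hE : E ∈ GD n D) {b b' : Fin n} (hbb : b ≠ b') :
    ((univ.filter (iX E b b')).card : ℝ) = D b - ct E b b' := by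
  rw [mem_GD] at hE
  have h := card_X hE.1 hbb.symm
  rw [ct_comm, hE.2 b] at h
  rw [← h]; push_cast
  have : (univ.filter (iX E b b')) = univ.filter (fun u => u ≠ b' ∧ s(b, u) ∈ E ∧ s(b', u) ∉ E) := by
    ext u; simp [iX]
  rw [this]; ring

lemma exch_ok {n : ℕ} {D : Fin n → ℕ} {E : Finset (Sym2 (Fin n))} (hE : E ∈ GD n D) {b b' u v : Fin n} (hbb : b ≠ b')
    (h1 : iX E b b' v) (h2 : iX E b' b u) :
    (({s(v, b), s(b', u)} : Finset _) ⊆ E ∧ Disjoint {s(v, b'), s(b, u)} E) ∧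
      sw E {s(v, b), s(b', u)} {s(v, b'), s(b, u)} ∈ GD n D ∧
      (iX (sw E {s(v, b), s(b', u)} {s(v, b'), s(b, u)}) b' b v ∧ iX (sw E {s(v, b), s(b', u)} {s(v, b'), s(b, u)}) b b' u) ∧
      ct (sw E {s(v, b), s(b', u)} {s(v, b'), s(b, u)}) b b' = ct E b b' := by
  obtain ⟨a1, a2, a3⟩ := h1
  obtain ⟨b1, b2, b3⟩ := h2
  have hl := (mem_GD.1 hE).1
  have hvb : v ≠ b := by rintro rfl; exact hl _ a2
  have hub : u ≠ b' := by rintro rfl; exact hl _ b2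
  have huv : u ≠ v := by rintro rfl; exact a3 b2
  have h := sw2_GD hE hvb (by rwa [Sym2.eq_swap]) b2 (Ne.symm a1) (by rwa [Sym2.eq_swap]) b1 b3
  refine ⟨h.1, h.2, ?_, ?_⟩
  · unfold iX
    simp only [mem_sw, mem_insert, mem_singleton, Sym2.eq_iff]
    grind
  · unfold ct
    simp only [mem_sw, mem_insert, mem_singleton, Sym2.eq_iff]
    congr 2
    · ext w; simp only [mem_filter, mem_univ, true_and]
      grind
    · grind

def sI {n : ℕ} (E : Finset (Sym2 (Fin n))) (b b' v : Fin n) : ℝ :=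
  (if iX E b b' v then 1 else 0) + (if iX E b' b v then 1 else 0)

lemma exch {n : ℕ} {D : Fin n → ℕ} {b b' : Fin n} (hbb : b ≠ b') (v : Fin n) (h0 : Finset (Sym2 (Fin n)) → ℝ)
    (hinv : ∀ E ∈ GD n D, ∀ u, iX E b b' v → iX E b' b u → h0 E = h0 (sw E {s(v, b), s(b', u)} {s(v, b'), s(b, u)})) :
    ∑ E ∈ GD n D, h0 E*((if iX E b b' v then 1 else 0) - (if iX E b' b v then 1 else 0)) =
      ((D b : ℝ) - D b')*∑ E ∈ GD n D, h0 E*sI E b b' v / ((D b : ℝ) + D b' - 2*ct E b b') := by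
  have key := switch_sum (GD n D) (GD n D) (ι := Fin n) (fun u => {s(v, b), s(b', u)}) (fun u => {s(v, b'), s(b, u)})
    (fun E u => iX E b b' v ∧ iX E b' b u) (fun E u => iX E b' b v ∧ iX E b b' u)
    (fun E _ => h0 E / ((D b : ℝ) + D b' - 2*ct E b b')) (fun E _ => h0 E / ((D b : ℝ) + D b' - 2*ct E b b'))
    (by
      intro E hE u hP
      have h := exch_ok hE hbb hP.1 hP.2
      refine ⟨h.1, h.2.1, h.2.2.1, ?_⟩
      rw [h.2.2.2, ← hinv E hE u hP.1 hP.2])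
    (by
      intro E hE u hP
      have h := exch_ok hE hbb.symm hP.1 hP.2
      exact ⟨h.1, h.2.1, h.2.2.1⟩)
  have inner : ∀ (E : Finset (Sym2 (Fin n))) (x y : Fin n) (r : ℝ), (∑ u, if (iX E x y v ∧ iX E y x u) then r else 0) =
      (if iX E x y v then 1 else 0)*r*(univ.filter (iX E y x)).card := by
    intro E x y r
    by_cases h : iX E x y v
    · simp only [h, true_and, if_true]
      rw [← sum_filter, sum_const, nsmul_eq_mul]; ring
    · simp [h]
  simp only [inner] at key
  have e : ∀ E ∈ GD n D, h0 E*((if iX E b b' v then 1 else 0) - (if iX E b' b v then 1 else 0)) -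
      ((D b : ℝ) - D b')*(h0 E*sI E b b' v / ((D b : ℝ) + D b' - 2*ct E b b')) =
      2*((if iX E b b' v then 1 else 0)*(h0 E / ((D b : ℝ) + D b' - 2*ct E b b'))*(univ.filter (iX E b' b)).card -
      (if iX E b' b v then 1 else 0)*(h0 E / ((D b : ℝ) + D b' - 2*ct E b b'))*(univ.filter (iX E b b')).card) := by
    intro E hE
    have c1 := iX_card hE hbb
    have c2 := iX_card hE hbb.symm
    rw [ct_comm] at c2
    by_cases h : iX E b b' v ∨ iX E b' b v
    · have hs : (0:ℝ) < (D b : ℝ) + D b' - 2*ct E b b' := by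
        have : (D b : ℝ) + D b' - 2*ct E b b' = (((univ.filter (iX E b b')).card : ℕ) : ℝ) + (univ.filter (iX E b' b)).card := by
          rw [c1, c2]; ring
        rw [this]
        rcases h with h | h
        · have : 0 < (univ.filter (iX E b b')).card := card_pos.2 ⟨v, by simpa using h⟩
          positivity
        · have : 0 < (univ.filter (iX E b' b)).card := card_pos.2 ⟨v, by simpa using h⟩
          positivity
      rw [c1, c2]; unfold sI
      field_simp
      ring
    · push Not at h
      simp [sI, h.1, h.2]
  have e2 := sum_congr rfl e
  rw [sum_sub_distrib, ← mul_sum, ← mul_sum, sum_sub_distrib, key, sub_self, mul_zero] at e2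
  linarith

def Iv (p : Prop) [Decidable p] : ℝ := if p then 1 else 0

lemma Iv_nonneg (p : Prop) [Decidable p] : 0 ≤ Iv p := by unfold Iv; split_ifs <;> norm_num
lemma Iv_le (p : Prop) [Decidable p] : Iv p ≤ 1 := by unfold Iv; split_ifs <;> norm_num

lemma sum_Iv {ι : Type*} [Fintype ι] (p : ι → Prop) [DecidablePred p] : ∑ v, Iv (p v) = ((univ.filter p).card : ℝ) := by
  rw [card_filter]; push_cast; rfl

lemma sI_nonneg {n : ℕ} (E : Finset (Sym2 (Fin n))) (b b' v : Fin n) : 0 ≤ sI E b b' v := by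
  unfold sI; split_ifs <;> norm_num

lemma sI_le {n : ℕ} (E : Finset (Sym2 (Fin n))) (b b' v : Fin n) : sI E b b' v ≤ 1 := by
  unfold sI iX
  by_cases q1 : s(b, v) ∈ E <;> by_cases q2 : s(b', v) ∈ E <;> simp [q1, q2] <;> split_ifs <;> norm_num

def TT {n : ℕ} (E : Finset (Sym2 (Fin n))) (a b b' : Fin n) : ℝ :=
  ∑ v, Iv (s(a, v) ∈ E)*sI E b b' v + (1 - Iv (s(b, b') ∈ E))*sI E b b' a

lemma ct_Iv {n : ℕ} (E : Finset (Sym2 (Fin n))) (a b : Fin n) :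
    (ct E a b : ℝ) = ∑ v, Iv (s(a, v) ∈ E)*Iv (s(b, v) ∈ E) + Iv (s(a, b) ∈ E) := by
  unfold ct; push_cast
  rw [← sum_Iv]
  congr 1
  · refine sum_congr rfl fun v _ => ?_
    unfold Iv
    by_cases q1 : s(a, v) ∈ E <;> by_cases q2 : s(b, v) ∈ E <;> simp [q1, q2]

lemma ct_diff {n : ℕ} {D : Fin n → ℕ} {E : Finset (Sym2 (Fin n))} (hE : E ∈ GD n D) {a b b' : Fin n} (hbb : b ≠ b')
    (hab : a ≠ b) (hab' : a ≠ b') :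
    (ct E a b : ℝ) - ct E a b' =
      ∑ v, Iv (s(a, v) ∈ E)*((if iX E b b' v then 1 else 0) - (if iX E b' b v then 1 else 0)) +
        (1 - Iv (s(b, b') ∈ E))*((if iX E b b' a then 1 else 0) - (if iX E b' b a then 1 else 0)) := by
  have hl := (mem_GD.1 hE).1
  have e1 : ∀ v, Iv (s(a, v) ∈ E)*Iv (s(b, v) ∈ E) - Iv (s(a, v) ∈ E)*Iv (s(b', v) ∈ E) =
      Iv (s(a, v) ∈ E)*((if iX E b b' v then 1 else 0) - (if iX E b' b v then 1 else 0)) +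
      ((if v = b then - (Iv (s(a, b) ∈ E)*Iv (s(b, b') ∈ E)) else 0) + (if v = b' then Iv (s(a, b') ∈ E)*Iv (s(b, b') ∈ E) else 0)) := by
    intro v
    by_cases h1 : v = b
    · subst h1
      have h3 : s(b', v) = s(v, b') := Sym2.eq_swap
      simp [iX, hl, hbb, Iv, h3]
    · by_cases h2 : v = b'
      · subst h2
        simp [iX, hl, h1, Iv]
      · simp only [iX, h1, h2, if_false, Iv]
        by_cases q1 : s(b, v) ∈ E <;> by_cases q2 : s(b', v) ∈ E <;> simp [q1, q2, h1, h2]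
  rw [ct_Iv, ct_Iv]
  have e2 := sum_congr (rfl : (univ : Finset (Fin n)) = univ) (fun v _ => e1 v)
  rw [sum_sub_distrib, sum_add_distrib, sum_add_distrib, sum_ite_eq' univ b, sum_ite_eq' univ b'] at e2
  simp only [mem_univ, if_true] at e2
  have e3 : ((if iX E b b' a then (1:ℝ) else 0) - (if iX E b' b a then 1 else 0)) = Iv (s(a, b) ∈ E) - Iv (s(a, b') ∈ E) := by
    have h3 : s(b', a) = s(a, b') := Sym2.eq_swap
    have h4 : s(b, a) = s(a, b) := Sym2.eq_swap
    simp only [iX, h3, h4, Iv, ne_eq, hab, hab', not_false_eq_true, true_and]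
    by_cases q1 : s(a, b) ∈ E <;> by_cases q2 : s(a, b') ∈ E <;> simp [q1, q2]
  rw [e3]
  linear_combination e2

lemma k_diff {n : ℕ} {D : Fin n → ℕ} {a b b' : Fin n} (hbb : b ≠ b') (hab : a ≠ b) (hab' : a ≠ b') :
    ∑ E ∈ GD n D, ((ct E a b : ℝ) - ct E a b') =
      ((D b : ℝ) - D b')*∑ E ∈ GD n D, TT E a b b' / ((D b : ℝ) + D b' - 2*ct E b b') := by
  rw [sum_congr rfl fun E hE => ct_diff hE hbb hab hab', sum_add_distrib, sum_comm]
  have h1 : ∀ v, ∑ E ∈ GD n D, Iv (s(a, v) ∈ E)*((if iX E b b' v then 1 else 0) - (if iX E b' b v then 1 else 0)) =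
      ((D b : ℝ) - D b')*∑ E ∈ GD n D, Iv (s(a, v) ∈ E)*sI E b b' v / ((D b : ℝ) + D b' - 2*ct E b b') := by
    intro v
    refine exch hbb v (fun E => Iv (s(a, v) ∈ E)) ?_
    intro E hE u i1 i2
    have hl := (mem_GD.1 hE).1
    have hvb : v ≠ b := by rintro rfl; exact hl _ i1.2.1
    have hvb' := i1.1
    have : (s(a, v) ∈ E) ↔ s(a, v) ∈ sw E {s(v, b), s(b', u)} {s(v, b'), s(b, u)} := by
      simp only [mem_sw, mem_insert, mem_singleton, Sym2.eq_iff]; grind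
    simp only [← this]
  have h2 := exch (D := D) hbb a (fun E => 1 - Iv (s(b, b') ∈ E)) (by
    intro E hE u i1 i2
    have hl := (mem_GD.1 hE).1
    have hub : u ≠ b := i2.1
    have hub' : u ≠ b' := by rintro rfl; exact hl _ i2.2.1
    have : (s(b, b') ∈ E) ↔ s(b, b') ∈ sw E {s(a, b), s(b', u)} {s(a, b'), s(b, u)} := by
      simp only [mem_sw, mem_insert, mem_singleton, Sym2.eq_iff]; grind
    simp only [← this])
  simp only [h1]
  rw [h2, ← mul_sum, ← mul_add, sum_comm, ← sum_add_distrib]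
  congr 1
  refine sum_congr rfl fun E _ => ?_
  unfold TT
  rw [← sum_div, ← add_div]

lemma P_diff {n : ℕ} {D : Fin n → ℕ} {a b b' : Fin n} (hbb : b ≠ b') (hab : a ≠ b) (hab' : a ≠ b') :
    ∑ E ∈ GD n D, (Iv (s(a, b) ∈ E) - Iv (s(a, b') ∈ E)) =
      ((D b : ℝ) - D b')*∑ E ∈ GD n D, sI E b b' a / ((D b : ℝ) + D b' - 2*ct E b b') := by
  have h2 := exch (D := D) hbb a (fun E => 1) (by intros; rfl)
  simp only [one_mul] at h2
  rw [← h2]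
  refine sum_congr rfl fun E _ => ?_
  have h3 : s(b', a) = s(a, b') := Sym2.eq_swap
  have h4 : s(b, a) = s(a, b) := Sym2.eq_swap
  simp only [iX, h3, h4, Iv, ne_eq, hab, hab', not_false_eq_true, true_and]
  by_cases q1 : s(a, b) ∈ E <;> by_cases q2 : s(a, b') ∈ E <;> simp [q1, q2]

lemma TT_nonneg {n : ℕ} (E : Finset (Sym2 (Fin n))) (a b b' : Fin n) : 0 ≤ TT E a b b' := by
  unfold TT
  exact add_nonneg (sum_nonneg fun v _ => mul_nonneg (Iv_nonneg _) (sI_nonneg _ _ _ _))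
    (mul_nonneg (by linarith [Iv_le (s(b, b') ∈ E)]) (sI_nonneg _ _ _ _))

lemma sum_sI {n : ℕ} {D : Fin n → ℕ} {E : Finset (Sym2 (Fin n))} (hE : E ∈ GD n D) {b b' : Fin n} (hbb : b ≠ b') :
    ∑ v, sI E b b' v = (D b : ℝ) + D b' - 2*ct E b b' := by
  have c1 := iX_card hE hbb
  have c2 := iX_card hE hbb.symm
  rw [ct_comm] at c2
  unfold sI
  rw [sum_add_distrib]
  have e1 := sum_Iv (iX E b b')
  have e2 := sum_Iv (iX E b' b)
  unfold Iv at e1 e2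
  rw [e1, e2, c1, c2]; ring

lemma TT_le {n : ℕ} {D : Fin n → ℕ} {E : Finset (Sym2 (Fin n))} (hE : E ∈ GD n D) {a b b' : Fin n} (hbb : b ≠ b') :
    TT E a b b' ≤ (D b : ℝ) + D b' - 2*ct E b b' := by
  have hl := (mem_GD.1 hE).1
  rw [← sum_sI hE hbb]
  unfold TT
  have h1 : (1 - Iv (s(b, b') ∈ E))*sI E b b' a ≤ ∑ v, if v = a then sI E b b' a else 0 := by
    rw [sum_ite_eq' univ a, if_pos (mem_univ _)]
    nlinarith [Iv_nonneg (s(b, b') ∈ E), sI_nonneg E b b' a]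
  refine (add_le_add_right h1 _).trans ?_
  rw [← sum_add_distrib]
  refine sum_le_sum fun v _ => ?_
  split_ifs with h
  · subst h; simp [Iv, hl]
  · nlinarith [Iv_le (s(a, v) ∈ E), sI_nonneg E b b' v]

lemma sI_le_add {n : ℕ} (E : Finset (Sym2 (Fin n))) (b b' v : Fin n) : sI E b b' v ≤ Iv (s(b, v) ∈ E) + Iv (s(b', v) ∈ E) := by
  unfold sI iX Iv
  by_cases q1 : s(b, v) ∈ E <;> by_cases q2 : s(b', v) ∈ E <;> simp [q1, q2] <;> split_ifs <;> norm_num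

lemma TT_le_ct {n : ℕ} (E : Finset (Sym2 (Fin n))) (a b b' : Fin n) :
    TT E a b b' ≤ ct E a b + ct E a b' := by
  rw [ct_Iv, ct_Iv]
  unfold TT
  have h1 : ∑ v, Iv (s(a, v) ∈ E)*sI E b b' v ≤ ∑ v, Iv (s(a, v) ∈ E)*Iv (s(b, v) ∈ E) + ∑ v, Iv (s(a, v) ∈ E)*Iv (s(b', v) ∈ E) := by
    rw [← sum_add_distrib]
    refine sum_le_sum fun v _ => ?_
    rw [← mul_add]
    exact mll (sI_le_add _ _ _ _) (Iv_nonneg _)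
  have h2 := sI_le_add E b b' a
  have h3 : s(b', a) = s(a, b') := Sym2.eq_swap
  have h4 : s(b, a) = s(a, b) := Sym2.eq_swap
  rw [h3, h4] at h2
  nlinarith [Iv_nonneg (s(b, b') ∈ E), sI_nonneg E b b' a]

lemma XA_Iv {n : ℕ} (E : Finset (Sym2 (Fin n))) (a b : Fin n) :
    (XA E {a, b} : ℝ) = ∑ v, Iv (s(a, v) ∈ E)*Iv (s(b, v) ∈ E) := by
  unfold XA
  rw [← sum_Iv]
  refine sum_congr rfl fun v _ => ?_
  simp only [mem_insert, mem_singleton, forall_eq_or_imp, forall_eq]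
  unfold Iv
  by_cases q1 : s(a, v) ∈ E <;> by_cases q2 : s(b, v) ∈ E <;> simp [q1, q2]

lemma XA_Iv3 {n : ℕ} (E : Finset (Sym2 (Fin n))) (a b c : Fin n) :
    (XA E {a, b, c} : ℝ) = ∑ v, Iv (s(a, v) ∈ E)*Iv (s(b, v) ∈ E)*Iv (s(c, v) ∈ E) := by
  unfold XA
  rw [← sum_Iv]
  refine sum_congr rfl fun v _ => ?_
  simp only [mem_insert, mem_singleton, forall_eq_or_imp, forall_eq]
  unfold Iv
  by_cases q1 : s(a, v) ∈ E <;> by_cases q2 : s(b, v) ∈ E <;> by_cases q3 : s(c, v) ∈ E <;> simp [q1, q2, q3]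

lemma ct_XA {n : ℕ} (E : Finset (Sym2 (Fin n))) (a b : Fin n) :
    (ct E a b : ℝ) = XA E {a, b} + Iv (s(a, b) ∈ E) := by rw [ct_Iv, XA_Iv]

lemma TT_XA {n : ℕ} {D : Fin n → ℕ} {E : Finset (Sym2 (Fin n))} (hE : E ∈ GD n D) {a b b' : Fin n} (hbb : b ≠ b') :
    |TT E a b b' - (XA E {a, b} + XA E {a, b'} - 2*XA E {a, b, b'})| ≤ 2 := by
  have hl := (mem_GD.1 hE).1
  have e1 : ∀ v, Iv (s(a, v) ∈ E)*sI E b b' v =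
      Iv (s(a, v) ∈ E)*Iv (s(b, v) ∈ E) + Iv (s(a, v) ∈ E)*Iv (s(b', v) ∈ E) - 2*(Iv (s(a, v) ∈ E)*Iv (s(b, v) ∈ E)*Iv (s(b', v) ∈ E)) -
      ((if v = b then Iv (s(a, b) ∈ E)*Iv (s(b, b') ∈ E) else 0) + (if v = b' then Iv (s(a, b') ∈ E)*Iv (s(b, b') ∈ E) else 0)) := by
    intro v
    by_cases h1 : v = b
    · subst h1
      have h3 : s(b', v) = s(v, b') := Sym2.eq_swap
      simp [sI, iX, hl, hbb, Iv, h3]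
    · by_cases h2 : v = b'
      · subst h2
        simp [sI, iX, hl, h1, Iv]
      · simp only [sI, iX, h1, h2, if_false, Iv]
        by_cases q1 : s(b, v) ∈ E <;> by_cases q2 : s(b', v) ∈ E <;> by_cases q0 : s(a, v) ∈ E <;> simp [q0, q1, q2, h1, h2] <;> norm_num
  have e2 := sum_congr (rfl : (univ : Finset (Fin n)) = univ) (fun v _ => e1 v)
  rw [sum_sub_distrib, sum_sub_distrib, sum_add_distrib, sum_add_distrib, sum_ite_eq' univ b, sum_ite_eq' univ b', ← mul_sum] at e2
  simp only [mem_univ, if_true] at e2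
  rw [XA_Iv, XA_Iv, XA_Iv3, TT, e2]
  have a1 := Iv_nonneg (s(b, b') ∈ E)
  have a2 := Iv_le (s(b, b') ∈ E)
  have a3 := Iv_nonneg (s(a, b) ∈ E)
  have a4 := Iv_le (s(a, b) ∈ E)
  have a5 := Iv_nonneg (s(a, b') ∈ E)
  have a6 := Iv_le (s(a, b') ∈ E)
  have a7 := sI_nonneg E b b' a
  have a8 := sI_le E b b' a
  rw [abs_le]
  constructor <;> nlinarith

lemma sum_adj {n : ℕ} {D : Fin n → ℕ} {E : Finset (Sym2 (Fin n))} (hE : E ∈ GD n D) (a : Fin n) :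
    ∑ v, Iv (s(a, v) ∈ E) = D a := by
  rw [sum_Iv, ← (mem_GD.1 hE).2 a, deg_eq_nb]; congr 2

lemma sum_ct {n : ℕ} {D : Fin n → ℕ} {E : Finset (Sym2 (Fin n))} (hE : E ∈ GD n D) (a : Fin n) :
    ∑ b ∈ univ.erase a, (ct E a b : ℝ) = ∑ v, Iv (s(a, v) ∈ E)*D v := by
  have hl := (mem_GD.1 hE).1
  rw [Finset.sum_erase_eq_sub (mem_univ a)]
  have h1 : (ct E a a : ℝ) = D a := by
    rw [ct_Iv, ← sum_adj hE a]
    simp only [Iv, hl, if_false, add_zero]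
    refine sum_congr rfl fun v _ => ?_
    split_ifs <;> norm_num
  rw [h1]
  simp only [ct_Iv]
  rw [sum_add_distrib, sum_adj hE a, sum_comm, add_sub_cancel_right]
  refine sum_congr rfl fun v _ => ?_
  rw [← mul_sum, ← sum_adj hE v]
  congr 1
  refine sum_congr rfl fun u _ => ?_
  rw [Sym2.eq_swap]

open scoped Classical in
structure Env (n m : ℕ) (x y : ℝ) (D : Fin n → ℕ) : Prop where
  hx : 10^6 ≤ x
  hn : (n:ℝ) = x^200
  hy : x^30 ≤ y
  hyn : 2*y^2 ≤ n
  hp : (n:ℝ)*((m : ℝ) / n.choose 2) = y^2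
  hs : ∑ v, (D v : ℝ) = (n - 1)*y^2
  hd : ∀ v, |(D v : ℝ) - y^2| ≤ 2*x*y
  hN : 0 < NN n D
  hbad : (((GD n D).filter (fun E => ¬ GoodE n m x E)).card : ℝ)*(n:ℝ)^10 ≤ NN n D

def avg {n : ℕ} (D : Fin n → ℕ) (f : Finset (Sym2 (Fin n)) → ℝ) : ℝ := (∑ E ∈ GD n D, f E) / NN n D

lemma avg_mono {n : ℕ} {D : Fin n → ℕ} {f g : Finset (Sym2 (Fin n)) → ℝ} (h : ∀ E ∈ GD n D, f E ≤ g E) : avg D f ≤ avg D g := by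
  unfold avg NN
  exact div_le_div_of_nonneg_right (sum_le_sum h) (by positivity)

lemma avg_congr {n : ℕ} {D : Fin n → ℕ} {f g : Finset (Sym2 (Fin n)) → ℝ} (h : ∀ E ∈ GD n D, f E = g E) : avg D f = avg D g := by
  unfold avg
  rw [sum_congr rfl h]

lemma avg_add {n : ℕ} (D : Fin n → ℕ) (f g : Finset (Sym2 (Fin n)) → ℝ) : avg D (fun E => f E + g E) = avg D f + avg D g := by
  unfold avg; rw [sum_add_distrib, add_div]

lemma avg_sub {n : ℕ} (D : Fin n → ℕ) (f g : Finset (Sym2 (Fin n)) → ℝ) : avg D (fun E => f E - g E) = avg D f - avg D g := by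
  unfold avg; rw [sum_sub_distrib, sub_div]

lemma avg_mul {n : ℕ} (D : Fin n → ℕ) (c : ℝ) (f : Finset (Sym2 (Fin n)) → ℝ) : avg D (fun E => c*f E) = c*avg D f := by
  unfold avg; rw [← mul_sum, mul_div_assoc]

lemma avg_const {n : ℕ} {D : Fin n → ℕ} (h : 0 < NN n D) (c : ℝ) : avg D (fun _ => c) = c := by
  unfold avg; rw [sum_const, nsmul_eq_mul]; change NN n D*c / NN n D = c; field_simp

lemma avg_sum {n : ℕ} {ι : Type*} (D : Fin n → ℕ) (s : Finset ι) (f : ι → Finset (Sym2 (Fin n)) → ℝ) :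
    avg D (fun E => ∑ i ∈ s, f i E) = ∑ i ∈ s, avg D (f i) := by
  unfold avg; rw [sum_comm, sum_div]

open scoped Classical in
lemma avg_good {n m : ℕ} {x y : ℝ} {D : Fin n → ℕ} (h : Env n m x y D) {f : Finset (Sym2 (Fin n)) → ℝ} {e B : ℝ} (he : 0 ≤ e) (hB : 0 ≤ B)
    (h1 : ∀ E ∈ GD n D, GoodE n m x E → |f E| ≤ e) (h2 : ∀ E ∈ GD n D, |f E| ≤ B) : |avg D f| ≤ e + B / (n:ℝ)^10 := by
  have hN := h.hN
  have hn0 : (0:ℝ) < n := by rw [h.hn]; have := h.hx; positivity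
  unfold avg
  rw [abs_div, abs_of_pos hN, div_le_iff₀ hN]
  have key : ∀ E ∈ GD n D, |f E| ≤ e + B*(if ¬ GoodE n m x E then 1 else 0) := by
    intro E hE
    by_cases hg : GoodE n m x E
    · simp only [hg, not_true, if_false, mul_zero, add_zero]; exact h1 E hE hg
    · simp only [hg, not_false_eq_true, if_true, mul_one]; linarith [h2 E hE]
  calc |∑ E ∈ GD n D, f E| ≤ ∑ E ∈ GD n D, |f E| := abs_sum_le_sum_abs _ _
    _ ≤ ∑ E ∈ GD n D, (e + B*(if ¬ GoodE n m x E then 1 else 0)) := sum_le_sum key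
    _ = NN n D*e + B*(((GD n D).filter (fun E => ¬ GoodE n m x E)).card : ℝ) := by
      rw [sum_add_distrib, sum_const, nsmul_eq_mul, ← mul_sum, card_filter]; push_cast; rfl
    _ ≤ NN n D*e + B*(NN n D / (n:ℝ)^10) := by
      gcongr
      rw [le_div_iff₀ (by positivity)]; exact h.hbad
    _ = _ := by ring

lemma Env.two {n m : ℕ} {x y : ℝ} {D : Fin n → ℕ} (h : Env n m x y D) {E : Finset (Sym2 (Fin n))} (hg : GoodE n m x E) {a b : Fin n} (hab : a ≠ b) :
    |(XA E {a, b} : ℝ) - y^4 / n| ≤ x*(y^2 / x^100 + 1) := by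
  have hx0 : 0 < x := by have := h.hx; linarith
  have hn0 : (0:ℝ) < n := by rw [h.hn]; positivity
  have := hg a b b
  simp only [mem_singleton, insert_eq_of_mem] at this
  rw [card_pair hab] at this
  have e1 : (n:ℝ)*((m : ℝ) / n.choose 2)^2 = y^4 / n := by
    rw [eq_div_iff (by positivity)]
    have := h.hp
    calc _ = ((n:ℝ)*((m : ℝ) / n.choose 2))^2 := by ring
      _ = _ := by rw [this]; ring
  rw [e1] at this
  have e2 : Real.sqrt (y^4 / n) = y^2 / x^100 := by
    rw [show y^4 / (n:ℝ) = (y^2 / x^100)^2 by rw [h.hn, div_pow, ← pow_mul, ← pow_mul]]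
    exact Real.sqrt_sq (by positivity)
  rw [e2] at this
  exact this.le

lemma Env.y0 {n m : ℕ} {x y : ℝ} {D : Fin n → ℕ} (h : Env n m x y D) : 0 < y :=
  lt_of_lt_of_le (by have := h.hx; positivity) h.hy

lemma Env.yz {n m : ℕ} {x y : ℝ} {D : Fin n → ℕ} (h : Env n m x y D) : y ≤ x^100 := by
  have h1 := h.hyn
  have h2 := h.hn
  have hx := h.hx
  apply le_of_sq_le_sq _ (by positivity)
  rw [← pow_mul, ← h2]; nlinarith [sq_nonneg y]

lemma Env.three {n m : ℕ} {x y : ℝ} {D : Fin n → ℕ} (h : Env n m x y D) {E : Finset (Sym2 (Fin n))} (hg : GoodE n m x E) {a b c : Fin n} (hab : a ≠ b)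
    (hac : a ≠ c) (hbc : b ≠ c) :
    |(XA E {a, b, c} : ℝ) - y^6 / n^2| ≤ x*(y^2 / x^100 + 1) := by
  have hx0 : 0 < x := by have := h.hx; linarith
  have hn0 : (0:ℝ) < n := by rw [h.hn]; positivity
  have hy0 := h.y0
  have := hg a b c
  rw [card_eq_three.2 ⟨a, b, c, hab, hac, hbc, rfl⟩] at this
  have e1 : (n:ℝ)*((m : ℝ) / n.choose 2)^3 = y^6 / n^2 := by
    rw [eq_div_iff (by positivity)]
    have := h.hp
    calc _ = ((n:ℝ)*((m : ℝ) / n.choose 2))^3 := by ring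
      _ = _ := by rw [this]; ring
  rw [e1] at this
  have e2 : Real.sqrt (y^6 / n^2) = y^3 / n := by
    rw [show y^6 / (n:ℝ)^2 = (y^3 / n)^2 by rw [div_pow, ← pow_mul]]
    exact Real.sqrt_sq (by positivity)
  rw [e2] at this
  refine this.le.trans ?_
  gcongr x*(?_ + 1)
  rw [div_le_div_iff₀ (by positivity) (by positivity), h.hn]
  have := h.yz
  calc y^3*x^100 = y^2*(y*x^100) := by ring
    _ ≤ y^2*(x^100*x^100) := by gcongr
    _ = _ := by ring

lemma kap_real {n x y Da Db κ S1 S2 e1 e2 : ℝ} (hx : 10^6 ≤ x) (hy0 : 0 < y) (hn2 : 2 ≤ n) (hyn : 2*y^2 ≤ n)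
    (ha : |Da - y^2| ≤ 2*x*y) (hb : |Db - y^2| ≤ 2*x*y) (hxy : 2*x*y ≤ y^2) (he1 : 0 ≤ e1)
    (hκ : (n - 1)*κ = S1 + S2) (hS1 : |S1 - Da*y^2| ≤ n*e2)
    (hS2 : |S2 - y^2 / n*((n - 1)*Db - ((n - 1)*y^2 - Da))| ≤ n*(4*x*y*e1)) :
    |κ - (Da + 1)*Db / n| ≤ 20*x^2*y^2 / n + 2*e2 + 8*x*y*e1 := by
  have hn0 : 0 < n := by linarith
  obtain ⟨p, hp⟩ : ∃ p, p = y^2 / n := ⟨_, rfl⟩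
  obtain ⟨q, hq⟩ : ∃ q, q = (Da + 1)*Db / n := ⟨_, rfl⟩
  rw [← hp] at hS2
  rw [← hq]
  have hp' : p*n = y^2 := by rw [hp]; field_simp
  have hq' : q*n = (Da + 1)*Db := by rw [hq]; field_simp
  have hp0 : 0 ≤ p := by rw [hp]; positivity
  have hp1 : 2*p ≤ 1 := by rw [hp, mul_div_assoc', div_le_one hn0]; exact hyn
  rw [abs_le] at ha hb
  have hDa0 : 0 ≤ Da := by linarith
  have hDb0 : 0 ≤ Db := by linarith
  have hDa2 : Da ≤ 2*y^2 := by linarith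
  have hDb2 : Db ≤ 2*y^2 := by linarith
  have hq0 : 0 ≤ q := by rw [hq]; positivity
  have hq1 : q ≤ 2*Db := by
    rw [hq, div_le_iff₀ hn0]; nlinarith
  have main : (n - 1)*(κ - q) = (S1 - Da*y^2) + (S2 - p*((n - 1)*Db - ((n - 1)*y^2 - Da)))
     + (-((Da - y^2)*(Db - y^2)) - p*(Db - y^2) + p*Da - Db + q) := by
    linear_combination hκ - hq' + (y^2 - Db)*-hp'
  have m1 : |(Da - y^2)*(Db - y^2)| ≤ (2*x*y)*(2*x*y) := by
    rw [abs_mul]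
    apply mul_le_mul (abs_le.2 ha) (abs_le.2 hb) (abs_nonneg _) (by positivity)
  have m2 : |p*(Db - y^2)| ≤ 1*(2*x*y) := by
    rw [abs_mul, abs_of_nonneg hp0]
    apply mul_le_mul (by linarith) (abs_le.2 hb) (abs_nonneg _) (by positivity)
  have m3 : p*Da ≤ Da := by nlinarith
  have m4 : 0 ≤ p*Da := by positivity
  have m5 : 10*y^2 ≤ x^2*y^2 := by
    apply mlr _ (by positivity); nlinarith
  have m6 : |(n - 1)*(κ - q)| ≤ n*e2 + n*(4*x*y*e1) + 6*x^2*y^2 := by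
    rw [main]
    rw [abs_le] at *
    constructor <;> nlinarith only [m1, m2, m3, m4, m5, hS1, hS2, hq0, hq1, hDa0, hDb0, hDa2, hDb2, hxy]
  rw [abs_mul, abs_of_pos (by linarith : 0 < n - 1)] at m6
  have m7 : n*|κ - q| ≤ n*(20*x^2*y^2 / n + 2*e2 + 8*x*y*e1) := by
    have : n*(20*x^2*y^2 / n + 2*e2 + 8*x*y*e1) = 20*x^2*y^2 + n*(2*e2) + n*(8*x*y*e1) := by
      field_simp
    rw [this]
    have : n*|κ - q| ≤ 2*((n - 1)*|κ - q|) := by nlinarith [abs_nonneg (κ - q)]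
    nlinarith [sq_nonneg (x*y)]
  exact le_of_mul_le_mul_left m7 hn0

lemma Env.xy {n m : ℕ} {x y : ℝ} {D : Fin n → ℕ} (h : Env n m x y D) : 2*x*y ≤ y^2 ∧ 10^6*(x*y) ≤ y^2 := by
  have hx := h.hx
  have hy := h.hy
  have hy0 := h.y0
  have h2 : x^2 ≤ x^30 := pow_le_pow_right₀ (by linarith) (by norm_num)
  have h3 : 10^6*x ≤ y := by nlinarith
  constructor <;> nlinarith

lemma Env.n2 {n m : ℕ} {x y : ℝ} {D : Fin n → ℕ} (h : Env n m x y D) : 10^6 ≤ (n:ℝ) := by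
  rw [h.hn]; exact h.hx.trans (le_self_pow₀ (by linarith [h.hx]) (by norm_num))

lemma kappa {n m : ℕ} {x y : ℝ} {D : Fin n → ℕ} (h : Env n m x y D) {a b : Fin n} (hab : a ≠ b) {e1 e2 : ℝ} (he1 : 0 ≤ e1)
    (h1 : ∀ b', b' ≠ a → b' ≠ b → |avg D (fun E => TT E a b b' / ((D b : ℝ) + D b' - 2*ct E b b')) - y^2 / n| ≤ e1)
    (h2 : |avg D (fun E => ∑ v, Iv (s(a, v) ∈ E)*((D v : ℝ) - y^2))| ≤ n*e2) :
    |avg D (fun E => (ct E a b : ℝ)) - (D a + 1)*D b / n| ≤ 20*x^2*y^2 / n + 2*e2 + 8*x*y*e1 := by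
  have hN := h.hN
  have hy0 := h.y0
  have hx := h.hx
  have hx0 : 0 < x := by linarith
  have hn6 := h.n2
  have hn0 : (0:ℝ) < n := by linarith
  refine kap_real (S1 := ∑ b' ∈ univ.erase a, avg D (fun E => (ct E a b' : ℝ)))
    (S2 := ∑ b' ∈ univ.erase a, (avg D (fun E => (ct E a b : ℝ)) - avg D (fun E => (ct E a b' : ℝ)))) hx hy0 (by linarith) h.hyn (h.hd a) (h.hd b) h.xy.1 he1 ?_ ?_ ?_
  · rw [sum_sub_distrib, sum_const, card_erase_of_mem (mem_univ a), card_univ, Fintype.card_fin, nsmul_eq_mul]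
    have : 1 ≤ n := by exact_mod_cast (by linarith : (1:ℝ) ≤ n)
    push_cast [this]; ring
  · rw [← avg_sum]
    have : avg D (fun E => ∑ b' ∈ univ.erase a, (ct E a b' : ℝ)) - D a*y^2 = avg D (fun E => ∑ v, Iv (s(a, v) ∈ E)*((D v : ℝ) - y^2)) := by
      rw [← avg_const hN (D a*y^2 : ℝ), ← avg_sub]
      apply avg_congr
      intro E hE
      rw [sum_ct hE, ← sum_adj hE a]
      simp only [mul_sub]
      rw [sum_sub_distrib, sum_mul]
    rw [this]; exact h2
  · have e : ∀ b' ∈ univ.erase a, |(avg D (fun E => (ct E a b : ℝ)) - avg D (fun E => (ct E a b' : ℝ))) - y^2 / n*((D b : ℝ) - D b')| ≤ 4*x*y*e1 := by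
      intro b' hb'
      have hb1 : b' ≠ a := (mem_erase.1 hb').1
      by_cases hb2 : b' = b
      · subst hb2; simp; positivity
      · have k := k_diff (D := D) (Ne.symm hb2) hab hb1.symm
        have k' : avg D (fun E => (ct E a b : ℝ)) - avg D (fun E => (ct E a b' : ℝ)) = ((D b : ℝ) - D b')*avg D (fun E => TT E a b b' / ((D b : ℝ) + D b' - 2*ct E b b')) := by
          rw [← avg_sub]; unfold avg; rw [k, mul_div_assoc]
        rw [k', mul_comm (y^2 / (n:ℝ)), ← mul_sub, abs_mul]
        have b1 : |(D b : ℝ) - D b'| ≤ 4*x*y := by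
          have q1 := abs_le.1 (h.hd b)
          have q2 := abs_le.1 (h.hd b')
          rw [abs_le]; constructor <;> linarith
        exact mul_le_mul b1 (h1 b' hb1 hb2) (abs_nonneg _) (by positivity)
    have e3 : y^2 / (n:ℝ)*((n - 1)*D b - ((n - 1)*y^2 - D a)) = ∑ b' ∈ univ.erase a, y^2 / n*((D b : ℝ) - D b') := by
      rw [← mul_sum, sum_sub_distrib, sum_const, card_erase_of_mem (mem_univ a), card_univ, Fintype.card_fin, nsmul_eq_mul,
        Finset.sum_erase_eq_sub (mem_univ a), h.hs]
      have : 1 ≤ n := by exact_mod_cast (by linarith : (1:ℝ) ≤ n)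
      push_cast [this]; ring
    rw [e3, ← sum_sub_distrib]
    refine (abs_sum_le_sum_abs _ _).trans ?_
    refine (sum_le_sum e).trans ?_
    rw [sum_const, card_erase_of_mem (mem_univ a), card_univ, Fintype.card_fin, nsmul_eq_mul]
    have : ((n - 1 : ℕ) : ℝ) ≤ n := by exact_mod_cast Nat.sub_le n 1
    have q : 0 ≤ 4*x*y*e1 := by positivity
    nlinarith

lemma Env.y6 {n m : ℕ} {x y : ℝ} {D : Fin n → ℕ} (h : Env n m x y D) : 10^6 ≤ y ∧ 1 ≤ x*y := by
  have hx := h.hx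
  have hy : 10^6 ≤ y := le_trans hx ((le_self_pow₀ (by linarith) (by norm_num)).trans h.hy)
  exact ⟨hy, one_le_mul_of_one_le_of_one_le (by linarith) (by linarith)⟩

lemma Env.dd {n m : ℕ} {x y : ℝ} {D : Fin n → ℕ} (h : Env n m x y D) (v : Fin n) : 0.99*y^2 ≤ D v ∧ (D v : ℝ) + 1 ≤ 1.01*y^2 ∧ 10^12 ≤ y^2 := by
  have h1 := abs_le.1 (h.hd v)
  have h2 := h.xy.2
  have hx := h.hx
  have hy : 10^6 ≤ y := le_trans hx ((le_self_pow₀ (by linarith) (by norm_num)).trans h.hy)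
  have hy2 : (10:ℝ)^12 ≤ y^2 := by nlinarith only [hy]
  refine ⟨?_, ?_, hy2⟩ <;> linarith

lemma ct_le {n : ℕ} {D : Fin n → ℕ} {E : Finset (Sym2 (Fin n))} (hE : E ∈ GD n D) {b b' : Fin n} (hbb : b ≠ b') : (ct E b b' : ℝ) ≤ D b := by
  have := iX_card hE hbb
  have h0 : (0:ℝ) ≤ ((univ.filter (iX E b b')).card : ℝ) := by positivity
  linarith

/-- common neighbours are small for good graphs -/
lemma Env.ctg {n m : ℕ} {x y : ℝ} {D : Fin n → ℕ} (h : Env n m x y D) {E : Finset (Sym2 (Fin n))} (hg : GoodE n m x E) {a b : Fin n} (hab : a ≠ b) :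
    |(ct E a b : ℝ) - y^4 / n| ≤ 2*x*(y^2 / x^100 + 1) := by
  have h1 := abs_le.1 (h.two hg hab)
  rw [ct_XA, abs_le]
  have h2 := Iv_nonneg (s(a, b) ∈ E)
  have h3 := Iv_le (s(a, b) ∈ E)
  have hx := h.hx
  have : 1 ≤ x*(y^2 / x^100 + 1) := by
    have : 0 ≤ y^2 / x^100 := by positivity
    nlinarith
  constructor <;> linarith

lemma Env.w {n m : ℕ} {x y : ℝ} {D : Fin n → ℕ} (h : Env n m x y D) : x*(y^2 / x^100 + 1) ≤ y^2 / 10^5 := by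
  have hx := h.hx
  have h1 : y^2 / x^100 ≤ y := by
    rw [div_le_iff₀ (by positivity)]
    nlinarith [h.yz, h.y0]
  have hy0 := h.y0
  have h2 := h.xy.2
  have hy : 10^6 ≤ y := le_trans hx ((le_self_pow₀ (by linarith) (by norm_num)).trans h.hy)
  have : x*(y^2 / x^100 + 1) ≤ x*(2*y) := mll (by linarith) (by linarith)
  linarith [sq_nonneg y]

lemma Env.y4 {n m : ℕ} {x y : ℝ} {D : Fin n → ℕ} (h : Env n m x y D) : y^4 / n ≤ y^2 / 2 := by
  have hn := h.n2
  rw [div_le_iff₀ (by linarith)]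
  nlinarith [h.hyn, sq_nonneg y]

lemma Q_bound {n m : ℕ} {x y : ℝ} {D : Fin n → ℕ} (h : Env n m x y D) {a b : Fin n} (hab : a ≠ b) :
    avg D (fun E => ((ct E a b : ℝ) - (D a + 1)*D b / n)^2 / (D a + 1 - ct E a b)) ≤ 600*x^2*(y^2 / n + 1 / y^2) := by
  have hx := h.hx
  have hx0 : 0 < x := by linarith
  have hn6 := h.n2
  have hn0 : (0:ℝ) < n := by linarith
  have hy0 := h.y0
  obtain ⟨a1, a2, a3⟩ := h.dd a
  obtain ⟨b1, b2, -⟩ := h.dd b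
  have hw := h.w
  have hy4 := h.y4
  have hyn := h.hyn
  set A : ℝ := D a + 1
  set B : ℝ := (D b : ℝ)
  set w : ℝ := y^2 / x^100 + 1 with hwdef
  have hw1 : 1 ≤ w := by rw [hwdef]; have : 0 ≤ y^2 / x^100 := by positivity
                         linarith
  have hcs : |A*B / n - y^4 / n| ≤ 6*x*w := by
    have hA : |A - y^2| ≤ 3*x*y := by
      have := abs_le.1 (h.hd a)
      have hy1 := h.y6.2
      rw [abs_le]; constructor <;> (simp only [A]; linarith)
    have hB := h.hd b
    have e : |A*B - y^4| ≤ 6*x*y^3 := by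
      have : A*B - y^4 = (A - y^2)*B + y^2*(B - y^2) := by ring
      rw [this]
      refine (abs_add_le _ _).trans ?_
      rw [abs_mul, abs_mul, abs_of_nonneg (by linarith : 0 ≤ B), abs_of_nonneg (sq_nonneg y)]
      have q1 : |A - y^2| * B ≤ 3*x*y*(1.01*y^2) := mul_le_mul hA (by linarith) (by linarith) (by positivity)
      have q2 : y^2*|B - y^2| ≤ y^2*(2*x*y) := mll hB (by positivity)
      have : 0 ≤ x*y^3 := by positivity
      linarith
    rw [← sub_div, abs_div, abs_of_pos hn0, div_le_iff₀ hn0]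
    refine e.trans ?_
    have q : y^3 ≤ w*n := by
      rw [hwdef, h.hn]
      have : y^3 ≤ y^2 / x^100*x^200 := by
        rw [show y^2 / x^100*x^200 = y^2*x^100 by field_simp]
        nlinarith [h.yz, sq_nonneg y]
      have q0 : 0 < x^200 := by positivity
      linarith
    have : 6*x*y^3 ≤ 6*x*(w*n) := mll q (by positivity)
    linarith
  have key := avg_good h (f := fun E => ((ct E a b : ℝ) - A*B / n)^2 / (A - ct E a b)) (e := 256*x^2*w^2 / y^2) (B := (n:ℝ)^2)
    (by positivity) (by positivity) ?_ ?_
  · refine (le_abs_self _).trans (key.trans ?_)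
    have w2 : w^2 ≤ 2*(y^4 / n + 1) := by
      have : (y^2 / x^100)^2 = y^4 / n := by rw [h.hn, div_pow, ← pow_mul, ← pow_mul]
      rw [hwdef, ← this]; nlinarith [sq_nonneg (y^2 / x^100 - 1)]
    have t1 : 256*x^2*w^2 / y^2 ≤ 512*x^2*(y^2 / n + 1 / y^2) := by
      calc 256*x^2*w^2 / y^2 ≤ 256*x^2*(2*(y^4 / n + 1)) / y^2 := by gcongr
        _ = _ := by field_simp; ring
    have t2 : (n:ℝ)^2 / n^10 ≤ x^2*(y^2 / n + 1 / y^2) := by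
      have : (n:ℝ)^2 / n^10 ≤ 1 / y^2 := by
        rw [div_le_div_iff₀ (by positivity) (by positivity), one_mul]
        calc (n:ℝ)^2*y^2 ≤ n^2*n^8 := by
              gcongr
              calc y^2 ≤ n := by linarith [sq_nonneg y]
                _ ≤ n^8 := le_self_pow₀ (by linarith) (by norm_num)
          _ = _ := by ring
      have q : 0 ≤ y^2 / n := by positivity
      have q2 : 0 ≤ 1 / y^2 := by positivity
      have q3 : 1 ≤ x^2 := one_le_pow₀ (by linarith)
      nlinarith only [this, q, q2, q3]
    have t3 : 0 ≤ x^2*(y^2 / n + 1 / y^2) := by positivity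
    linarith
  · intro E hE hg
    have hc := h.ctg hg hab
    have hd : |(ct E a b : ℝ) - A*B / n| ≤ 8*x*w := by
      rw [abs_le] at *; constructor <;> linarith
    have hA4 : y^2 / 4 ≤ A - ct E a b := by
      have := (abs_le.1 hc).2
      simp only [A]; linarith
    rw [abs_of_nonneg (div_nonneg (sq_nonneg _) (by linarith [sq_nonneg y]))]
    rw [← sq_abs, div_le_iff₀ (by linarith)]
    calc |(ct E a b : ℝ) - A*B / n|^2 ≤ (8*x*w)^2 := by gcongr
      _ = 256*x^2*w^2 / y^2*(y^2 / 4) := by field_simp; ring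
      _ ≤ _ := by gcongr
  · intro E hE
    have hc := ct_le hE hab
    have hA1 : 1 ≤ A - ct E a b := by simp only [A]; linarith
    rw [abs_of_nonneg (div_nonneg (sq_nonneg _) (by linarith))]
    refine (div_le_self (sq_nonneg _) hA1).trans ?_
    rw [← sq_abs]
    have h0 : (0:ℝ) ≤ ct E a b := by positivity
    have hq0 : 0 ≤ A*B / n := by
      have : 0 ≤ B := by linarith [sq_nonneg y]
      have : 0 ≤ A := by linarith
      positivity
    have hq1 : A*B / n ≤ A := by
      rw [div_le_iff₀ hn0]
      exact mll (by linarith) (by linarith)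
    have hAn : A ≤ n := by linarith
    apply pow_le_pow_left₀ (abs_nonneg _)
    rw [abs_le]; constructor <;> linarith

lemma step_real {n x y A B Y Q na nb av xa xb c K : ℝ} (hx0 : 0 < x) (hy : 1 ≤ y) (hn0 : 0 < n) (hyn : 2*y^2 ≤ n)
    (hA1 : 0.99*y^2 ≤ A) (hA2 : A ≤ 1.01*y^2) (hB1 : 0.99*y^2 ≤ B) (hB2 : B ≤ 1.01*y^2) (hAB : |B - A| ≤ 5*x*y)
    (hc : c = A*B / n) (hK : |K - c| ≤ Y) (hQ0 : 0 ≤ Q) (hav : av = 1 + (B - A) / (A - c) + (B - A) / (A - c)^2*((K - c) + Q))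
    (hxa : xa*(n - A) = na*A) (hxb : xb*(n - B) = nb*B) (hnb : 0 < nb) (hna : nb*av ≤ na) :
    xb - xa ≤ 180*x / y^3*(Y + Q)*xb := by
  have hy2 : 1 ≤ y^2 := one_le_pow₀ hy
  have hA0 : 0 < A := by linarith
  have hB0 : 0 < B := by linarith
  have hnA : 0 < n - A := by linarith
  have hnB : 0 < n - B := by linarith
  have hAc : A - c = A*(n - B) / n := by rw [hc]; field_simp
  have hAc3 : y^2 / 3 ≤ A - c := by
    rw [hAc, le_div_iff₀ hn0]
    have : 0.49*n ≤ n - B := by linarith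
    nlinarith only [this, hA1, hn0, hA0, mul_le_mul hA1 this (by positivity) hA0.le, mul_nonneg (sq_nonneg y) hn0.le]
  have hAc0 : 0 < A - c := by linarith
  obtain ⟨φ, hφ⟩ : ∃ φ, φ = B*(n - A) / (A*(n - B)) := ⟨_, rfl⟩
  have hφ1 : 1 + (B - A) / (A - c) = φ := by
    rw [hAc, hφ]; field_simp; ring
  have hφ4 : 1 / 4 ≤ φ := by
    rw [hφ, div_le_div_iff₀ (by norm_num) (by positivity)]
    have : 0.49*n ≤ n - A := by linarith
    have q : A*(n - B) ≤ A*n := mll (by linarith) hA0.le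
    have q2 := mul_le_mul hB1 this (by positivity) hB0.le
    have q3 := mlr hA2 hn0.le
    linarith [mul_nonneg (sq_nonneg y) hn0.le]
  have hφ0 : 0 < φ := by linarith
  have hxb0 : 0 < xb := by
    by_contra hcon
    have : xb*(n - B) ≤ 0 := mul_nonpos_of_nonpos_of_nonneg (by linarith) hnB.le
    have : 0 < nb*B := by positivity
    linarith
  have hxa' : xb*av / φ ≤ xa := by
    have e1 : xb = nb*B / (n - B) := by rw [eq_div_iff hnB.ne']; exact hxb
    have e2 : xa = na*A / (n - A) := by rw [eq_div_iff hnA.ne']; exact hxa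
    have e3 : xb*av / φ = nb*av*A / (n - A) := by
      rw [e1, hφ]; field_simp
    rw [e3, e2]; gcongr
  have hdev : φ - av ≤ 45*x / y^3*(Y + Q) := by
    have e1 : φ - av = -((B - A) / (A - c)^2*((K - c) + Q)) := by rw [hav, hφ1]; ring
    rw [e1]
    refine (neg_le_abs _).trans ?_
    rw [abs_mul, abs_div, abs_of_nonneg (sq_nonneg (A - c))]
    have f1 : |B - A| / (A - c)^2 ≤ 5*x*y / (y^2 / 3)^2 := by gcongr
    have f2 : 5*x*y / (y^2 / 3)^2 = 45*x / y^3 := by field_simp; ring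
    have f3 : |(K - c) + Q| ≤ Y + Q := (abs_add_le _ _).trans (by rw [abs_of_nonneg hQ0]; linarith)
    rw [f2] at f1
    exact mul_le_mul f1 f3 (abs_nonneg _) (by positivity)
  have hYQ : 0 ≤ Y + Q := by linarith [abs_nonneg (K - c)]
  have g : xb - xb*av / φ = xb*((φ - av) / φ) := by field_simp
  have g2 : (φ - av) / φ ≤ 180*x / y^3*(Y + Q) := by
    rw [div_le_iff₀ hφ0]
    have z0 : 0 ≤ 45*x / y^3*(Y + Q) := by positivity
    have : 180*x / y^3*(Y + Q)*φ = 4*φ*(45*x / y^3*(Y + Q)) := by ring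
    rw [this]; nlinarith only [z0, hφ4, hdev]
  have g3 := mll g2 hxb0.le
  linarith

lemma r3_step {n m : ℕ} {x y : ℝ} {T : Fin n → ℕ} {a b : Fin n} (hab : a ≠ b) (h : Env n m x y (up T b)) (ha : 0 < rr T a) (hb : 0 < rr T b)
    {Y : ℝ} (hY : |avg (up T b) (fun E => (ct E a b : ℝ)) - (up T b a + 1)*up T b b / n| ≤ Y) :
    xx T b - xx T a ≤ 180*x / y^3*(Y + 600*x^2*(y^2 / n + 1 / y^2))*xx T b := by
  have hx := h.hx
  have hx0 : 0 < x := by linarith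
  have hn6 := h.n2
  have hn0 : (0:ℝ) < n := by linarith
  have hy0 := h.y0
  have hQ := Q_bound h hab
  obtain ⟨a1, a2, a3⟩ := h.dd a
  obtain ⟨b1, b2, -⟩ := h.dd b
  have hda := abs_le.1 (h.hd a)
  have hdb := abs_le.1 (h.hd b)
  have hA : (up T b a : ℝ) = T a := by rw [up_apply]; simp [hab]
  have hB : (up T b b : ℝ) = T b + 1 := by rw [up_apply]; simp
  have hN := h.hN
  have hyn := h.hyn
  have hy1 : 1 ≤ y := by linarith [h.y6.1]
  have hxy1 := h.y6.2
  have hctl : ∀ E ∈ GD n (up T b), (ct E a b : ℝ) ≤ T a := fun E hE => hA ▸ ct_le hE hab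
  rw [hA, hB] at hY hQ
  rw [hA] at a1 a2 hda
  rw [hB] at b1 b2 hdb
  clear hA hB
  set D := up T b with hD
  set A : ℝ := T a + 1 with hAdef
  set B : ℝ := (T b : ℝ) + 1 with hBdef
  set cs : ℝ := A*B / n with hcs
  set Q := avg D (fun E => ((ct E a b : ℝ) - cs)^2 / (A - ct E a b)) with hQdef
  have hct : ∀ E ∈ GD n D, 0 < A - ct E a b := by
    intro E hE
    have := hctl E hE
    rw [hAdef]; linarith
  have hQ0 : 0 ≤ Q := by
    rw [hQdef, ← avg_const hN 0]
    exact avg_mono fun E hE => div_nonneg (sq_nonneg _) (hct E hE).le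
  have hmove := move T hab (fun c => 1 / (A - c))
  have hAn : A - cs ≠ 0 := by
    have : A - cs = A*(n - B) / n := by rw [hcs]; field_simp
    rw [this]
    have q1 : 0 < A := by linarith
    have q2 : (0:ℝ) < n - B := by linarith
    positivity
  have hav : NN n D*avg D (fun E => (B - ct E a b) / (A - ct E a b)) ≤ NN n (up T a) := by
    unfold avg
    rw [mul_div_cancel₀ _ hN.ne']
    have e1 : ∑ E ∈ GD n D, (B - ct E a b) / (A - ct E a b) = ∑ E ∈ GD n D, 1 / (A - ct E a b)*(B - ct E a b) :=
      sum_congr rfl fun E _ => by ring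
    rw [e1, hmove]
    unfold NN
    rw [card_eq_sum_ones]; push_cast
    refine sum_le_sum fun E _ => ?_
    rw [one_div, mul_comm]
    by_cases h0 : A - (ct E a b : ℝ) = 0
    · rw [h0]; simp
    · rw [mul_inv_cancel₀ h0]
  have havQ : avg D (fun E => (B - ct E a b) / (A - ct E a b)) = 1 + (B - A) / (A - cs) + (B - A) / (A - cs)^2*((avg D (fun E => (ct E a b : ℝ)) - cs) + Q) := by
    rw [← avg_const hN cs, ← avg_sub, hQdef, ← avg_add, avg_const hN cs, ← avg_mul, ← avg_const hN (1 + (B - A) / (A - cs)), ← avg_add]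
    apply avg_congr
    intro E hE
    have := (hct E hE).ne'
    field_simp
    ring
  have hfin := step_real (n := n) (A := A) (B := B) (Y := Y) (Q := Q) (na := NN n (up T a)) (nb := NN n D) (xa := xx T a) (xb := xx T b) (K := avg D (fun E => (ct E a b : ℝ)))
    hx0 hy1 hn0 hyn (by linarith) (by linarith) (by linarith) (by linarith) (by rw [abs_le]; constructor <;> linarith) hcs hY hQ0 havQ
    (by rw [show (n:ℝ) - A = rr T a by rw [hAdef]; unfold rr; ring]; unfold xx; field_simp; rfl)
    (by rw [show (n:ℝ) - B = rr T b by rw [hBdef]; unfold rr; ring]; unfold xx; field_simp; rfl) hN hav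
  refine hfin.trans ?_
  have := xx_nonneg T b hb
  gcongr

lemma Env.sgood {n m : ℕ} {x y : ℝ} {D : Fin n → ℕ} (h : Env n m x y D) {E : Finset (Sym2 (Fin n))} (hg : GoodE n m x E) {b b' : Fin n} (hbb : b ≠ b') :
    y^2 / 2 ≤ (D b : ℝ) + D b' - 2*ct E b b' := by
  have h1 := (abs_le.1 (h.ctg hg hbb)).2
  have h2 := h.w
  have h3 := h.y4
  have h4 := (h.dd b).1
  have h5 := (h.dd b').1
  linarith [sq_nonneg y]

lemma TTs_nonneg {n : ℕ} {D : Fin n → ℕ} {E : Finset (Sym2 (Fin n))} (hE : E ∈ GD n D) {a b b' : Fin n} (hbb : b ≠ b') :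
    0 ≤ TT E a b b' / ((D b : ℝ) + D b' - 2*ct E b b') ∧ TT E a b b' / ((D b : ℝ) + D b' - 2*ct E b b') ≤ 1 := by
  have h1 := TT_nonneg E a b b'
  have h2 := TT_le hE (a := a) hbb
  exact ⟨div_nonneg h1 (h1.trans h2), div_le_one_of_le₀ h2 (h1.trans h2)⟩

lemma sIs {n : ℕ} {D : Fin n → ℕ} {E : Finset (Sym2 (Fin n))} (hE : E ∈ GD n D) {a b b' : Fin n} (hbb : b ≠ b') :
    0 ≤ sI E b b' a / ((D b : ℝ) + D b' - 2*ct E b b') ∧ sI E b b' a / ((D b : ℝ) + D b' - 2*ct E b b') ≤ 1 := by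
  have h1 := sI_nonneg E b b' a
  have h2 : sI E b b' a ≤ (D b : ℝ) + D b' - 2*ct E b b' := by
    rw [← sum_sI hE hbb]
    exact single_le_sum (fun v _ => sI_nonneg E b b' v) (mem_univ a)
  exact ⟨div_nonneg h1 (h1.trans h2), div_le_one_of_le₀ h2 (h1.trans h2)⟩

lemma Env.n10 {n m : ℕ} {x y : ℝ} {D : Fin n → ℕ} (h : Env n m x y D) : 2 / (n:ℝ)^10 ≤ 1 / n := by
  have hn := h.n2
  rw [div_le_div_iff₀ (by positivity) (by positivity)]
  have : (n:ℝ)^2 ≤ n^10 := pow_le_pow_right₀ (by linarith) (by norm_num)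
  nlinarith

lemma kap_le {n m : ℕ} {x y : ℝ} {D : Fin n → ℕ} (h : Env n m x y D) (hm : ∑ i, D i = 2*m) (hlow : y ≤ x^60) {a b : Fin n} (hab : a ≠ b) :
    avg D (fun E => (ct E a b : ℝ)) ≤ 5*y^4 / n := by
  have hx := h.hx
  have hx0 : 0 < x := by linarith
  have hn6 := h.n2
  have hn0 : (0:ℝ) < n := by linarith
  have hy0 := h.y0
  have hmr : (2*m : ℝ) = (n - 1)*y^2 := by
    rw [← h.hs]; exact_mod_cast hm.symm
  have hy20 : 20*y^2 ≤ n := by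
    rw [h.hn]
    calc 20*y^2 ≤ x*(x^60)^2 := by gcongr; linarith
      _ = x^121 := by ring
      _ ≤ x^200 := pow_le_pow_right₀ (by linarith) (by norm_num)
  set Δ := ⌊1.01*y^2⌋₊ with hΔ
  have hΔr : (Δ:ℝ) ≤ 1.01*y^2 := Nat.floor_le (by positivity)
  have hDΔ : ∀ i, D i ≤ Δ := fun i => Nat.le_floor (by linarith [(h.dd i).2.1])
  have hΔM : 12*Δ^2 ≤ 2*m := by
    have : (12:ℝ)*Δ^2 ≤ 2*m := by
      rw [hmr]
      have : (Δ:ℝ)^2 ≤ (1.01*y^2)^2 := by gcongr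
      nlinarith only [this, hy20, hn6, sq_nonneg y, mul_nonneg (sq_nonneg y) (sub_nonneg.2 hy20), (h.dd a).2.2]
    exact_mod_cast this
  have key := ct_bound hm hDΔ hΔM hab
  have key' : (2*m : ℝ)*∑ E ∈ GD n D, (ct E a b : ℝ) ≤ 4*Δ*(D a*D b)*NN n D := by unfold NN; exact_mod_cast key
  unfold avg
  rw [div_le_iff₀ h.hN]
  have hD1 : (D a : ℝ) ≤ 1.01*y^2 := by linarith [(h.dd a).2.1]
  have hD2 : (D b : ℝ) ≤ 1.01*y^2 := by linarith [(h.dd b).2.1]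
  have hN := h.hN
  have k1 : 4*(Δ:ℝ)*(D a*D b)*NN n D ≤ 4*(1.01*y^2)*((1.01*y^2)*(1.01*y^2))*NN n D := by gcongr
  have k2 : (2*m : ℝ)*(5*y^4 / n*NN n D) ≥ 4*(1.01*y^2)*((1.01*y^2)*(1.01*y^2))*NN n D := by
    rw [hmr]
    have : ((n:ℝ) - 1) / n ≥ 0.9 := by rw [ge_iff_le, le_div_iff₀ hn0]; linarith
    calc (n - 1)*y^2*(5*y^4 / n*NN n D) = ((n:ℝ) - 1) / n*(5*y^6*NN n D) := by ring
      _ ≥ 0.9*(5*y^6*NN n D) := by gcongr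
      _ ≥ _ := by
        have : 0 ≤ y^6*NN n D := by positivity
        nlinarith only [this]
  have hm0 : (0:ℝ) < 2*m := by
    rw [hmr]
    have : (0:ℝ) < n - 1 := by linarith
    positivity
  exact le_of_mul_le_mul_left (key'.trans (k1.trans k2)) hm0

lemma kap_low {n m : ℕ} {x y : ℝ} {D : Fin n → ℕ} (h : Env n m x y D) (hm : ∑ i, D i = 2*m) (hlow : y ≤ x^60) {a b : Fin n} (hab : a ≠ b) :
    |avg D (fun E => (ct E a b : ℝ)) - (D a + 1)*D b / n| ≤ 200*x^2*y^3 / n := by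
  have hx := h.hx
  have hx0 : 0 < x := by linarith
  have hn6 := h.n2
  have hn0 : (0:ℝ) < n := by linarith
  have hy0 := h.y0
  have hy6 := h.y6.1
  have hN := h.hN
  have key := kappa h hab (e1 := 21*y^2 / n) (e2 := 3*x*y^3 / n) (by positivity) ?_ ?_
  · refine key.trans ?_
    have : 20*x^2*y^2 / n + 2*(3*x*y^3 / n) + 8*x*y*(21*y^2 / n) = (20*(x^2*y^2) + 174*(x*y^3)) / n := by ring
    rw [this]
    gcongr
    have q1 : x^2*y^2 ≤ x^2*y^3 := by
      gcongr
      · linarith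
      · norm_num
    have q2 : x*y^3 ≤ x^2*y^3 := by
      gcongr
      nlinarith only [hx]
    have q3 : 0 ≤ x^2*y^3 := by positivity
    linarith
  · intro b' hb1 hb2
    have hbb : b ≠ b' := Ne.symm hb2
    set f := fun E => TT E a b b' / ((D b : ℝ) + D b' - 2*ct E b b') with hf
    set g := fun E => max 0 (f E - 2 / y^2*((ct E a b : ℝ) + ct E a b')) with hg
    have g1 : |avg D g| ≤ 0 + 1 / (n:ℝ)^10 := by
      refine avg_good h le_rfl zero_le_one ?_ ?_
      · intro E hE hgood
        have hs := h.sgood hgood hbb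
        have : f E ≤ 2 / y^2*((ct E a b : ℝ) + ct E a b') := by
          rw [hf]; dsimp only
          rw [div_le_iff₀ (by linarith [pow_pos hy0 2])]
          calc TT E a b b' ≤ ct E a b + ct E a b' := TT_le_ct _ _ _ _
            _ = 2 / y^2*((ct E a b : ℝ) + ct E a b')*(y^2 / 2) := by field_simp
            _ ≤ _ := by gcongr
        rw [hg]; dsimp only
        rw [max_eq_left (by linarith)]; simp
      · intro E hE
        obtain ⟨t1, t2⟩ := TTs_nonneg hE (a := a) hbb
        rw [hg]; dsimp only
        rw [abs_of_nonneg (le_max_left _ _)]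
        apply max_le (by norm_num)
        have : 0 ≤ 2 / y^2*((ct E a b : ℝ) + ct E a b') := by positivity
        rw [hf]; dsimp only; linarith
    have g2 : avg D f ≤ 2 / y^2*(avg D (fun E => (ct E a b : ℝ)) + avg D (fun E => (ct E a b' : ℝ))) + avg D g := by
      rw [← avg_add, ← avg_mul, ← avg_add]
      apply avg_mono
      intro E hE
      have := le_max_right 0 (f E - 2 / y^2*((ct E a b : ℝ) + ct E a b'))
      rw [hg]; dsimp only; linarith
    have g3 : 0 ≤ avg D f := by
      rw [← avg_const hN 0]; exact avg_mono fun E hE => (TTs_nonneg hE hbb).1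
    have k1 := kap_le h hm hlow hab
    have k2 := kap_le h hm hlow (Ne.symm hb1)
    have g4 : 2 / y^2*(avg D (fun E => (ct E a b : ℝ)) + avg D (fun E => (ct E a b' : ℝ))) ≤ 20*y^2 / n := by
      calc _ ≤ 2 / y^2*(5*y^4 / n + 5*y^4 / n) := by gcongr
        _ = _ := by field_simp; ring
    have g5 := (le_abs_self _).trans g1
    have g6 := h.n10
    have g7 : 1 / (n:ℝ) ≤ y^2 / n := by
      gcongr
      nlinarith only [hy6]
    have g8 : 1 / (n:ℝ)^10 ≤ 2 / (n:ℝ)^10 := by gcongr; norm_num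
    have e1 : 20*y^2 / (n:ℝ) = 20*(y^2 / n) := by ring
    have e2 : 21*y^2 / (n:ℝ) = 21*(y^2 / n) := by ring
    rw [e1] at g4
    rw [e2, abs_le]
    constructor <;> linarith
  · rw [show (n:ℝ)*(3*x*y^3 / n) = 3*x*y^3 by field_simp]
    have hall : ∀ E ∈ GD n D, |∑ v, Iv (s(a, v) ∈ E)*((D v : ℝ) - y^2)| ≤ 3*x*y^3 := by
      intro E hE
      calc |∑ v, Iv (s(a, v) ∈ E)*((D v : ℝ) - y^2)| ≤ ∑ v, |Iv (s(a, v) ∈ E)*((D v : ℝ) - y^2)| := abs_sum_le_sum_abs _ _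
        _ ≤ ∑ v, Iv (s(a, v) ∈ E)*(2*x*y) := by
          refine sum_le_sum fun v _ => ?_
          rw [abs_mul, abs_of_nonneg (Iv_nonneg _)]
          exact mll (h.hd v) (Iv_nonneg _)
        _ = D a*(2*x*y) := by rw [← sum_mul, sum_adj hE]
        _ ≤ (1.01*y^2)*(2*x*y) := by
          gcongr
          linarith [(h.dd a).2.1]
        _ ≤ _ := by
          have : 0 ≤ x*y^3 := by positivity
          nlinarith only [this]
    rw [abs_le]
    constructor
    · rw [← avg_const hN (-(3*x*y^3))]; exact avg_mono fun E hE => (abs_le.1 (hall E hE)).1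
    · conv_rhs => rw [← avg_const hN (3*x*y^3)]
      exact avg_mono fun E hE => (abs_le.1 (hall E hE)).2

lemma tts_real {n x y w p TT s X1 X2 X3 : ℝ} (hx : 1 ≤ x) (hy : 1 ≤ y) (hn : 0 < n) (hw : 1 ≤ w) (hwy : y^3 / n ≤ w)
    (hp : p = y^2 / n) (hp1 : p ≤ 1) (h1 : |X1 - y^4 / n| ≤ x*w) (h2 : |X2 - y^4 / n| ≤ x*w) (h3 : |X3 - y^6 / n^2| ≤ x*w)
    (hT : |TT - (X1 + X2 - 2*X3)| ≤ 2) (hs : |s - (2*y^2 - 2*(y^4 / n))| ≤ 4*x*y + 4*x*w) (hs2 : y^2 / 2 ≤ s) :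
    |TT / s - p| ≤ 28*x*w / y^2 := by
  have hs0 : 0 < s := by nlinarith
  have hp0 : 0 ≤ p := by rw [hp]; positivity
  have e : TT / s - p = (TT - p*s) / s := by field_simp
  have e4 : y^4 / n = p*y^2 := by rw [hp]; ring
  have e6 : y^6 / n^2 = p^2*y^2 := by rw [hp]; ring
  have e3 : p*y = y^3 / n := by rw [hp]; ring
  rw [e4] at h1 h2 hs
  rw [e6] at h3
  have hxw : 1 ≤ x*w := one_le_mul_of_one_le_of_one_le hx hw
  have hsp : |p*(s - (2*y^2 - 2*(p*y^2)))| ≤ 8*(x*w) := by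
    rw [abs_mul, abs_of_nonneg hp0]
    calc p*|s - (2*y^2 - 2*(p*y^2))| ≤ p*(4*x*y + 4*x*w) := by gcongr
      _ = 4*x*(p*y) + p*(4*x*w) := by ring
      _ ≤ 4*x*w + 1*(4*x*w) := by
        rw [e3]
        gcongr
      _ = _ := by ring
  have main : |TT - p*s| ≤ 14*(x*w) := by
    have : TT - p*s = (TT - (X1 + X2 - 2*X3)) + (X1 - p*y^2) + (X2 - p*y^2) - 2*(X3 - p^2*y^2) - p*(s - (2*y^2 - 2*(p*y^2))) := by ring
    rw [this]
    rw [abs_le] at *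
    constructor <;> linarith
  rw [e, abs_div, abs_of_pos hs0, div_le_iff₀ hs0]
  refine main.trans ?_
  calc 14*(x*w) = 28*x*w / y^2*(y^2 / 2) := by field_simp; ring
    _ ≤ _ := by gcongr

lemma e1_high {n m : ℕ} {x y : ℝ} {D : Fin n → ℕ} (h : Env n m x y D) {a b b' : Fin n} (hab : a ≠ b) (hab' : a ≠ b') (hbb : b ≠ b') :
    |avg D (fun E => TT E a b b' / ((D b : ℝ) + D b' - 2*ct E b b')) - y^2 / n| ≤ 29*x*(y^2 / x^100 + 1) / y^2 := by
  have hx := h.hx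
  have hx0 : 0 < x := by linarith
  have hn6 := h.n2
  have hn0 : (0:ℝ) < n := by linarith
  have hy0 := h.y0
  have hy6 := h.y6.1
  have hN := h.hN
  set w := y^2 / x^100 + 1 with hw
  have hw1 : 1 ≤ w := by
    have : 0 ≤ y^2 / x^100 := by positivity
    linarith
  have hp1 : y^2 / n ≤ 1 := by rw [div_le_one hn0]; linarith [h.hyn, sq_nonneg y]
  have hp0 : 0 ≤ y^2 / n := by positivity
  have hwy : y^3 / n ≤ w := by
    have : y^3 / n ≤ y^2 / x^100 := by
      rw [div_le_div_iff₀ hn0 (by positivity), h.hn]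
      calc y^3*x^100 = y^2*(y*x^100) := by ring
        _ ≤ y^2*(x^100*x^100) := by gcongr; exact h.yz
        _ = _ := by ring
    linarith
  have key := avg_good h (f := fun E => TT E a b b' / ((D b : ℝ) + D b' - 2*ct E b b') - y^2 / n) (e := 28*x*w / y^2) (B := 1) (by positivity) zero_le_one ?_ ?_
  · rw [avg_sub, avg_const hN] at key
    refine key.trans ?_
    have q1 : 1 / (n:ℝ)^10 ≤ 2 / (n:ℝ)^10 := by gcongr; norm_num
    have q2 := h.n10
    have q3 : 1 / (n:ℝ) ≤ 1*x*w / y^2 := by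
      rw [div_le_div_iff₀ hn0 (by positivity)]
      have : 1 ≤ x*w := one_le_mul_of_one_le_of_one_le (by linarith) hw1
      nlinarith only [this, h.hyn, hn0, sq_nonneg y]
    have q4 : 29*x*w / y^2 = 28*x*w / y^2 + 1*x*w / y^2 := by ring
    linarith
  · intro E hE hg
    refine tts_real (n := n) (by linarith) (by linarith) hn0 hw1 hwy rfl hp1 (h.two hg hab) (h.two hg hab') (h.three hg hab hab' hbb) (TT_XA hE hbb) ?_ (h.sgood hg hbb)
    have c1 := abs_le.1 (h.ctg hg hbb)
    have c2 := abs_le.1 (h.hd b)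
    have c3 := abs_le.1 (h.hd b')
    rw [abs_le]; constructor <;> linarith
  · intro E hE
    obtain ⟨t1, t2⟩ := TTs_nonneg hE (a := a) hbb
    rw [abs_le]; constructor <;> linarith

lemma e2_high {n m : ℕ} {x y : ℝ} {D : Fin n → ℕ} (h : Env n m x y D) {a b : Fin n} (hab : a ≠ b) :
    |avg D (fun E => ∑ v, Iv (s(a, v) ∈ E)*((D v : ℝ) - y^2))| ≤ n*(25*x^2) := by
  have hx := h.hx
  have hx0 : 0 < x := by linarith
  have hn6 := h.n2
  have hn0 : (0:ℝ) < n := by linarith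
  have hy0 := h.y0
  have hy6 := h.y6.1
  have hN := h.hN
  set P : Fin n → ℝ := fun v => avg D (fun E => Iv (s(a, v) ∈ E)) with hP
  have hPd : ∀ v ∈ univ.erase a, |P v - P b| ≤ 12*x / y := by
    intro v hv
    have hva : v ≠ a := (mem_erase.1 hv).1
    by_cases hvb : v = b
    · subst hvb; simp; positivity
    have k := P_diff (D := D) hvb (Ne.symm hva) hab
    have k' : P v - P b = ((D v : ℝ) - D b)*avg D (fun E => sI E v b a / ((D v : ℝ) + D b - 2*ct E v b)) := by
      rw [hP]; dsimp only
      rw [← avg_sub]; unfold avg; rw [k, mul_div_assoc]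
    rw [k', abs_mul]
    have b1 : |(D v : ℝ) - D b| ≤ 4*x*y := by
      have q1 := abs_le.1 (h.hd b)
      have q2 := abs_le.1 (h.hd v)
      rw [abs_le]; constructor <;> linarith
    have key := avg_good h (f := fun E => sI E v b a / ((D v : ℝ) + D b - 2*ct E v b)) (e := 2 / y^2) (B := 1) (by positivity) zero_le_one ?_ ?_
    · have q1 : 1 / (n:ℝ)^10 ≤ 2 / (n:ℝ)^10 := by gcongr; norm_num
      have q2 := h.n10
      have q3 : 1 / (n:ℝ) ≤ 1 / y^2 := by
        apply one_div_le_one_div_of_le (by positivity); linarith [h.hyn, sq_nonneg y]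
      have q4 : 2 / y^2 = 2*(1 / y^2) := by ring
      calc _ ≤ 4*x*y*(3*(1 / y^2)) := by
            apply mul_le_mul b1 _ (abs_nonneg _) (by positivity)
            linarith
        _ = _ := by field_simp; ring
    · intro E hE hg
      have hs := h.sgood hg hvb
      obtain ⟨t1, t2⟩ := sIs hE (a := a) hvb
      rw [abs_of_nonneg t1, div_le_iff₀ (by linarith [pow_pos hy0 2])]
      calc sI E v b a ≤ 1 := sI_le _ _ _ _
        _ = 2 / y^2*(y^2 / 2) := by field_simp
        _ ≤ _ := by gcongr
    · intro E hE
      obtain ⟨t1, t2⟩ := sIs hE (a := a) hvb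
      rw [abs_of_nonneg t1]; exact t2
  have e1 : avg D (fun E => ∑ v, Iv (s(a, v) ∈ E)*((D v : ℝ) - y^2)) = ∑ v ∈ univ.erase a, P v*((D v : ℝ) - y^2) := by
    have : ∀ E ∈ GD n D, ∑ v, Iv (s(a, v) ∈ E)*((D v : ℝ) - y^2) = ∑ v ∈ univ.erase a, ((D v : ℝ) - y^2)*Iv (s(a, v) ∈ E) := by
      intro E hE
      rw [← Finset.add_sum_erase _ _ (mem_univ a)]
      have hl := (mem_GD.1 hE).1 a
      simp only [Iv, hl, if_false, zero_mul, zero_add]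
      exact sum_congr rfl fun v _ => mul_comm _ _
    rw [avg_congr this, avg_sum]
    refine sum_congr rfl fun v _ => ?_
    rw [avg_mul, mul_comm]
  have e2 : ∑ v ∈ univ.erase a, P v*((D v : ℝ) - y^2) = -(P b*D a) + ∑ v ∈ univ.erase a, (P v - P b)*((D v : ℝ) - y^2) := by
    have : ∑ v ∈ univ.erase a, ((D v : ℝ) - y^2) = - D a := by
      rw [sum_sub_distrib, sum_const, card_erase_of_mem (mem_univ a), card_univ, Fintype.card_fin, nsmul_eq_mul,
        Finset.sum_erase_eq_sub (mem_univ a), h.hs]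
      have : 1 ≤ n := by exact_mod_cast (by linarith : (1:ℝ) ≤ n)
      push_cast [this]; ring
    rw [show -(P b*(D a : ℝ)) = P b*(-(D a : ℝ)) by ring, ← this, mul_sum, ← sum_add_distrib]
    exact sum_congr rfl fun v _ => by ring
  have hP0 : 0 ≤ P b := by
    rw [hP]; dsimp only; rw [← avg_const hN 0]; exact avg_mono fun E _ => Iv_nonneg _
  have hP1 : P b ≤ 1 := by
    rw [hP]; dsimp only; conv_rhs => rw [← avg_const hN 1]
    exact avg_mono fun E _ => Iv_le _
  rw [e1, e2]
  have t1 : |-(P b*(D a : ℝ))| ≤ n := by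
    rw [abs_neg, abs_of_nonneg (by positivity)]
    have := (h.dd a).2.1
    calc P b*(D a : ℝ) ≤ 1*D a := by gcongr
      _ ≤ n := by linarith [h.hyn, sq_nonneg y]
  have t2 : |∑ v ∈ univ.erase a, (P v - P b)*((D v : ℝ) - y^2)| ≤ n*(24*x^2) := by
    refine (abs_sum_le_sum_abs _ _).trans ?_
    have : ∀ v ∈ univ.erase a, |(P v - P b)*((D v : ℝ) - y^2)| ≤ 24*x^2 := by
      intro v hv
      rw [abs_mul]
      calc _ ≤ 12*x / y*(2*x*y) := mul_le_mul (hPd v hv) (h.hd v) (abs_nonneg _) (by positivity)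
        _ = _ := by field_simp; ring
    refine (sum_le_sum this).trans ?_
    rw [sum_const, card_erase_of_mem (mem_univ a), card_univ, Fintype.card_fin, nsmul_eq_mul]
    gcongr
    exact Nat.sub_le n 1
  have q : (n:ℝ) ≤ n*x^2 := by
    have : 1 ≤ x^2 := one_le_pow₀ (by linarith)
    nlinarith only [this, hn0]
  refine (abs_add_le _ _).trans ?_
  linarith

lemma kap_high {n m : ℕ} {x y : ℝ} {D : Fin n → ℕ} (h : Env n m x y D) {a b : Fin n} (hab : a ≠ b) :
    |avg D (fun E => (ct E a b : ℝ)) - (D a + 1)*D b / n| ≤ 600*x^2 := by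
  have hx := h.hx
  have hx0 : 0 < x := by linarith
  have hn6 := h.n2
  have hn0 : (0:ℝ) < n := by linarith
  have hy0 := h.y0
  have hy6 := h.y6.1
  refine (kappa h hab (e1 := 29*x*(y^2 / x^100 + 1) / y^2) (by positivity) (fun b' h1 h2 => e1_high h hab (Ne.symm h1) (Ne.symm h2)) (e2_high h hab)).trans ?_
  have q1 : y^2 / n ≤ 1 := by rw [div_le_one hn0]; linarith [h.hyn, sq_nonneg y]
  have q2 : (y^2 / x^100 + 1) / y ≤ 2 := by
    rw [div_le_iff₀ hy0]
    have : y^2 / x^100 ≤ y := by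
      rw [div_le_iff₀ (by positivity)]
      nlinarith only [h.yz, hy0]
    linarith
  have e : 20*x^2*y^2 / n + 2*(25*x^2) + 8*x*y*(29*x*(y^2 / x^100 + 1) / y^2) =
      x^2*(20*(y^2 / n) + 50 + 232*((y^2 / x^100 + 1) / y)) := by field_simp; ring
  rw [e, mul_comm 600]
  gcongr
  linarith

lemma R3_low {x y n M : ℝ} (hx : 10^6 ≤ x) (hnx : n = x^200) (hy : x^30 ≤ y) (hy2 : y ≤ x^60) (hM0 : 0 ≤ M) (hM : M ≤ n*y^2) :
    (180*x/y^3*(200*x^2*y^3/n+600*x^2*(y^2/n+1/y^2)))^2*M ≤ 1 / x^10 := by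
  have hx1 : 1 ≤ x := by linarith
  have hx0 : 0 < x := by linarith
  have hy1 : 1 ≤ y := le_trans (one_le_pow₀ hx1) hy
  have hy0 : 0 < y := by linarith
  have hn0 : 0 < n := by rw [hnx]; positivity
  have h1 : 180*x/y^3*(200*x^2*y^3/n+600*x^2*(y^2/n+1/y^2)) ≤ 2*10^5*x^3*(1 / n + 1 / y^5) := by
    have e : 180*x/y^3*(200*x^2*y^3/n+600*x^2*(y^2/n+1/y^2)) = x^3*(36000*(1 / n) + 108000*(1 / (y*n)) + 108000*(1 / y^5)) := by
      field_simp; ring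
    have e2 : 1 / (y*n) ≤ 1 / n := by
      apply one_div_le_one_div_of_le hn0; nlinarith only [hy1, hn0]
    have e3 : 0 < 1 / n := by positivity
    have e4 : 0 < 1 / y^5 := by positivity
    rw [e, show 2*10^5*x^3*(1 / n + 1 / y^5) = x^3*(200000*(1 / n) + 200000*(1 / y^5)) by ring]
    refine mll ?_ (by positivity)
    linarith only [e2, e3, e4]
  have h2 : y^2 / n ≤ 1 / x^40 := by
    rw [hnx, div_le_div_iff₀ (by positivity) (by positivity)]
    calc y^2*x^40 ≤ (x^60)^2*x^40 := by gcongr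
      _ = x^160 := by ring
      _ ≤ x^200 := pow_le_pow_right₀ hx1 (by norm_num)
      _ = _ := by ring
  have h3 : n / y^8 ≤ 1 / x^40 := by
    rw [hnx, div_le_div_iff₀ (by positivity) (by positivity)]
    calc x^200*x^40 = 1*(x^30)^8 := by ring
      _ ≤ _ := by gcongr
  calc _ ≤ (2*10^5*x^3*(1 / n + 1 / y^5))^2*(n*y^2) := by gcongr
    _ = 4*10^10*x^6*(1 / n + 1 / y^5)^2*(n*y^2) := by ring
    _ ≤ 4*10^10*x^6*(2*(1 / n)^2 + 2*(1 / y^5)^2)*(n*y^2) := by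
        gcongr
        nlinarith only [sq_nonneg (1 / n - 1 / y^5)]
    _ = 8*10^10*x^6*(y^2 / n + n / y^8) := by field_simp; ring
    _ ≤ 8*10^10*x^6*(1 / x^40 + 1 / x^40) := by gcongr
    _ = 16*10^10*x^6 / x^40 := by ring
    _ ≤ _ := by
        rw [div_le_div_iff₀ (by positivity) (by positivity)]
        calc 16*10^10*x^6*x^10 ≤ (10^6)^2*x^6*x^10 := by
              gcongr; norm_num
          _ ≤ x^2*x^6*x^10 := by gcongr
          _ = x^18 := by ring
          _ ≤ x^40 := pow_le_pow_right₀ hx1 (by norm_num)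
          _ = _ := by ring

lemma R3_high {x y n M : ℝ} (hx : 10^6 ≤ x) (hnx : n = x^200) (hy : x^60 ≤ y) (hy2 : 2*y^2 ≤ n) (hM0 : 0 ≤ M) (hM : M ≤ n*y^2) :
    (180*x/y^3*(600*x^2+600*x^2*(y^2/n+1/y^2)))^2*M ≤ 1 / x^10 := by
  have hx1 : 1 ≤ x := by linarith
  have hx0 : 0 < x := by linarith
  have hy1 : 1 ≤ y := le_trans (one_le_pow₀ hx1) hy
  have hy0 : 0 < y := by linarith
  have hn0 : 0 < n := by rw [hnx]; positivity
  have h1 : 180*x/y^3*(600*x^2+600*x^2*(y^2/n+1/y^2)) ≤ 4*10^5*x^3 / y^3 := by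
    have e1 : y^2 / n ≤ 1 := by
      rw [div_le_one hn0]; nlinarith only [hy2, hy0]
    have e2 : 1 / y^2 ≤ 1 := by
      rw [div_le_one (by positivity)]; exact one_le_pow₀ hy1
    calc _ ≤ 180*x/y^3*(600*x^2+600*x^2*(1+1)) := by gcongr
      _ = 324000*x^3 / y^3 := by ring
      _ ≤ _ := by gcongr; norm_num
  have h3 : n / y^4 ≤ 1 / x^40 := by
    rw [hnx, div_le_div_iff₀ (by positivity) (by positivity)]
    calc x^200*x^40 = 1*(x^60)^4 := by ring
      _ ≤ _ := by gcongr
  calc _ ≤ (4*10^5*x^3 / y^3)^2*(n*y^2) := by gcongr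
    _ = 16*10^10*x^6*(n / y^4) := by field_simp; ring
    _ ≤ 16*10^10*x^6*(1 / x^40) := by gcongr
    _ = 16*10^10*x^6 / x^40 := by ring
    _ ≤ _ := by
        rw [div_le_div_iff₀ (by positivity) (by positivity)]
        calc 16*10^10*x^6*x^10 ≤ (10^6)^2*x^6*x^10 := by
              gcongr; norm_num
          _ ≤ x^2*x^6*x^10 := by gcongr
          _ = x^18 := by ring
          _ ≤ x^40 := pow_le_pow_right₀ hx1 (by norm_num)
          _ = _ := by ring

open scoped Classical in
lemma DDg_Env {n m : ℕ} {x y : ℝ} (hx : 10^6 ≤ x) (hxdef : x = (n:ℝ)^(1/200:ℝ)) (hnx : (n:ℝ) = x^200)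
    (hy : x^30 ≤ y) (hy2 : 2*y^2 ≤ n) (hd : (n:ℝ)*((m:ℝ) / n.choose 2) = y^2) (hn2 : 2 ≤ n)
    {D : Fin n → ℕ} (hD : D ∈ DDg n m) (hs : ∑ i, D i = 2*m) : Env n m x y D := by
  have hx1 : 1 ≤ x := by linarith
  have hx0 : 0 < x := by linarith
  have hy1 : 1 ≤ y := le_trans (one_le_pow₀ hx1) hy
  have hnr : (2:ℝ) ≤ n := by exact_mod_cast hn2
  have hD' := hD
  simp only [DDg, Set.mem_ofPred_eq, ← hxdef] at hD'
  refine ⟨hx, hnx, hy, hy2, hd, ?_, ?_, ?_, ?_⟩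
  · have h1 : (∑ v, (D v : ℝ)) = 2*m := by exact_mod_cast hs
    rw [h1, ← hd, d_eq hn2]
    have : (n:ℝ) - 1 ≠ 0 := by linarith
    field_simp
  · intro v
    have h1 := DDg_deg (by omega) hD v
    rw [hd, ← hxdef, Real.sqrt_sq (by linarith)] at h1
    refine h1.le.trans ?_
    nlinarith only [hy1, hx0]
  · refine lt_of_le_of_lt ?_ hD'
    exact mul_nonneg (Nat.cast_nonneg _) (pow_nonneg (Nat.cast_nonneg _) _)
  · exact hD'.le

lemma R3 (c θ : ℝ) (hc : 0 < c) (hθ : 0 < θ) (hθ1 : θ ≤ 1) : ∀ᶠ n : ℕ in Filter.atTop, ∀ m : ℕ,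
    (n:ℝ)^(13/10:ℝ) ≤ 2*m → 2*m ≤ n.choose 2 → Intf n m c θ := by
  filter_upwards [crit_asym c θ hc hθ hθ1, xlarge (10^6), Filter.eventually_ge_atTop 2] with n hcr hx hn2 m hm1 hm2
  set x := (n:ℝ)^(1/200:ℝ) with hxdef
  have hnx : (n:ℝ) = x^200 := by rw [hxdef, xpow]; norm_num
  have h260 : x^260 ≤ 2*m := by rw [hxdef, xpow]; refine le_trans (le_of_eq ?_) hm1; norm_num
  have hx1 : 1 ≤ x := by linarith
  have hx0 : 0 < x := by linarith
  have hnr : (2:ℝ) ≤ n := by exact_mod_cast hn2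
  have hM0 : (0:ℝ) < 2*m := lt_of_lt_of_le (by positivity) h260
  have hmpos : 1 ≤ m := by
    by_contra h
    have : m = 0 := by omega
    rw [this] at hM0; simp at hM0
  have hmN : m < n.choose 2 := by omega
  have hd0 : 0 ≤ (n:ℝ)*((m:ℝ) / n.choose 2) := by positivity
  set y := Real.sqrt ((n:ℝ)*((m:ℝ) / n.choose 2)) with hydef
  have hyy : (n:ℝ)*((m:ℝ) / n.choose 2) = y^2 := (Real.sq_sqrt hd0).symm
  have hy0 : 0 ≤ y := Real.sqrt_nonneg _
  have hn10 : (0:ℝ) < (n:ℝ) - 1 := by linarith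
  have hMy : 2*(m:ℝ) = (n - 1)*y^2 := by
    rw [← hyy, d_eq hn2]; field_simp
  have hy : x^30 ≤ y := by
    refine le_of_sq_le_sq ?_ hy0
    rw [← hyy, d_eq hn2, le_div_iff₀ hn10]
    calc (x^30)^2*((n:ℝ) - 1) ≤ (x^30)^2*n := by gcongr; linarith
      _ = x^260 := by rw [hnx]; ring
      _ ≤ _ := h260
  have hy2 : 2*y^2 ≤ n := by
    have hC : (0:ℝ) < n.choose 2 := by
      have : 0 < n.choose 2 := by omega
      exact_mod_cast this
    have h1 : (2:ℝ)*m ≤ n.choose 2 := by exact_mod_cast hm2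
    rw [← hyy]
    have : 2*((n:ℝ)*((m:ℝ) / n.choose 2)) = n*(2*m / n.choose 2) := by ring
    rw [this]
    have : 2*(m:ℝ) / n.choose 2 ≤ 1 := by rw [div_le_one hC]; exact h1
    nlinarith only [this, hnr]
  have hy1 : 0 < y := lt_of_lt_of_le (by positivity) hy
  have hMn : 2*(m:ℝ) ≤ n*y^2 := by rw [hMy]; nlinarith only [sq_nonneg y]
  have e1 : (n:ℝ)^(-(1/20:ℝ)) = 1 / x^10 := by
    rw [hxdef, xpow, Real.rpow_neg (by positivity), one_div]; norm_num
  have hn0 : (0:ℝ) < n := by linarith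
  have hsum : ∀ T ∈ Wt n (2*m - 1), ∀ b, ∑ i, up T b i = 2*m := by
    intro T hT b
    have := up_mem hT b
    rw [mem_Wt] at this
    omega
  rcases le_total y (x^60) with hl | hl
  · have hδ0 : 0 ≤ 180*x/y^3*(200*x^2*y^3/n+600*x^2*(y^2/n+1/y^2)) := by positivity
    refine hcr m (DDg n m) _ hmpos hmN.le hδ0 ?_ ?_ (nuc_DDg hmN)
    · apply Hyp_of _ _ hδ0
      intro T hT a b hab ha hb hDD
      have hE := DDg_Env hx hxdef hnx hy hy2 hyy hn2 hDD (hsum T hT b)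
      exact r3_step hab hE ha hb (kap_low hE (hsum T hT b) hl hab)
    · rw [e1]; exact R3_low hx hnx hy hl hM0.le hMn
  · have hδ0 : 0 ≤ 180*x/y^3*(600*x^2+600*x^2*(y^2/n+1/y^2)) := by positivity
    refine hcr m (DDg n m) _ hmpos hmN.le hδ0 ?_ ?_ (nuc_DDg hmN)
    · apply Hyp_of _ _ hδ0
      intro T hT a b hab ha hb hDD
      have hE := DDg_Env hx hxdef hnx hy hy2 hyy hn2 hDD (hsum T hT b)
      exact r3_step hab hE ha hb (kap_high hE hab)
    · rw [e1]; exact R3_high hx hnx hl hy2 hM0.le hMn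

lemma move_zero {n m : ℕ} {T : Fin n → ℕ} {a b : Fin n} (hab : a ≠ b) (hTa : T a = 0) (ha : 0 < rr T a) (hb : 0 < rr T b) :
    ff n m (up T b)*rr T b ≤ ff n m (up T a)*rr T a := by
  obtain ⟨C, hC, hCe⟩ := ff_up (m := m) T
  have xa : xx T a*rr T a = NN n (up T a)*(T a + 1) := by unfold xx; field_simp
  have xb : xx T b*rr T b = NN n (up T b)*(T b + 1) := by unfold xx; field_simp
  rw [hCe a ha, hCe b hb, mul_assoc, mul_assoc, xa, xb]
  refine mll ?_ hC
  have hmove := move T hab (fun _ => 1)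
  simp only [one_mul, sum_sub_distrib, sum_const, nsmul_eq_mul] at hmove
  have h1 : ∑ E ∈ GD n (up T b), (ct E a b : ℝ) = 0 := by
    refine sum_eq_zero fun E hE => ?_
    have := ct_le hE hab
    rw [up_apply, if_neg hab, hTa] at this
    refine le_antisymm (by simpa using this) (by positivity)
  have h2 : (0:ℝ) ≤ ∑ E ∈ GD n (up T a), (ct E a b : ℝ) := sum_nonneg fun _ _ => by positivity
  unfold NN
  linarith

def exc {n : ℕ} (D : Fin n → ℕ) : ℕ := ∑ i, (D i - 1)

lemma exc_up {n : ℕ} (T : Fin n → ℕ) (a : Fin n) : exc (up T a) = exc T + if T a = 0 then 0 else 1 := by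
  unfold exc
  rw [← Finset.add_sum_erase _ _ (mem_univ a), ← Finset.add_sum_erase _ (fun i => T i - 1) (mem_univ a)]
  have : ∑ x ∈ univ.erase a, (up T a x - 1) = ∑ x ∈ univ.erase a, (T x - 1) := by
    refine sum_congr rfl fun x hx => ?_
    rw [up_apply, if_neg (ne_of_mem_erase hx)]; rfl
  rw [this, up_apply, if_pos rfl]
  split_ifs <;> omega

lemma exc_le {n : ℕ} (D : Fin n → ℕ) (i : Fin n) : D i ≤ exc D + 1 := by
  have : D i - 1 ≤ exc D := single_le_sum (f := fun i => D i - 1) (fun _ _ => Nat.zero_le _) (mem_univ i)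
  omega

lemma down {n : ℕ} (D : Fin n → ℕ) (b : Fin n) (hb : 1 ≤ D b) : ∃ T, D = up T b := by
  refine ⟨D - Pi.single b 1, ?_⟩
  funext i
  rw [up_apply]
  by_cases h : i = b
  · subst h; simp; omega
  · simp [h]

lemma up_sum {n : ℕ} (T : Fin n → ℕ) (a : Fin n) : ∑ i, up T a i = ∑ i, T i + 1 := by
  simp [up_apply, sum_add_distrib]

lemma rr_zero {n : ℕ} {T : Fin n → ℕ} {a : Fin n} (h : T a = 0) : rr T a = (n:ℝ) - 1 := by
  unfold rr; rw [h]; simp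

lemma zero_const {n m : ℕ} (hn : 2 ≤ n) : ∀ (k : ℕ) (D D' : Fin n → ℕ), (univ.filter fun i => D i < D' i).card = k →
    ∑ i, D i = ∑ i, D' i → exc D = 0 → exc D' = 0 → ff n m D = ff n m D' := by
  have hnr : (2:ℝ) ≤ n := by exact_mod_cast hn
  intro k
  induction k with
  | zero =>
    intro D D' h hs _ _
    have h1 : ∀ i ∈ univ, D' i ≤ D i := by
      intro i _
      by_contra hc
      have : i ∈ (univ.filter fun i => D i < D' i) := by simp; omega
      rw [card_eq_zero] at h
      rw [h] at this; simp at this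
    have := (Finset.sum_eq_sum_iff_of_le h1).1 hs.symm
    have : D = D' := funext fun i => (this i (mem_univ i)).symm
    rw [this]
  | succ k ih =>
    intro D D' h hs h0 h0'
    have hne : (univ.filter fun i => D i < D' i).Nonempty := by rw [← card_pos]; omega
    obtain ⟨a, ha⟩ := hne
    have ha' : D a < D' a := by simpa using ha
    obtain ⟨b, hb⟩ : ∃ b, D' b < D b := by
      by_contra hc
      push Not at hc
      have := Finset.sum_lt_sum (s := univ) (fun i _ => hc i) ⟨a, mem_univ a, ha'⟩
      omega
    have l1 := exc_le D' a
    have l2 := exc_le D b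
    have hab : a ≠ b := by rintro rfl; omega
    obtain ⟨T, rfl⟩ := down D b (by omega)
    have hTa : T a = 0 := by rw [up_apply, if_neg hab] at ha'; omega
    have hTb : T b = 0 := by
      have : up T b b ≤ 1 := by omega
      rw [up_apply, if_pos rfl] at this; omega
    have ra := rr_zero hTa
    have rb := rr_zero hTb
    have p : (0:ℝ) < (n:ℝ) - 1 := by linarith
    have q1 := move_zero (m := m) hab hTa (by rw [ra]; exact p) (by rw [rb]; exact p)
    have q2 := move_zero (m := m) hab.symm hTb (by rw [rb]; exact p) (by rw [ra]; exact p)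
    rw [ra, rb] at q1 q2
    have q3 : ff n m (up T b) = ff n m (up T a) :=
      le_antisymm (le_of_mul_le_mul_right q1 p) (le_of_mul_le_mul_right q2 p)
    rw [q3]
    apply ih
    · have : (univ.filter fun i => up T a i < D' i) = (univ.filter fun i => up T b i < D' i).erase a := by
        ext i
        simp only [mem_filter, mem_univ, true_and, mem_erase, up_apply]
        by_cases hia : i = a
        · subst hia; simp; omega
        · by_cases hib : i = b
          · subst hib; simp [hia]; rw [up_apply, if_pos rfl] at hb; omega
          · simp [hia, hib]
      rw [this, card_erase_of_mem ha, h]; rfl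
    · rw [up_sum]; rw [up_sum] at hs; exact hs
    · rw [exc_up, if_pos hTa]; rw [exc_up, if_pos hTb] at h0; exact h0
    · exact h0'

lemma exc_step {n : ℕ} {D : Fin n → ℕ} {k : ℕ} (hk : exc D = k + 1) (hs : ∑ i, D i < n) :
    ∃ T a b, a ≠ b ∧ D = up T b ∧ T a = 0 ∧ 1 ≤ T b ∧ exc (up T a) = k := by
  obtain ⟨b, hb⟩ : ∃ b, 2 ≤ D b := by
    by_contra hc
    push Not at hc
    have : exc D = 0 := sum_eq_zero fun i _ => by have := hc i; omega
    omega
  obtain ⟨a, ha⟩ : ∃ a, D a = 0 := by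
    by_contra hc
    push Not at hc
    have : ∑ i : Fin n, 1 ≤ ∑ i, D i := sum_le_sum fun i _ => by have := hc i; omega
    simp at this; omega
  have hab : a ≠ b := by rintro rfl; omega
  obtain ⟨T, rfl⟩ := down D b (by omega)
  rw [up_apply, if_neg hab] at ha
  rw [up_apply, if_pos rfl] at hb
  refine ⟨T, a, b, hab, rfl, by omega, by omega, ?_⟩
  rw [exc_up, if_neg (by omega)] at hk
  rw [exc_up, if_pos (by omega)]; omega

lemma exc_upper {n m : ℕ} (hn : 2*m + 2 ≤ n) {D0 : Fin n → ℕ} (hD0 : ∑ i, D0 i = 2*m) (h0 : exc D0 = 0) :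
    ∀ (k : ℕ) (D : Fin n → ℕ), exc D = k → ∑ i, D i = 2*m → ff n m D*(1 - 2*m / ((n:ℝ) - 1))^k ≤ ff n m D0 := by
  have hnr : (2:ℝ)*m + 2 ≤ n := by exact_mod_cast hn
  have hm0 : (0:ℝ) ≤ m := Nat.cast_nonneg m
  have p : (0:ℝ) < (n:ℝ) - 1 := by linarith
  intro k
  induction k with
  | zero => intro D h hs; rw [zero_const (by omega) _ D D0 rfl (by omega) h h0]; simp
  | succ k ih =>
    intro D h hs
    obtain ⟨T, a, b, hab, rfl, hTa, hTb, he⟩ := exc_step h (by omega)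
    have hs' : ∑ i, up T a i = 2*m := by rw [up_sum] at *; exact hs
    have ra := rr_zero hTa
    have rb : (n:ℝ) - 1 - 2*m ≤ rr T b := by
      have : up T b b ≤ ∑ i, up T b i := single_le_sum (fun _ _ => Nat.zero_le _) (mem_univ b)
      rw [up_apply, if_pos rfl, hs] at this
      have : (T b : ℝ) + 1 ≤ 2*m := by exact_mod_cast this
      unfold rr; linarith
    have q1 := move_zero (m := m) hab hTa (by rw [ra]; exact p) (by linarith)
    rw [ra] at q1
    have q2 := ih _ he hs'
    have e : 1 - 2*m / ((n:ℝ) - 1) = ((n:ℝ) - 1 - 2*m) / ((n:ℝ) - 1) := by field_simp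
    have e0 : 0 ≤ 1 - 2*m / ((n:ℝ) - 1) := by rw [e]; apply div_nonneg <;> linarith
    refine le_trans ?_ q2
    rw [pow_succ', ← mul_assoc]
    refine mlr ?_ (by positivity)
    rw [e, ← mul_div_assoc, div_le_iff₀ p]
    refine le_trans ?_ q1
    exact mll rb (ff_nonneg _ _ _)

lemma exc_lower {n m K : ℕ} (hm : 1 ≤ m) (hn : 2*m + 2 ≤ n) {D0 : Fin n → ℕ} (hD0 : ∑ i, D0 i = 2*m) (h0 : exc D0 = 0)
    (hK : 12*(K + 1)^2 ≤ 2*m) {δ : ℝ} (hδ : ((K + 1 : ℕ) : ℝ) / (n - 1) + 4*((K + 1 : ℕ) : ℝ)^2 / (2*m) = δ) (hδ1 : δ ≤ 1) :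
    ∀ (k : ℕ) (D : Fin n → ℕ), k ≤ K → exc D = k → ∑ i, D i = 2*m → ff n m D0*(1 - δ)^k ≤ ff n m D := by
  have hnr : (2:ℝ)*m + 2 ≤ n := by exact_mod_cast hn
  have hm0 : (0:ℝ) ≤ m := Nat.cast_nonneg m
  have p : (0:ℝ) < (n:ℝ) - 1 := by linarith
  intro k
  induction k with
  | zero => intro D _ h hs; rw [zero_const (by omega) _ D D0 rfl (by omega) h h0]; simp
  | succ k ih =>
    intro D hkK h hs
    obtain ⟨T, a, b, hab, rfl, hTa, hTb, he⟩ := exc_step h (by omega)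
    have hs' : ∑ i, up T a i = 2*m := by rw [up_sum] at *; exact hs
    have ra := rr_zero hTa
    have rb : (n:ℝ) - 1 - 2*m ≤ rr T b := by
      have : up T b b ≤ ∑ i, up T b i := single_le_sum (fun _ _ => Nat.zero_le _) (mem_univ b)
      rw [up_apply, if_pos rfl, hs] at this
      have : (T b : ℝ) + 1 ≤ 2*m := by exact_mod_cast this
      unfold rr; linarith
    have hra : 0 < rr T a := by rw [ra]; exact p
    have hrb : 0 < rr T b := by linarith
    have q1 := sparse_one (Δ := K + 1) hm (T := T) (by rw [mem_Wt]; rw [up_sum] at hs; omega) hab.symm hrb hra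
      (fun i => (exc_le _ i).trans (by omega)) hK (by omega)
    rw [hδ] at q1
    have q2 := ih _ (by omega) he hs'
    obtain ⟨C, hC, hCe⟩ := ff_up (m := m) T
    have q3 : ff n m (up T a)*(1 - δ) ≤ ff n m (up T b) := by
      rw [hCe a hra, hCe b hrb]
      have := mll q1 hC
      linarith
    calc _ = ff n m D0*(1 - δ)^k*(1 - δ) := by ring
      _ ≤ ff n m (up T a)*(1 - δ) := mlr q2 (by linarith)
      _ ≤ _ := q3

lemma exc_moment {n M0 : ℕ} (hn : 2 ≤ n) (hM0 : 2*M0 ≤ n) {z : ℝ} (hz : 0 ≤ z) : ∀ M, M ≤ M0 →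
    EE n M (fun D => z^exc D) ≤ (1 + 2*z*M0 / n)^M := by
  have hnr : (2:ℝ) ≤ n := by exact_mod_cast hn
  have hM0r : (2:ℝ)*M0 ≤ n := by exact_mod_cast hM0
  have hMn : ∀ M, M ≤ M0 → M < n*(n - 1) := by
    intro M h
    have : n*1 ≤ n*(n - 1) := Nat.mul_le_mul_left _ (by omega)
    omega
  intro M
  induction M with
  | zero =>
    intro _
    have : EE n 0 (fun D => z^exc D) = EE n 0 (fun _ => 1) := by
      apply EE_congr
      intro D hD
      have : exc D = 0 := by
        rw [mem_Wt, Finset.sum_eq_zero_iff] at hD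
        exact sum_eq_zero fun i _ => by rw [hD i (mem_univ i)]; rfl
      rw [this, pow_zero]
    rw [this, EE_const (Nat.zero_le _)]; simp
  | succ M ih =>
    intro hM
    have ih' := ih (by omega)
    have hlt := hMn M (by omega)
    rw [← EE_step' hlt]
    have hMr : (M:ℝ) + 1 ≤ M0 := by exact_mod_cast hM
    have hq : ∀ T : Fin n → ℕ, ∀ a, qq M T a ≤ 2 / n := by
      intro T a
      have h1 : rr T a ≤ (n:ℝ) - 1 := by unfold rr; linarith [Nat.cast_nonneg (α := ℝ) (T a)]
      have h2 : (0:ℝ) < n*(n - 1) - M := by nlinarith only [hnr, hM0r, hMr]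
      unfold qq
      rw [div_le_div_iff₀ h2 (by linarith)]
      nlinarith only [hnr, hM0r, hMr, h1]
    have step : EE n M (fun T => ∑ a, qq M T a*z^exc (up T a)) ≤ EE n M (fun T => (1 + 2*z*M0 / n)*z^exc T) := by
      apply EE_mono
      intro T hT hrr
      have hle : ∀ a, qq M T a*z^exc (up T a) ≤ z^exc T*(qq M T a + 2 / n*z*T a) := by
        intro a
        have hq0 := qq_nonneg hlt (hrr a)
        have hqa := hq T a
        rw [exc_up]
        have hze : 0 ≤ z^exc T := by positivity
        split_ifs with h
        · rw [h]; simp; linarith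
        · rw [pow_add, pow_one]
          have h1 : (1:ℝ) ≤ T a := by exact_mod_cast Nat.one_le_iff_ne_zero.2 h
          have h2 : qq M T a*z ≤ 2 / n*z*T a := by
            calc qq M T a*z ≤ 2 / n*z := mlr hqa hz
              _ ≤ _ := le_mul_of_one_le_right (by positivity) h1
          calc qq M T a*(z^exc T*z) = z^exc T*(qq M T a*z) := by ring
            _ ≤ _ := mll (by linarith) hze
      refine (sum_le_sum fun a _ => hle a).trans ?_
      rw [← mul_sum, sum_add_distrib, sum_qq hlt hT, ← mul_sum, mul_comm]
      have : ∑ i, (T i : ℝ) = M := by rw [mem_Wt] at hT; exact_mod_cast hT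
      rw [this]
      refine mlr ?_ (by positivity)
      have : 2*z*M0 / (n:ℝ) = 2 / n*z*M0 := by ring
      rw [this]
      have : 2 / n*z*M ≤ 2 / n*z*(M0:ℝ) := mll (by linarith) (by positivity)
      linarith
    refine step.trans ?_
    rw [EE_smul, pow_succ']
    exact mll ih' (by positivity)

lemma exc_tail {n m : ℕ} (hn : 2 ≤ n) (hM0 : 2*(2*m) ≤ n) {z : ℝ} (hz : 1 ≤ z) (hzm : z*(2*m)^2 ≤ n) (k : ℕ) :
    ∑ D ∈ (Wt n (2*m)).filter (fun D => k ≤ exc D), mu n m D ≤ 8 / z^k := by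
  have hz0 : 0 < z := by linarith
  have h1 := exc_moment hn hM0 hz0.le (2*m) le_rfl
  have hnr : (2:ℝ) ≤ n := by exact_mod_cast hn
  have h2 : (1 + 2*z*(2*m : ℕ) / (n:ℝ))^(2*m) ≤ 8 := by
    have a1 := Real.add_one_le_exp (2*z*(2*m : ℕ) / (n:ℝ))
    calc _ ≤ (Real.exp (2*z*(2*m : ℕ) / (n:ℝ)))^(2*m) := by
          apply pow_le_pow_left₀ (by positivity); linarith
      _ = Real.exp (2*(z*(2*m)^2 / n)) := by
          rw [← Real.exp_nat_mul]; congr 1; push_cast; ring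
      _ ≤ Real.exp 2 := by
          apply Real.exp_le_exp.2
          have : z*(2*m)^2 / n ≤ 1 := by rw [div_le_one (by linarith)]; exact hzm
          linarith
      _ = Real.exp 1^2 := by rw [← Real.exp_nat_mul]; norm_num
      _ ≤ 2.7182818286^2 := by
          apply pow_le_pow_left₀ (Real.exp_pos _).le Real.exp_one_lt_d9.le
      _ ≤ 8 := by norm_num
  rw [le_div_iff₀ (by positivity), sum_mul]
  refine le_trans ?_ (h1.trans h2)
  rw [EE_eq_mu]
  calc _ ≤ ∑ D ∈ (Wt n (2*m)).filter (fun D => k ≤ exc D), mu n m D*z^exc D := by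
        refine sum_le_sum fun D hD => ?_
        refine mll ?_ (mu_nonneg _ _ _)
        exact pow_le_pow_right₀ hz (mem_filter.1 hD).2
    _ ≤ _ := by
        apply sum_le_sum_of_subset_of_nonneg (filter_subset _ _)
        intro D _ _
        exact mul_nonneg (mu_nonneg _ _ _) (by positivity)

lemma R1_core {n m K : ℕ} {c θ z : ℝ} (hθ : 0 < θ) (hθ1 : θ ≤ 1) (hm : 1 ≤ m) (hn : 2*(2*m) ≤ n) (hz : 16 ≤ z)
    (hzm : z*(2*m)^2 ≤ n) (hK : 12*(K + 1)^2 ≤ 2*m)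
    (hδ : K*(((K + 1 : ℕ) : ℝ) / (n - 1) + 4*((K + 1 : ℕ) : ℝ)^2 / (2*m)) ≤ θ)
    (hδ1 : ((K + 1 : ℕ) : ℝ) / (n - 1) + 4*((K + 1 : ℕ) : ℝ)^2 / (2*m) ≤ 1)
    (hs1 : (2*m)*(2*m / ((n:ℝ) - 1)) ≤ 1 / 4) (hs2 : K*(2*m / ((n:ℝ) - 1)) ≤ θ / 4)
    (hc : 32 / z^(K + 1) ≤ (n:ℝ)^(-c)) : Intf n m c θ := by
  have hnr : (2:ℝ)*(2*m) ≤ n := by exact_mod_cast hn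
  have hmr : (1:ℝ) ≤ m := by exact_mod_cast hm
  have hA : 2*m ≤ n*(n - 1) := by
    have : n*1 ≤ n*(n - 1) := Nat.mul_le_mul_left _ (by omega)
    omega
  have hN : m ≤ n.choose 2 := by
    have h := two_choose_real n
    have : (m:ℝ) ≤ n.choose 2 := by nlinarith only [h, hnr, hmr]
    exact_mod_cast this
  have hmu := sum_mu hA
  have hnu := sum_nu hN
  have t0 := exc_tail (by omega) hn (by linarith) hzm 1
  have tK := exc_tail (by omega) hn (by linarith) hzm (K + 1)
  set s := 2*m / ((n:ℝ) - 1) with hs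
  have p : (0:ℝ) < (n:ℝ) - 1 := by linarith
  have s0 : 0 ≤ s := by positivity
  have s1 : s ≤ 1 := by nlinarith only [hs1, s0, hmr]
  have hz2 : 8 / z^1 ≤ 1 / 2 := by rw [pow_one, div_le_iff₀ (by linarith)]; linarith
  have hzero : 1 / 2 ≤ ∑ D ∈ (Wt n (2*m)).filter (fun D => ¬ 1 ≤ exc D), mu n m D := by
    have := Finset.sum_filter_add_sum_filter_not (Wt n (2*m)) (fun D => 1 ≤ exc D) (mu n m)
    linarith
  obtain ⟨D0, hD0⟩ : ((Wt n (2*m)).filter (fun D => ¬ 1 ≤ exc D)).Nonempty := by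
    by_contra h
    rw [not_nonempty_iff_eq_empty] at h
    rw [h, sum_empty] at hzero; linarith
  simp only [mem_filter, mem_Wt] at hD0
  have e0 : exc D0 = 0 := by omega
  set f0 := ff n m D0 with hf0
  have up1 := exc_upper (by omega) hD0.1 e0
  have lo1 := exc_lower hm (by omega) hD0.1 e0 hK rfl hδ1
  rw [← hs, ← hf0] at up1
  set δ := ((K + 1 : ℕ) : ℝ) / ((n:ℝ) - 1) + 4*((K + 1 : ℕ) : ℝ)^2 / (2*m) with hδd
  have δ0 : 0 ≤ δ := by positivity
  rw [← hf0] at lo1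
  have f00 : 0 ≤ f0 := ff_nonneg _ _ _
  have bern : ∀ k : ℕ, 1 - k*s ≤ (1 - s)^k := by
    intro k
    have := one_add_mul_le_pow (a := -s) (by linarith) k
    rw [← sub_eq_add_neg] at this
    linarith
  have excle : ∀ D ∈ Wt n (2*m), exc D ≤ 2*m := by
    intro D hD
    rw [mem_Wt] at hD; rw [← hD]
    exact sum_le_sum fun i _ => by omega
  have hff : ∀ D ∈ Wt n (2*m), nu n m D ≤ 2*f0*mu n m D := by
    intro D hD
    have h1 := up1 _ D rfl (mem_Wt.1 hD)
    have h2 := bern (exc D)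
    have h3 : (exc D : ℝ) ≤ 2*m := by exact_mod_cast excle D hD
    have h4 : (exc D : ℝ)*s ≤ 2*m*s := mlr h3 s0
    have h5 : 1 / 2 ≤ (1 - s)^exc D := by linarith
    have h6 := mll h5 (ff_nonneg n m D)
    rw [← mu_ff D hA, mul_comm]
    refine mlr (by linarith) (mu_nonneg _ _ _)
  have f0pos : 0 < f0 := by
    have := sum_le_sum hff
    rw [← mul_sum, hmu, hnu] at this
    linarith
  have f02 : f0 ≤ 2 := by
    have h1 : ∑ D ∈ (Wt n (2*m)).filter (fun D => ¬ 1 ≤ exc D), nu n m D ≤ 1 := by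
      rw [← hnu]
      exact sum_le_sum_of_subset_of_nonneg (filter_subset _ _) fun _ _ _ => nu_nonneg _ _ _
    have h2 : ∑ D ∈ (Wt n (2*m)).filter (fun D => ¬ 1 ≤ exc D), nu n m D = f0*∑ D ∈ (Wt n (2*m)).filter (fun D => ¬ 1 ≤ exc D), mu n m D := by
      rw [mul_sum]
      refine sum_congr rfl fun D hD => ?_
      simp only [mem_filter, mem_Wt] at hD
      rw [← mu_ff D hA, zero_const (by omega) _ D D0 rfl (by omega) (by omega) e0, mul_comm]
    rw [h2] at h1
    have h3 := mll hzero f00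
    linarith
  have hsd : Wt n (2*m) \ (Wt n (2*m)).filter (fun D => exc D ≤ K) = (Wt n (2*m)).filter (fun D => K + 1 ≤ exc D) := by
    ext D; simp only [mem_sdiff, mem_filter]; constructor
    · rintro ⟨h1, h2⟩; exact ⟨h1, by by_contra h; exact h2 ⟨h1, by omega⟩⟩
    · rintro ⟨h1, h2⟩; exact ⟨h1, fun h => by omega⟩
  have hzp : (0:ℝ) < 8 / z^(K + 1) := by
    have : 0 < z := by linarith
    positivity
  have hz32 : 32 / z^(K + 1) = 4*(8 / z^(K + 1)) := by ring
  refine ⟨(Wt n (2*m)).filter (fun D => exc D ≤ K), f0, filter_subset _ _, f0pos, ?_, ?_, ?_⟩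
  · intro D hD
    simp only [mem_filter, mem_Wt] at hD
    have hmu0 := mu_nonneg n m D
    have hkK : (exc D : ℝ) ≤ K := by exact_mod_cast hD.2
    rw [← mu_ff D hA]
    constructor
    · have h1 := lo1 _ D hD.2 rfl hD.1
      have h2 : 1 - θ ≤ (1 - δ)^exc D := by
        have := one_add_mul_le_pow (a := -δ) (by linarith) (exc D)
        rw [← sub_eq_add_neg] at this
        have h3 : (exc D : ℝ)*δ ≤ K*δ := mlr hkK δ0
        linarith
      have h3 := mll h2 f00
      rw [mul_comm (mu n m D)]
      refine mlr (by linarith) hmu0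
    · have h1 := up1 _ D rfl hD.1
      have h2 := bern (exc D)
      have h4 : (exc D : ℝ)*s ≤ K*s := mlr hkK s0
      have h5 : 1 - θ / 4 ≤ (1 - s)^exc D := by linarith
      have h6 := mll h5 (ff_nonneg n m D)
      have h7 : ff n m D*(1 - θ / 4) ≤ f0 := h6.trans h1
      rw [mul_comm (mu n m D)]
      refine mlr ?_ hmu0
      have hf := ff_nonneg n m D
      have h8 : ff n m D*1 ≤ ff n m D*((1 - θ / 4)*(1 + θ)) :=
        mll (by nlinarith only [hθ, hθ1]) hf
      have h9 := mlr h7 (by linarith : (0:ℝ) ≤ 1 + θ)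
      linarith
  · rw [hsd]; linarith
  · rw [hsd]
    calc _ ≤ ∑ D ∈ (Wt n (2*m)).filter (fun D => K + 1 ≤ exc D), 2*f0*mu n m D :=
          sum_le_sum fun D hD => hff D (mem_filter.1 hD).1
      _ = 2*f0*∑ D ∈ (Wt n (2*m)).filter (fun D => K + 1 ≤ exc D), mu n m D := by rw [mul_sum]
      _ ≤ 2*f0*(8 / z^(K + 1)) := mll tK (by linarith)
      _ ≤ 4*(8 / z^(K + 1)) := mlr (by linarith) hzp.le
      _ ≤ _ := by linarith

lemma R1 (c θ : ℝ) (hc : 0 < c) (hθ : 0 < θ) (hθ1 : θ ≤ 1) : ∃ m0 : ℕ, ∀ᶠ n : ℕ in Filter.atTop, ∀ m : ℕ,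
    m0 ≤ m → 2*m ≤ (n:ℝ)^(2/5:ℝ) → Intf n m c θ := by
  set K : ℕ := ⌈5*(c + 1)⌉₊ with hKd
  have hK5 : 5*(c + 1) ≤ K := Nat.le_ceil _
  refine ⟨6*(K + 1)^2 + ⌈6*((K:ℝ) + 1)^3 / θ⌉₊, ?_⟩
  filter_upwards [xlarge 32, xlarge (32*(K + 1) / θ), Filter.eventually_ge_atTop 2] with n hx1 hx2 hn2 m hm hm2
  set x := (n:ℝ)^(1/200:ℝ) with hxdef
  have hnx : (n:ℝ) = x^200 := by rw [hxdef, xpow]; norm_num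
  have h80 : 2*m ≤ x^80 := by rw [hxdef, xpow]; refine hm2.trans (le_of_eq ?_); norm_num
  have hnr : (2:ℝ) ≤ n := by exact_mod_cast hn2
  have x1 : 1 ≤ x := by linarith
  have x0 : 0 < x := by linarith
  have hm6 : 6*(K + 1)^2 ≤ m := by omega
  have hmK : 6*((K:ℝ) + 1)^3 ≤ θ*m := by
    have h1 : 6*((K:ℝ) + 1)^3 / θ ≤ m := (Nat.le_ceil _).trans (Nat.cast_le.2 (by omega))
    rw [div_le_iff₀ hθ] at h1; linarith
  have hmpos : 1 ≤ m := by have : 0 < (K + 1)^2 := by positivity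
                           omega
  have hmr : (1:ℝ) ≤ m := by exact_mod_cast hmpos
  have p : (0:ℝ) < (n:ℝ) - 1 := by linarith
  have hbig : (32*(K + 1) / θ)*(2*m)^2 ≤ n := by
    calc (32*(K + 1) / θ)*(2*m)^2 ≤ x*(x^80)^2 := by gcongr
      _ = x^161 := by ring
      _ ≤ x^200 := pow_le_pow_right₀ x1 (by norm_num)
      _ = n := hnx.symm
  have hbig2 : (32*((K:ℝ) + 1))*(2*m)^2 ≤ θ*n := by
    have := mll hbig hθ.le
    have e : θ*((32*((K:ℝ) + 1) / θ)*(2*m)^2) = (32*((K:ℝ) + 1))*(2*m)^2 := by field_simp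
    rw [e] at this; exact this
  have hK0 : (0:ℝ) ≤ K := Nat.cast_nonneg _
  set s := 2*m / ((n:ℝ) - 1) with hs
  have s0 : 0 ≤ s := by positivity
  have h2s : (K + 1)*(2*m*s) ≤ θ / 4 := by
    have h1 : (n:ℝ) ≤ 2*(n - 1) := by linarith
    have : (K + 1)*(2*m*s) = (K + 1)*(2*m)^2 / ((n:ℝ) - 1) := by rw [hs]; ring
    rw [this, div_le_iff₀ p]
    nlinarith only [hbig2, h1, hθ]
  have hms : 0 ≤ 2*m*s := by positivity
  have hsm : s ≤ 2*m*s := by nlinarith only [s0, hmr]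
  have h2sq : (2*(m:ℝ))^2 ≤ n := by
    nlinarith only [hbig2, hθ1, hK0, sq_nonneg (2*(m:ℝ)), mul_nonneg hK0 (sq_nonneg (2*(m:ℝ))), hnr]
  have hδe : ((K + 1 : ℕ) : ℝ) / (n - 1) + 4*((K + 1 : ℕ) : ℝ)^2 / (2*m) ≤ 6*((K:ℝ) + 1)^2 / m := by
    push_cast
    have h1 : ((K:ℝ) + 1) / (n - 1) ≤ 4*(K + 1)^2 / m := by
      rw [div_le_div_iff₀ p (by linarith)]
      have h3 : (m:ℝ) ≤ 4*(n - 1) := by nlinarith only [h2sq, hmr]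
      have h4 : ((K:ℝ) + 1)*m ≤ (K + 1)*(4*(n - 1)) := mll h3 (by linarith)
      have h5 : ((K:ℝ) + 1)*(4*(n - 1)) ≤ (K + 1)^2*(4*(n - 1)) :=
        mlr (by nlinarith only [hK0]) (by linarith)
      linarith
    have h2 : 4*((K:ℝ) + 1)^2 / (2*m) = 2*(K + 1)^2 / m := by field_simp; ring
    rw [h2]
    have : 6*((K:ℝ) + 1)^2 / m = 4*(K + 1)^2 / m + 2*(K + 1)^2 / m := by ring
    linarith
  have hδK : ((K:ℝ) + 1)*(6*((K:ℝ) + 1)^2 / m) ≤ θ := by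
    have : ((K:ℝ) + 1)*(6*((K:ℝ) + 1)^2 / m) = 6*((K:ℝ) + 1)^3 / m := by ring
    rw [this, div_le_iff₀ (by linarith)]; exact hmK
  have hδ0 : 0 ≤ 6*((K:ℝ) + 1)^2 / m := by positivity
  refine R1_core (K := K) (z := x^40) hθ hθ1 hmpos ?_ ?_ ?_ ?_ ?_ ?_ ?_ ?_ ?_
  · have : (2:ℝ)*(2*m) ≤ n := by
      nlinarith only [h2sq, hmr]
    exact_mod_cast this
  · exact le_trans (by linarith) (le_self_pow₀ x1 (by norm_num))
  · calc x^40*(2*(m:ℝ))^2 ≤ x^40*(x^80)^2 := by gcongr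
      _ = (n:ℝ) := by rw [hnx]; ring
  · omega
  · refine (mll hδe hK0).trans ?_
    nlinarith only [hδK, hδ0]
  · refine hδe.trans ?_
    nlinarith only [hδK, hδ0, hK0, hθ1]
  · nlinarith only [h2s, hms, hK0, hθ1]
  · nlinarith only [h2s, hms, hsm, hK0, s0, mll hsm hK0]
  · have h1 : (x^40)^(K + 1) = (n:ℝ)^(((K:ℝ) + 1) / 5) := by
      rw [← pow_mul, hxdef, xpow]; congr 1; push_cast; ring
    rw [h1, div_le_iff₀ (by positivity), ← Real.rpow_add (by linarith)]
    have hn1 : (1:ℝ) ≤ n := by linarith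
    calc (32:ℝ) ≤ x := hx1
      _ ≤ x^200 := le_self_pow₀ x1 (by norm_num)
      _ = (n:ℝ)^(1:ℝ) := by rw [← hnx, Real.rpow_one]
      _ ≤ _ := by
        apply Real.rpow_le_rpow_of_exponent_le hn1
        linarith

def cp {n : ℕ} (D : Fin n → ℕ) : Fin n → ℕ := fun i => n - 1 - D i

lemma cp_cp {n : ℕ} {D : Fin n → ℕ} (h : ∀ i, D i ≤ n - 1) : cp (cp D) = D := by
  funext i; simp only [cp]; have := h i; omega

lemma cp_sum {n : ℕ} {D : Fin n → ℕ} (h : ∀ i, D i ≤ n - 1) : ∑ i, cp D i + ∑ i, D i = n*(n - 1) := by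
  rw [← sum_add_distrib, sum_congr rfl (g := fun _ => n - 1)]
  · simp
  · intro i _; simp only [cp]; have := h i; omega

lemma wt_cp {n : ℕ} {D : Fin n → ℕ} (h : ∀ i, D i ≤ n - 1) : wt n (cp D) = wt n D := by
  unfold wt
  refine Finset.prod_congr rfl fun i _ => ?_
  simp only [cp]; rw [Nat.choose_symm (h i)]

def cE {n : ℕ} (E : Finset (Sym2 (Fin n))) : Finset (Sym2 (Fin n)) :=
  univ.filter (fun e => ¬ e.IsDiag) \ E

lemma cE_cE {n : ℕ} {E : Finset (Sym2 (Fin n))} (hE : E ∈ Graphs n) : cE (cE E) = E := by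
  simp only [Graphs, mem_filter, mem_univ, true_and] at hE
  ext e; simp only [cE, mem_sdiff, mem_filter, mem_univ, true_and]
  have := hE e
  tauto

lemma cE_GD {n : ℕ} {D : Fin n → ℕ} {E : Finset (Sym2 (Fin n))} (hE : E ∈ GD n D) : cE E ∈ GD n (cp D) := by
  rw [mem_GD] at *
  refine ⟨fun v => by simp [cE], fun i => ?_⟩
  have h1 : nb (cE E) i = univ.erase i \ nb E i := by
    ext u; simp only [mem_nb, cE, mem_sdiff, mem_filter, mem_univ, true_and, mem_erase, Sym2.mk_isDiag_iff, and_true]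
    rw [eq_comm]
  have h2 : nb E i ⊆ univ.erase i := by
    intro u hu
    rw [mem_nb] at hu
    simp only [mem_erase, mem_univ, and_true]
    rintro rfl; exact hE.1 _ hu
  rw [deg_eq_nb, h1, card_sdiff_of_subset h2, ← deg_eq_nb, hE.2 i]
  simp [cp]

lemma NN_cp_le {n : ℕ} (D : Fin n → ℕ) : NN n D ≤ NN n (cp D) := by
  unfold NN
  rw [Nat.cast_le]
  apply card_le_card_of_injOn cE (fun E hE => cE_GD hE)
  intro E hE F hF h
  rw [← cE_cE (GD_Graphs hE).1, ← cE_cE (GD_Graphs hF).1, h]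

lemma NN_cp {n : ℕ} {D : Fin n → ℕ} (h : ∀ i, D i ≤ n - 1) : NN n (cp D) = NN n D := by
  apply le_antisymm _ (NN_cp_le D)
  have := NN_cp_le (cp D)
  rwa [cp_cp h] at this

lemma wt_big {n : ℕ} {D : Fin n → ℕ} (h : ¬ ∀ i, D i ≤ n - 1) : wt n D = 0 := by
  push Not at h
  obtain ⟨i, hi⟩ := h
  apply Finset.prod_eq_zero (mem_univ i)
  rw [Nat.choose_eq_zero_of_lt hi]; simp

lemma cpl_le {n m m' : ℕ} (G G' : (Fin n → ℕ) → ℝ) (hG : ∀ D, (∀ i, D i ≤ n - 1) → G D = G' (cp D))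
    (hG0 : ∀ D, (¬ ∀ i, D i ≤ n - 1) → G D = 0) (hG' : ∀ D, 0 ≤ G' D) (hmm : 2*m + 2*m' = n*(n - 1))
    (Gd' : Finset (Fin n → ℕ)) :
    ∑ D ∈ Wt n (2*m) \ (Wt n (2*m)).filter (fun D => (∀ i, D i ≤ n - 1) ∧ cp D ∈ Gd'), G D ≤ ∑ D ∈ Wt n (2*m') \ Gd', G' D := by
  set S := Wt n (2*m) \ (Wt n (2*m)).filter (fun D => (∀ i, D i ≤ n - 1) ∧ cp D ∈ Gd') with hS
  have h1 : ∑ D ∈ S.filter (fun D => ∀ i, D i ≤ n - 1), G D = ∑ D ∈ S, G D := by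
    apply Finset.sum_subset (filter_subset _ _)
    intro D hD hD'
    apply hG0
    intro h
    exact hD' (mem_filter.2 ⟨hD, h⟩)
  rw [← h1]
  have h2 : ∑ D ∈ S.filter (fun D => ∀ i, D i ≤ n - 1), G D = ∑ D ∈ (S.filter (fun D => ∀ i, D i ≤ n - 1)).image cp, G' D := by
    rw [sum_image]
    · exact sum_congr rfl fun D hD => hG D (mem_filter.1 hD).2
    · intro D hD F hF h
      rw [← cp_cp (mem_filter.1 hD).2, ← cp_cp (mem_filter.1 hF).2, h]
  rw [h2]
  apply sum_le_sum_of_subset_of_nonneg _ fun D _ _ => hG' D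
  intro F hF
  obtain ⟨D, hD, rfl⟩ := mem_image.1 hF
  simp only [hS, mem_filter, mem_sdiff, mem_Wt] at hD ⊢
  obtain ⟨⟨h3, h4⟩, h5⟩ := hD
  refine ⟨?_, fun h => h4 ⟨h3, h5, h⟩⟩
  have := cp_sum h5
  omega

lemma Intf_compl {n m : ℕ} {c θ : ℝ} (hm : m ≤ n.choose 2) (h : Intf n (n.choose 2 - m) c θ) : Intf n m c θ := by
  have htc : 2*n.choose 2 = n*(n - 1) := by
    rw [Nat.choose_two_right]
    exact Nat.mul_div_cancel' (Nat.even_mul_pred_self n).two_dvd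
  set m' := n.choose 2 - m with hm'
  have hmm : 2*m + 2*m' = n*(n - 1) := by omega
  have c1 : (n*(n - 1)).choose (2*m) = (n*(n - 1)).choose (2*m') := by
    rw [← Nat.choose_symm (by omega)]; congr 1; omega
  have c2 : (n.choose 2).choose m = (n.choose 2).choose m' := (Nat.choose_symm hm).symm
  have emu : ∀ D : Fin n → ℕ, (∀ i, D i ≤ n - 1) → mu n m D = mu n m' (cp D) := by
    intro D hD; unfold mu; rw [wt_cp hD, c1]
  have enu : ∀ D : Fin n → ℕ, (∀ i, D i ≤ n - 1) → nu n m D = nu n m' (cp D) := by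
    intro D hD; unfold nu; rw [NN_cp hD, c2]
  obtain ⟨Gd', lam, h1, h2, h3, h4, h5⟩ := h
  refine ⟨(Wt n (2*m)).filter (fun D => (∀ i, D i ≤ n - 1) ∧ cp D ∈ Gd'), lam, filter_subset _ _, h2, ?_, ?_, ?_⟩
  · intro D hD
    obtain ⟨_, h6, h7⟩ := mem_filter.1 hD
    rw [emu D h6, enu D h6]
    exact h3 _ h7
  · exact (cpl_le _ _ emu (fun D hD => by unfold mu; rw [wt_big hD, zero_div]) (fun D => mu_nonneg _ _ _) hmm Gd').trans h4
  · exact (cpl_le _ _ enu (fun D hD => by unfold nu; rw [NN_zero (wt_big hD), zero_div]) (fun D => nu_nonneg _ _ _) hmm Gd').trans h5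

lemma fin_real {P Q P' Q' θ ε η lam u v : ℝ} (hθ : 0 < θ) (hθ1 : θ ≤ 1 / 10) (hη : 0 < η) (hε : ε ≤ θ*η) (hε1 : ε ≤ θ)
    (hlam : 0 < lam) (hu : 1 - ε ≤ u) (hu1 : u ≤ 1) (hv : 1 - ε ≤ v) (hv1 : v ≤ 1)
    (h1 : (1 - θ)*lam*u ≤ v) (h2 : v ≤ (1 + θ)*lam*u)
    (p1 : P' ≤ P) (p2 : P ≤ P' + ε) (q1 : Q' ≤ Q) (q2 : Q ≤ Q' + ε) (hQ'0 : 0 ≤ Q')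
    (h3 : (1 - θ)*lam*Q' ≤ P') (h4 : P' ≤ (1 + θ)*lam*Q') (hc : η ≤ P ∨ η ≤ Q) : |P / Q - 1| ≤ 8*θ := by
  have l1 : lam*(1 - θ)^2 ≤ 1 := by
    have : (1 - θ)*lam*(1 - θ) ≤ (1 - θ)*lam*u :=
      mll (by linarith) (mul_nonneg (by linarith) hlam.le)
    nlinarith only [this, h1, hv1]
  have l2 : 1 - θ ≤ (1 + θ)*lam := by
    have : (1 + θ)*lam*u ≤ (1 + θ)*lam*1 :=
      mll hu1 (mul_nonneg (by linarith) hlam.le)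
    linarith
  have β : (1 + θ)*lam ≤ 1 + 5*θ := by
    have e1 : 1 + θ ≤ (1 + 5*θ)*(1 - θ)^2 := by
      nlinarith only [hθ, hθ1, mul_pos hθ hθ, mul_nonneg hθ.le (by linarith : 0 ≤ 1 / 10 - θ), pow_pos hθ 3]
    have e2 := mll e1 hlam.le
    have e3 := mll l1 (by linarith : 0 ≤ 1 + 5*θ)
    linarith
  have α : 1 - 3*θ ≤ (1 - θ)*lam := by
    have e1 : (1 - 3*θ)*(1 + θ) ≤ (1 - θ)*(1 - θ) := by nlinarith only [hθ]
    have e2 := mll l2 (by linarith : 0 ≤ 1 - θ)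
    have e3 : (1 - 3*θ)*(1 + θ) ≤ ((1 - θ)*lam)*(1 + θ) := by linarith
    exact le_of_mul_le_mul_right e3 (by linarith)
  have a1 := (mlr α hQ'0).trans h3
  have a2 := h4.trans (mlr β hQ'0)
  have fin : 0 < Q → P ≤ (1 + 8*θ)*Q → (1 - 8*θ)*Q ≤ P → |P / Q - 1| ≤ 8*θ := by
    intro hQ b1 b2
    rw [abs_le]; constructor
    · have : 1 - 8*θ ≤ P / Q := by rw [le_div_iff₀ hQ]; exact b2
      linarith
    · have : P / Q ≤ 1 + 8*θ := by rw [div_le_iff₀ hQ]; exact b1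
      linarith
  rcases hc with hc | hc
  · have hP : 0 < P := by linarith
    have e : ε ≤ θ*P := hε.trans (mll hc hθ.le)
    have c1 : (1 - θ)*P ≤ (1 + 5*θ)*Q := by
      have := mll q1 (by linarith : 0 ≤ 1 + 5*θ)
      linarith
    have hQ : 0 < Q := by
      by_contra h
      have h5 : 0 < (1 - θ)*P := mul_pos (by linarith) hP
      nlinarith only [h, c1, h5, hθ]
    have c2 : P ≤ (1 + 8*θ)*Q := by
      have e1 : 1 + 5*θ ≤ (1 + 8*θ)*(1 - θ) := by nlinarith only [hθ, hθ1]
      have e2 := mlr e1 hQ.le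
      have e3 : (1 - θ)*P ≤ (1 - θ)*((1 + 8*θ)*Q) := by linarith
      exact le_of_mul_le_mul_left e3 (by linarith)
    refine fin hQ c2 ?_
    have d1 : θ*P ≤ θ*((1 + 8*θ)*Q) := mll c2 hθ.le
    have d2 : θ*((1 + 8*θ)*Q) ≤ 2*θ*Q := by
      have : 8*θ ≤ 1 := by linarith
      nlinarith only [mul_nonneg (mul_nonneg hθ.le hQ.le) (by linarith : 0 ≤ 1 - 8*θ)]
    have d3 : (1 - 2*θ)*Q ≤ Q' := by linarith
    have d4 := mll d3 (by linarith : 0 ≤ 1 - 3*θ)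
    have d5 : (1 - 8*θ)*Q ≤ (1 - 3*θ)*((1 - 2*θ)*Q) := by
      rw [← mul_assoc]; refine mlr ?_ hQ.le
      nlinarith only [hθ]
    linarith
  · have hQ : 0 < Q := by linarith
    have e : ε ≤ θ*Q := hε.trans (mll hc hθ.le)
    have tQ : 0 < θ*Q := mul_pos hθ hQ
    refine fin hQ ?_ ?_
    · have := mll q1 (by linarith : 0 ≤ 1 + 5*θ)
      linarith
    · have d3 : (1 - θ)*Q ≤ Q' := by linarith
      have d4 := mll d3 (by linarith : 0 ≤ 1 - 3*θ)
      have d5 : (1 - 8*θ)*Q ≤ (1 - 3*θ)*((1 - θ)*Q) := by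
        rw [← mul_assoc]; refine mlr ?_ hQ.le
        nlinarith only [hθ]
      linarith

open scoped Classical in
lemma fin_bound {n m : ℕ} {c θ : ℝ} (hc : 0 < c) (hθ : 0 < θ) (hθ1 : θ ≤ 1 / 10) (hm : m ≤ n.choose 2) (hn : 1 / θ ≤ n)
    (h : Intf n m (c + 1) θ) (H : Set (Fin n → ℕ))
    (hH : (n:ℝ)^(-c) ≤ prGEvent n m H ∨ (n:ℝ)^(-c) ≤ prBEvent n m H) :
    |prGEvent n m H / prBEvent n m H - 1| ≤ 8*θ := by
  have hn1 : (1:ℝ) ≤ n := by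
    refine le_trans ?_ hn
    rw [le_div_iff₀ hθ]; linarith
  have hθn : 1 ≤ θ*n := by rw [div_le_iff₀ hθ] at hn; linarith
  have htc : 2*n.choose 2 = n*(n - 1) := by
    rw [Nat.choose_two_right]
    exact Nat.mul_div_cancel' (Nat.even_mul_pred_self n).two_dvd
  have hA : 2*m ≤ n*(n - 1) := by omega
  obtain ⟨Gd, lam, g1, g2, g3, g4, g5⟩ := h
  have hη : (0:ℝ) < (n:ℝ)^(-c) := by positivity
  have hεη : (n:ℝ)^(-(c + 1))*n = (n:ℝ)^(-c) := by
    nth_rewrite 2 [← Real.rpow_one (n:ℝ)]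
    rw [← Real.rpow_add (by linarith)]; congr 1; ring
  have hε0 : (0:ℝ) < (n:ℝ)^(-(c + 1)) := by positivity
  have hη1 : (n:ℝ)^(-c) ≤ 1 := Real.rpow_le_one_of_one_le_of_nonpos hn1 (by linarith)
  have hε : (n:ℝ)^(-(c + 1)) ≤ θ*(n:ℝ)^(-c) := by
    rw [← hεη]
    nlinarith only [hε0, hθn]
  have smu := sum_sdiff (f := mu n m) g1
  have snu := sum_sdiff (f := nu n m) g1
  rw [sum_mu hA] at smu
  rw [sum_nu hm] at snu
  have n1 : 0 ≤ ∑ D ∈ Wt n (2*m) \ Gd, mu n m D := sum_nonneg fun _ _ => mu_nonneg _ _ _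
  have n2 : 0 ≤ ∑ D ∈ Wt n (2*m) \ Gd, nu n m D := sum_nonneg fun _ _ => nu_nonneg _ _ _
  have split : ∀ G : (Fin n → ℕ) → ℝ, (∀ D, 0 ≤ G D) →
      ∑ D ∈ Gd.filter (· ∈ H), G D ≤ ∑ D ∈ (Wt n (2*m)).filter (· ∈ H), G D ∧
      ∑ D ∈ (Wt n (2*m)).filter (· ∈ H), G D ≤ ∑ D ∈ Gd.filter (· ∈ H), G D + ∑ D ∈ Wt n (2*m) \ Gd, G D := by
    intro G hG
    refine ⟨sum_le_sum_of_subset_of_nonneg (filter_subset_filter _ g1) fun D _ _ => hG D, ?_⟩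
    rw [← sum_union]
    · apply sum_le_sum_of_subset_of_nonneg _ fun D _ _ => hG D
      intro D hD
      simp only [mem_filter, mem_union, mem_sdiff] at *
      tauto
    · rw [disjoint_left]
      intro D h1 h2
      simp only [mem_filter, mem_sdiff] at *
      tauto
  have sP := split (nu n m) (nu_nonneg n m)
  have sQ := split (mu n m) (mu_nonneg n m)
  rw [← prG_eq] at sP
  rw [← prB_eq] at sQ
  refine fin_real (lam := lam) (u := ∑ D ∈ Gd, mu n m D) (v := ∑ D ∈ Gd, nu n m D)
    (P' := ∑ D ∈ Gd.filter (· ∈ H), nu n m D) (Q' := ∑ D ∈ Gd.filter (· ∈ H), mu n m D)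
    hθ hθ1 hη hε ?_ g2 (by linarith) (by linarith) (by linarith) (by linarith) ?_ ?_ sP.1 (by linarith [sP.2]) sQ.1 (by linarith [sQ.2])
    (sum_nonneg fun _ _ => mu_nonneg _ _ _) ?_ ?_ hH
  · nlinarith only [hε, hη1, hθ]
  · rw [mul_sum]; exact sum_le_sum fun D hD => (g3 D hD).1
  · rw [mul_sum]; exact sum_le_sum fun D hD => (g3 D hD).2
  · rw [mul_sum]; exact sum_le_sum fun D hD => (g3 D (mem_filter.1 hD).1).1
  · rw [mul_sum]; exact sum_le_sum fun D hD => (g3 D (mem_filter.1 hD).1).2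

lemma Intf_all (c θ : ℝ) (hc : 0 < c) (hθ : 0 < θ) (hθ1 : θ ≤ 1) : ∃ m0 : ℕ, ∀ᶠ n : ℕ in Filter.atTop, ∀ m : ℕ,
    m0 ≤ m → m + m0 ≤ n.choose 2 → Intf n m c θ := by
  obtain ⟨m0, h1⟩ := R1 c θ hc hθ hθ1
  refine ⟨m0, ?_⟩
  filter_upwards [h1, R2 c θ hc hθ hθ1, R3 c θ hc hθ hθ1] with n a1 a2 a3
  have half : ∀ m, m0 ≤ m → 2*m ≤ n.choose 2 → Intf n m c θ := by
    intro m hm hm2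
    rcases le_total (2*(m:ℝ)) ((n:ℝ)^(2/5:ℝ)) with h | h
    · exact a1 m hm h
    · rcases le_total (2*(m:ℝ)) ((n:ℝ)^(13/10:ℝ)) with h' | h'
      · exact a2 m h h'
      · exact a3 m h' hm2
  intro m hm hm2
  rcases le_total (2*m) (n.choose 2) with h | h
  · exact half m hm h
  · exact Intf_compl (by omega) (half _ (by omega) (by omega))

/-- The degree sequence of `G(n,m)` and `B_m(n)` are asymptotically quite equivalent. -/
theorem degree_sequence_aqe (m : ℕ → ℕ)
    (hm : Filter.Tendsto
      (fun n => (min (m n) (n.choose 2 - m n) : ℝ) / Real.log n)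
      Filter.atTop Filter.atTop) :
    ∀ c : ℝ, 0 < c →
      ∀ H : (n : ℕ) → Set (Fin n → ℕ),
        (∀ᶠ n : ℕ in Filter.atTop,
          (n : ℝ) ^ (-c) ≤ prGEvent n (m n) (H n) ∨
          (n : ℝ) ^ (-c) ≤ prBEvent n (m n) (H n)) →
        Filter.Tendsto (fun n => prGEvent n (m n) (H n) / prBEvent n (m n) (H n))
          Filter.atTop (nhds 1) := by
  intro c hc H hH
  rw [Metric.tendsto_nhds]
  intro ε hε
  set θ : ℝ := min (1 / 10) (ε / 9) with hθd
  have hθ : 0 < θ := lt_min (by norm_num) (by linarith)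
  have hθ1 : θ ≤ 1 / 10 := min_le_left _ _
  have hθ2 : θ ≤ ε / 9 := min_le_right _ _
  obtain ⟨m0, h0⟩ := Intf_all (c + 1) θ (by linarith) hθ (by linarith)
  have hlog : ∀ᶠ n : ℕ in Filter.atTop, (m0:ℝ) + 1 ≤ Real.log n :=
    (Real.tendsto_log_atTop.comp tendsto_natCast_atTop_atTop).eventually_ge_atTop _
  have hnn : ∀ᶠ n : ℕ in Filter.atTop, 1 / θ ≤ (n:ℝ) :=
    tendsto_natCast_atTop_atTop.eventually_ge_atTop _
  filter_upwards [h0, hlog, hnn, hm.eventually_ge_atTop 1, hH] with n a1 a2 a3 a4 a5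
  have hm0 : (0:ℝ) ≤ m0 := Nat.cast_nonneg _
  rw [le_div_iff₀ (by linarith), one_mul] at a4
  have b1 := a4.trans (min_le_left _ _)
  have b2 := a4.trans (min_le_right _ _)
  have c1 : m0 ≤ m n := by
    have : (m0:ℝ) ≤ m n := by linarith
    exact_mod_cast this
  have c2 : m n + m0 ≤ n.choose 2 := by
    have : (m n : ℝ) + m0 ≤ n.choose 2 := by linarith
    exact_mod_cast this
  rw [Real.dist_eq]
  have := fin_bound hc hθ hθ1 (by omega) a3 (a1 _ c1 c2) (H n) a5
  linarith
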